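/- Let d = 3. Let V₁, V₂ be continuous real functions on ℝ³ satisfying |V_j(x)| ≤ C₀(1+|x|²)^{−β/2} on ℝ³ for some β > 2 and C₀ > 0 (j = 1,2). Assume that for j = 1,2 the functional Q_{V_j} is critical in ℝ³. Then there exists r₀ > 0 such that for every R ∈ ℝ³ with |R| ≥ r₀ the functional Q_{V₁ + V₂^R} is supercritical (i.e., Q_{V₁+V₂^R}(u) < 0 for some u ∈ C_c^∞(ℝ³)); moreover, lim_{|R|→∞} |R|² E(R) = −b², where b is the unique positive real root of the equation s = e^{−s} (so that −b² < −1/4). -/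

import Mathlib

open MeasureTheory Filter
open scoped Topology

noncomputable section

abbrev Ed (d : ℕ) := EuclideanSpace ℝ (Fin d)

/-- A smooth compactly supported test function on ℝ^d. -/
def IsTest {d : ℕ} (u : Ed d → ℝ) : Prop :=
  ContDiff ℝ (⊤ : ℕ∞) u ∧ HasCompactSupport u

/-- The quadratic functional `Q_V(u) = ∫ (|∇u|² + V u²) dx`. -/
def Qf {d : ℕ} (V : Ed d → ℝ) (u : Ed d → ℝ) : ℝ :=
  ∫ x, (‖gradient u x‖ ^ 2 + V x * u x ^ 2)

/-- `Q_V` is supercritical in ℝ^d: `Q_V(u) < 0` for some test function `u`. -/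
def Supercrit {d : ℕ} (V : Ed d → ℝ) : Prop :=
  ∃ u, IsTest u ∧ Qf V u < 0

/-- A null sequence for `Q_V`. -/
def NullSeq {d : ℕ} (V : Ed d → ℝ) (un : ℕ → Ed d → ℝ) : Prop :=
  (∀ n, IsTest (un n)) ∧ (∀ n x, 0 ≤ un n x) ∧
  (∃ B : Set (Ed d), IsOpen B ∧ Bornology.IsBounded B ∧
    ∀ n, (∫ x in B, un n x ^ 2) = 1) ∧
  Tendsto (fun n => Qf V (un n)) atTop (𝓝 0)

/-- A ground state of `Q_V`: a positive C¹ function that is the limit of a null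
sequence in `L²(K)` for every compact `K`. -/
def GroundState {d : ℕ} (V : Ed d → ℝ) (φ : Ed d → ℝ) : Prop :=
  ContDiff ℝ 1 φ ∧ (∀ x, 0 < φ x) ∧
  ∃ un, NullSeq V un ∧ ∀ K : Set (Ed d), IsCompact K →
    Tendsto (fun n => ∫ x in K, (un n x - φ x) ^ 2) atTop (𝓝 0)

/-- `Q_V` is critical in ℝ^d. -/
def Crit {d : ℕ} (V : Ed d → ℝ) : Prop :=
  (∀ u, IsTest u → 0 ≤ Qf V u) ∧ ∃ φ, GroundState V φ

/-- The ground-state energy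
`E = sup{λ : ∫(|∇u|² + V u²) ≥ λ ∫ u² for all test functions u}`. -/
def Energy {d : ℕ} (V : Ed d → ℝ) : ℝ :=
  sSup {l : ℝ | ∀ u, IsTest u → l * ∫ x, u x ^ 2 ≤ Qf V u}

abbrev E3 := Ed 3

/-- C¹ functions with compact support -/
def C1c (u : E3 → ℝ) : Prop := ContDiff ℝ 1 u ∧ HasCompactSupport u

lemma IsTest.c1c {u : E3 → ℝ} (h : IsTest u) : C1c u := ⟨h.1.of_le (by exact_mod_cast le_top), h.2⟩

lemma hg_mul {f g : E3 → ℝ} {f' g' x : E3} (hf : HasGradientAt f f' x) (hg : HasGradientAt g g' x) :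
    HasGradientAt (fun y => f y * g y) (f x • g' + g x • f') x := by
  rw [hasGradientAt_iff_hasFDerivAt] at *
  refine HasFDerivAt.congr_fderiv (hf.mul hg) ?_
  ext v; simp

lemma hg_add {f g : E3 → ℝ} {f' g' x : E3} (hf : HasGradientAt f f' x) (hg : HasGradientAt g g' x) :
    HasGradientAt (fun y => f y + g y) (f' + g') x := by
  rw [hasGradientAt_iff_hasFDerivAt] at *
  refine HasFDerivAt.congr_fderiv (hf.add hg) ?_
  ext v; simp

lemma hg_sub {f g : E3 → ℝ} {f' g' x : E3} (hf : HasGradientAt f f' x) (hg : HasGradientAt g g' x) :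
    HasGradientAt (fun y => f y - g y) (f' - g') x := by
  rw [hasGradientAt_iff_hasFDerivAt] at *
  refine HasFDerivAt.congr_fderiv (hf.sub hg) ?_
  ext v; simp

lemma hg_comp {f : E3 → ℝ} {f' x : E3} {k : ℝ → ℝ} {k' : ℝ} (hk : HasDerivAt k k' (f x))
    (hf : HasGradientAt f f' x) :
    HasGradientAt (fun y => k (f y)) (k' • f') x := by
  rw [hasGradientAt_iff_hasFDerivAt] at *
  refine HasFDerivAt.congr_fderiv (hk.comp_hasFDerivAt x hf) ?_
  ext v; simp

lemma hg_normsq (p x : E3) : HasGradientAt (fun y => ‖y - p‖ ^ 2) ((2:ℝ) • (x - p)) x := by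
  rw [hasGradientAt_iff_hasFDerivAt]
  have h := ((hasFDerivAt_id (𝕜 := ℝ) x).sub_const p).norm_sq
  refine h.congr_fderiv ?_
  ext v
  simp

lemma hg_norm (p x : E3) (hx : x ≠ p) : HasGradientAt (fun y => ‖y - p‖) ((1 / ‖x - p‖) • (x - p)) x := by
  have hn : (0:ℝ) < ‖x - p‖ := norm_pos_iff.2 (sub_ne_zero.2 hx)
  have h := hg_comp (k := Real.sqrt) (f := fun y => ‖y - p‖ ^ 2) (Real.hasDerivAt_sqrt (x := ‖x - p‖ ^ (2:ℕ)) (by positivity)) (hg_normsq p x)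
  have e : (fun y : E3 => Real.sqrt (‖y - p‖ ^ 2)) = fun y => ‖y - p‖ := by
    ext y; exact Real.sqrt_sq (norm_nonneg _)
  rw [e, Real.sqrt_sq hn.le, smul_smul] at h
  convert h using 2
  field_simp

lemma C1.hg {u : E3 → ℝ} (h : ContDiff ℝ 1 u) (x : E3) : HasGradientAt u (gradient u x) x :=
  ((h.differentiable (by norm_num)) x).hasGradientAt

lemma C1.cont_grad {u : E3 → ℝ} (h : ContDiff ℝ 1 u) : Continuous (fun x => gradient u x) := by
  have : Continuous (fderiv ℝ u) := h.continuous_fderiv (by norm_num)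
  exact (InnerProductSpace.toDual ℝ E3).symm.continuous.comp this

lemma C1c.mul {f u : E3 → ℝ} (hf : ContDiff ℝ 1 f) (hu : C1c u) : C1c (fun x => f x * u x) :=
  ⟨hf.mul hu.1, hu.2.mul_left⟩

lemma C1c.mul' {f u : E3 → ℝ} (hf : ContDiff ℝ 1 f) (hu : C1c u) : C1c (fun x => u x * f x) :=
  ⟨hu.1.mul hf, hu.2.mul_right⟩

lemma C1c.add {f u : E3 → ℝ} (hf : C1c f) (hu : C1c u) : C1c (fun x => f x + u x) :=
  ⟨hf.1.add hu.1, hf.2.add hu.2⟩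

lemma C1c.grad_supp {u : E3 → ℝ} (h : C1c u) : HasCompactSupport (fun x => gradient u x) := by
  have := h.2.fderiv (𝕜 := ℝ)
  exact this.comp_left (g := (InnerProductSpace.toDual ℝ E3).symm) (by simp)

lemma C1c.int_grad_inner {u : E3 → ℝ} (h : C1c u) {F : E3 → E3} (hF : Continuous F) :
    Integrable (fun x => inner ℝ (F x) (gradient u x)) := by
  refine Continuous.integrable_of_hasCompactSupport (hF.inner (C1.cont_grad h.1)) ?_
  refine h.grad_supp.mono ?_
  intro x hx
  simp only [Function.mem_support] at *
  intro h0; apply hx; rw [h0]; simp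

lemma C1c.int_mul {u : E3 → ℝ} (h : C1c u) {F : E3 → ℝ} (hF : Continuous F) :
    Integrable (fun x => F x * u x) :=
  Continuous.integrable_of_hasCompactSupport (hF.mul h.1.continuous) h.2.mul_left

lemma C1c.int_grad_sq {u : E3 → ℝ} (h : C1c u) : Integrable (fun x => ‖gradient u x‖ ^ 2) := by
  have := h.int_grad_inner (C1.cont_grad h.1)
  simpa using this

lemma C1c.int_sq {u : E3 → ℝ} (h : C1c u) {W : E3 → ℝ} (hW : Continuous W) :
    Integrable (fun x => W x * u x ^ 2) := by
  have := h.int_mul (hW.mul h.1.continuous)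
  refine this.congr (Eventually.of_forall fun x => ?_)
  simp only [Pi.mul_apply]; ring

lemma Qf_eq {u W : E3 → ℝ} (h : C1c u) (hW : Continuous W) :
    Qf W u = (∫ x, ‖gradient u x‖ ^ 2) + ∫ x, W x * u x ^ 2 :=
  integral_add h.int_grad_sq (h.int_sq hW)

/-- divergence theorem for the field `H (x-p)` -/
lemma euler {H : E3 → ℝ} (h : C1c H) (p : E3) :
    ∫ x, inner ℝ (x - p) (gradient H x) = - ∫ x, 3 * H x := by
  have key : ∀ i : Fin 3, ∫ x : E3, (x - p) i * fderiv ℝ H x (EuclideanSpace.single i 1)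
      = - ∫ x, H x := by
    intro i
    have hd : ∀ x : E3, HasFDerivAt (fun x : E3 => (x - p) i) (EuclideanSpace.proj i : E3 →L[ℝ] ℝ) x := by
      intro x
      have := (EuclideanSpace.proj i : E3 →L[ℝ] ℝ).hasFDerivAt (x := x)
      have h2 := this.sub_const (p i)
      exact h2
    have hcf : Continuous (fun x => fderiv ℝ H x (EuclideanSpace.single i 1)) :=
      (h.1.continuous_fderiv (by norm_num)).clm_apply continuous_const
    have hcs : HasCompactSupport (fun x => fderiv ℝ H x (EuclideanSpace.single i 1)) :=
      h.2.fderiv_apply (𝕜 := ℝ) _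
    have hc1 : Continuous (fun x : E3 => (x - p) i) := by fun_prop
    have e1 : ∀ x : E3, fderiv ℝ (fun x : E3 => (x - p) i) x (EuclideanSpace.single i 1) = 1 := by
      intro x; rw [(hd x).fderiv]; simp
    have := integral_mul_fderiv_eq_neg_fderiv_mul_of_integrable (μ := volume) (𝕜 := ℝ)
      (f := fun x : E3 => (x - p) i) (g := H) (v := EuclideanSpace.single i 1) ?_ ?_ ?_ ?_ ?_
    · rw [this]; simp only [e1, one_mul]
    · simp only [e1, one_mul]; exact h.1.continuous.integrable_of_hasCompactSupport h.2
    · exact (hc1.mul hcf).integrable_of_hasCompactSupport hcs.mul_left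
    · exact (hc1.mul h.1.continuous).integrable_of_hasCompactSupport h.2.mul_left
    · intro x _; exact (hd x).differentiableAt
    · intro x _; exact h.1.differentiable (by norm_num) x
  have hint : ∀ i : Fin 3, Integrable (fun x : E3 => (x - p) i * fderiv ℝ H x (EuclideanSpace.single i 1)) := by
    intro i
    have hcf : Continuous (fun x => fderiv ℝ H x (EuclideanSpace.single i 1)) :=
      (h.1.continuous_fderiv (by norm_num)).clm_apply continuous_const
    have hcs : HasCompactSupport (fun x => fderiv ℝ H x (EuclideanSpace.single i 1)) :=
      h.2.fderiv_apply (𝕜 := ℝ) _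
    have hc1 : Continuous (fun x : E3 => (x - p) i) := by fun_prop
    exact (hc1.mul hcf).integrable_of_hasCompactSupport hcs.mul_left
  have e : ∀ x, inner ℝ (x - p) (gradient H x) =
      ∑ i, (x - p) i * fderiv ℝ H x (EuclideanSpace.single i 1) := by
    intro x
    rw [real_inner_comm, inner_gradient_left]
    conv_lhs => rw [← (EuclideanSpace.basisFun (Fin 3) ℝ).sum_repr (x - p)]
    simp
  simp_rw [e]
  rw [integral_finsetSum _ (fun i _ => hint i)]
  simp_rw [key]
  rw [integral_const_mul]
  simp
  try ring

lemma mollify {v : E3 → ℝ} (h : C1c v) {ε : ℝ} (hε : 0 < ε) :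
    ∃ w : E3 → ℝ, IsTest w ∧ (∀ x, |w x - v x| ≤ ε) ∧ (∀ x, ‖gradient w x - gradient v x‖ ≤ ε) ∧
      ∀ x, x ∉ Metric.cthickening 1 (tsupport v) → w x = 0 := by
  have hu1 : UniformContinuous v := h.2.uniformContinuous_of_continuous h.1.continuous
  have hcf : Continuous (fderiv ℝ v) := h.1.continuous_fderiv (by norm_num)
  have hu2 : UniformContinuous (fderiv ℝ v) := (h.2.fderiv (𝕜 := ℝ)).uniformContinuous_of_continuous hcf
  obtain ⟨δ1, hδ1, H1⟩ := Metric.uniformContinuous_iff.1 hu1 ε hε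
  obtain ⟨δ2, hδ2, H2⟩ := Metric.uniformContinuous_iff.1 hu2 ε hε
  set ρ := min 1 (min δ1 δ2) with hρ
  have hρ0 : 0 < ρ := by positivity
  let B : ContDiffBump (0 : E3) := ⟨ρ / 2, ρ, by positivity, by linarith⟩
  have hB : B.rOut = ρ := rfl
  let w : E3 → ℝ := convolution (B.normed volume) v (ContinuousLinearMap.lsmul ℝ ℝ) volume
  have hli : LocallyIntegrable (B.normed (volume : Measure E3)) volume :=
    B.continuous_normed.locallyIntegrable
  have hd : ∀ x, HasFDerivAt w (convolution (B.normed volume) (fderiv ℝ v)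
      ((ContinuousLinearMap.lsmul ℝ ℝ).precompR E3) volume x) x := fun x =>
    h.2.hasFDerivAt_convolution_right _ hli h.1 x
  have he : ∀ x, convolution (B.normed volume) (fderiv ℝ v)
      ((ContinuousLinearMap.lsmul ℝ ℝ).precompR E3) volume x = convolution (B.normed volume) (fderiv ℝ v)
      (ContinuousLinearMap.lsmul ℝ ℝ) volume x := by
    intro x; rfl
  refine ⟨w, ⟨?_, ?_⟩, ?_, ?_, ?_⟩
  · exact B.hasCompactSupport_normed.contDiff_convolution_left _ B.contDiff_normed
      h.1.continuous.locallyIntegrable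
  · exact B.hasCompactSupport_normed.convolution _ h.2
  · intro x
    have := B.dist_normed_convolution_le (μ := (volume : Measure E3)) (g := v) (x₀ := x) (ε := ε)
      h.1.continuous.aestronglyMeasurable ?_
    · simpa [Real.dist_eq] using this
    · intro y hy
      refine (H1 ?_).le
      have : dist y x < ρ := hy
      exact lt_of_lt_of_le this ((min_le_right _ _).trans (min_le_left _ _))
  · intro x
    have := B.dist_normed_convolution_le (μ := (volume : Measure E3)) (g := fderiv ℝ v) (x₀ := x) (ε := ε)
      hcf.aestronglyMeasurable ?_
    · rw [← he x, ← (hd x).fderiv, dist_eq_norm] at this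
      have e2 : gradient w x - gradient v x = (InnerProductSpace.toDual ℝ E3).symm (fderiv ℝ w x - fderiv ℝ v x) := by
        rw [map_sub]; rfl
      rw [e2, LinearIsometryEquiv.norm_map]
      exact this
    · intro y hy
      refine (H2 ?_).le
      have : dist y x < ρ := hy
      exact lt_of_lt_of_le this ((min_le_right _ _).trans (min_le_right _ _))
  · intro x hx
    by_contra h0
    have hs := support_convolution_subset (μ := (volume : Measure E3)) (f := B.normed volume) (g := v)
      (ContinuousLinearMap.lsmul ℝ ℝ) (Function.mem_support.2 h0)
    rw [B.support_normed_eq] at hs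
    obtain ⟨a, ha, b, hb, rfl⟩ := hs
    apply hx
    refine Metric.mem_cthickening_of_dist_le _ b _ _ (subset_tsupport _ hb) ?_
    have : ‖a‖ < ρ := by simpa using ha
    rw [dist_eq_norm]
    simp only [add_sub_cancel_right]
    exact this.le.trans (min_le_left _ _)

lemma moll_tendsto {v : E3 → ℝ} (h : C1c v) :
    ∃ w : ℕ → E3 → ℝ, (∀ n, IsTest (w n)) ∧ ∀ F : E3 → ℝ → E3 → ℝ,
      Continuous (fun q : E3 × ℝ × E3 => F q.1 q.2.1 q.2.2) → (∀ x, F x 0 0 = 0) →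
      Tendsto (fun n => ∫ x, F x (w n x) (gradient (w n) x)) atTop (𝓝 (∫ x, F x (v x) (gradient v x))) := by
  choose w hw1 hw2 hw3 hw4 using fun n : ℕ => mollify h (ε := 1 / ((n:ℝ) + 1)) (by positivity)
  refine ⟨w, hw1, fun F hF hF0 => ?_⟩
  set K := Metric.cthickening 1 (tsupport v) with hK
  have hKc : IsCompact K := h.2.isCompact.cthickening
  have hKcl : IsClosed K := Metric.isClosed_cthickening
  have hgz : ∀ n x, x ∉ K → gradient (w n) x = 0 := by
    intro n x hx
    have : w n =ᶠ[𝓝 x] fun _ => 0 := by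
      filter_upwards [hKcl.isOpen_compl.mem_nhds hx] with y hy using hw4 n y hy
    rw [this.gradient_eq]
    simp [gradient]
  obtain ⟨M1, hM1⟩ := h.2.exists_bound_of_continuous h.1.continuous
  obtain ⟨M2, hM2⟩ := h.grad_supp.exists_bound_of_continuous (C1.cont_grad h.1)
  have hS : IsCompact (K ×ˢ (Metric.closedBall (0:ℝ) (M1 + 1) ×ˢ Metric.closedBall (0:E3) (M2 + 1))) :=
    hKc.prod ((isCompact_closedBall _ _).prod (isCompact_closedBall _ _))
  obtain ⟨C, hC⟩ := hS.exists_bound_of_continuousOn hF.continuousOn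
  have hle : ∀ n : ℕ, 1 / ((n:ℝ) + 1) ≤ 1 := by
    intro n; rw [div_le_one (by positivity)]; have : (0:ℝ) ≤ n := n.cast_nonneg
    linarith
  have hlim : Tendsto (fun n : ℕ => 1 / ((n:ℝ) + 1)) atTop (𝓝 0) := tendsto_one_div_add_atTop_nhds_zero_nat
  refine tendsto_integral_of_dominated_convergence (K.indicator fun _ => C) ?_ ?_ ?_ ?_
  · intro n
    have h1 := (hw1 n).c1c
    exact (hF.comp (continuous_id.prodMk (h1.1.continuous.prodMk (C1.cont_grad h1.1)))).aestronglyMeasurable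
  · exact (integrableOn_const hKc.measure_lt_top.ne).integrable_indicator hKcl.measurableSet
  · intro n
    refine Eventually.of_forall fun x => ?_
    by_cases hx : x ∈ K
    · rw [Set.indicator_of_mem hx]
      refine hC (x, w n x, gradient (w n) x) ⟨hx, ?_, ?_⟩
      · simp only [Metric.mem_closedBall, dist_zero_right]
        have := hw2 n x
        have h3 := hM1 x
        have := hle n
        calc ‖w n x‖ = ‖(w n x - v x) + v x‖ := by ring_nf
          _ ≤ _ := norm_add_le _ _
          _ ≤ _ := by rw [Real.norm_eq_abs (w n x - v x)]; linarith
      · simp only [Metric.mem_closedBall, dist_zero_right]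
        have := hw3 n x
        have h3 := hM2 x
        have := hle n
        calc ‖gradient (w n) x‖ = ‖(gradient (w n) x - gradient v x) + gradient v x‖ := by simp
          _ ≤ _ := norm_add_le _ _
          _ ≤ _ := by linarith
    · rw [Set.indicator_of_notMem hx, hw4 n x hx, hgz n x hx, hF0]; simp
  · refine Eventually.of_forall fun x => ?_
    have t1 : Tendsto (fun n => w n x) atTop (𝓝 (v x)) := by
      rw [tendsto_iff_dist_tendsto_zero]
      exact squeeze_zero (fun _ => dist_nonneg) (fun n => by rw [Real.dist_eq]; exact hw2 n x) hlim
    have t2 : Tendsto (fun n => gradient (w n) x) atTop (𝓝 (gradient v x)) := by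
      rw [tendsto_iff_dist_tendsto_zero]
      exact squeeze_zero (fun _ => dist_nonneg) (fun n => by rw [dist_eq_norm]; exact hw3 n x) hlim
    exact (hF.tendsto (x, v x, gradient v x)).comp
      (tendsto_const_nhds.prodMk_nhds (t1.prodMk_nhds t2))

lemma moll_Q {v W : E3 → ℝ} (h : C1c v) (hW : Continuous W) (hneg : Qf W v < 0) :
    ∃ w, IsTest w ∧ Qf W w < 0 := by
  obtain ⟨w, hw, ht⟩ := moll_tendsto h
  have := ht (fun x a p => ‖p‖ ^ 2 + W x * a ^ 2) (by fun_prop) (by simp)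
  obtain ⟨n, hn⟩ := (this.eventually_lt_const hneg).exists
  exact ⟨w n, hw n, hn⟩

lemma Q_nonneg_c1c {v W : E3 → ℝ} (h : C1c v) (hW : Continuous W) (hpos : ∀ u, IsTest u → 0 ≤ Qf W u) :
    0 ≤ Qf W v := by
  by_contra hh
  obtain ⟨w, hw, hn⟩ := moll_Q h hW (not_le.1 hh)
  exact absurd (hpos w hw) (not_le.2 hn)

/-- `φ` is a weak solution of `-Δφ + V φ = 0`. -/
def WeakSol (V φ : E3 → ℝ) : Prop :=
  ∀ v, C1c v → ∫ x, inner ℝ (gradient φ x) (gradient v x) = - ∫ x, V x * φ x * v x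

lemma weak_of_test {V φ : E3 → ℝ} (hV : Continuous V) (hφ : ContDiff ℝ 1 φ)
    (H : ∀ v, IsTest v → ∫ x, (inner ℝ (gradient φ x) (gradient v x) + V x * φ x * v x) = 0) :
    WeakSol V φ := by
  intro v hv
  obtain ⟨w, hw, ht⟩ := moll_tendsto hv
  have hg := C1.cont_grad hφ
  have hφc := hφ.continuous
  have := ht (fun x a p => inner ℝ (gradient φ x) p + V x * φ x * a) (by fun_prop) (by simp)
  have e : ∀ n, ∫ x, (inner ℝ (gradient φ x) (gradient (w n) x) + V x * φ x * w n x) = 0 := fun n => H _ (hw n)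
  simp only [e] at this
  have := tendsto_nhds_unique this tendsto_const_nhds
  rw [integral_add (hv.int_grad_inner hg) (hv.int_mul (F := fun x => V x * φ x) (hV.mul hφc))] at this
  linarith

lemma C1c.integrable_of {u G : E3 → ℝ} (h : C1c u) (hG : Continuous G)
    (h0 : ∀ x, u x = 0 → gradient u x = 0 → G x = 0) : Integrable G := by
  refine hG.integrable_of_hasCompactSupport ?_
  refine HasCompactSupport.intro h.2.isCompact fun x hx => ?_
  refine h0 x (image_eq_zero_of_notMem_tsupport hx) ?_
  have hz : u =ᶠ[𝓝 x] fun _ => 0 := by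
    filter_upwards [(isClosed_tsupport u).isOpen_compl.mem_nhds hx] with y hy using
      image_eq_zero_of_notMem_tsupport hy
  rw [hz.gradient_eq]
  simp [gradient]

/-- Hardy inequality -/
lemma hardy {u : E3 → ℝ} (h : C1c u) :
    (1/4) * ∫ x, u x ^ 2 / (1 + ‖x‖ ^ 2) ≤ ∫ x, ‖gradient u x‖ ^ 2 := by
  let a : E3 → ℝ := fun x => (1/2) * (1 + ‖x‖ ^ 2)⁻¹
  have hpos : ∀ x : E3, 0 < 1 + ‖x‖ ^ 2 := fun x => by positivity
  have ha : ContDiff ℝ 1 a := by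
    refine contDiff_const.mul (ContDiff.inv (contDiff_const.add (contDiff_norm_sq ℝ)) fun x => (hpos x).ne')
  have hga : ∀ x, HasGradientAt a ((-(1 + ‖x‖^2)⁻¹^2) • x) x := by
    intro x
    have h1 := hg_normsq 0 x
    have hk : HasDerivAt (fun t : ℝ => (1/2) * (1 + t)⁻¹) ((1/2) * (-1 / (1 + ‖x - 0‖^2)^2)) (‖x - 0‖^2) := by
      refine HasDerivAt.const_mul _ ?_
      exact ((hasDerivAt_id _).const_add 1).inv (by simpa using (hpos x).ne')
    have := hg_comp hk h1
    simp only [sub_zero, smul_smul] at this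
    convert this using 2
    field_simp
  have hH : C1c (fun x => a x * (u x * u x)) := C1c.mul ha (C1c.mul h.1 h)
  have hgH : ∀ x, gradient (fun x => a x * (u x * u x)) x =
      a x • (u x • gradient u x + u x • gradient u x) + (u x * u x) • ((-(1 + ‖x‖^2)⁻¹^2) • x) := fun x =>
    (hg_mul (hga x) (hg_mul (C1.hg h.1 x) (C1.hg h.1 x))).gradient
  have he := euler hH 0
  have hc : Continuous a := ha.continuous
  have hgc := C1.cont_grad h.1
  have huc := h.1.continuous
  have hI1 : Integrable (fun x => inner ℝ (x - 0) (gradient (fun x => a x * (u x * u x)) x)) :=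
    hH.int_grad_inner (by fun_prop)
  have hI2 : Integrable (fun x => 3 * (a x * (u x * u x))) :=
    (hH.1.continuous.integrable_of_hasCompactSupport hH.2).const_mul 3
  have hI3 := h.int_grad_sq
  have hI4 : Integrable (fun x => u x ^ 2 / (1 + ‖x‖ ^ 2)) := by
    refine h.integrable_of (by fun_prop (disch := intro x; positivity)) ?_
    intro x h0 _; simp [h0]
  have key : 0 ≤ ∫ x, (((‖gradient u x‖ ^ 2 + inner ℝ (x - 0) (gradient (fun x => a x * (u x * u x)) x))
      + 3 * (a x * (u x * u x))) - (1/4) * (u x ^ 2 / (1 + ‖x‖ ^ 2))) := by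
    refine integral_nonneg fun x => ?_
    have hs := hpos x
    have e0 : (0:ℝ) ≤ ‖gradient u x + (a x * u x) • x‖ ^ 2 := by positivity
    rw [@norm_add_sq_real, norm_smul, inner_smul_right, mul_pow, Real.norm_eq_abs, sq_abs] at e0
    simp only [Pi.zero_apply]
    rw [hgH x]
    simp only [sub_zero, inner_add_right, inner_smul_right, real_inner_self_eq_norm_sq]
    rw [real_inner_comm] at e0
    have e1 : 3 * (a x * (u x * u x)) - (1/4) * (u x ^ 2 / (1 + ‖x‖ ^ 2)) - (1 + ‖x‖^2)⁻¹^2 * ‖x‖^2 * (u x)^2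
       - (a x * u x)^2 * ‖x‖^2 = (5/4) * u x ^2 / (1 + ‖x‖^2)^2 := by
      simp only [a]; field_simp; ring
    have e2 : 0 ≤ (5/4) * u x ^2 / (1 + ‖x‖^2)^2 := by positivity
    nlinarith
  rw [integral_sub (by exact (hI3.add hI1).add hI2) (by exact hI4.const_mul _),
    integral_add (by exact hI3.add hI1) hI2, integral_add hI3 hI1, he, integral_const_mul (1/4 : ℝ)] at key
  linarith

lemma disc_le {a b c : ℝ} (h : ∀ t : ℝ, 0 ≤ a + 2 * t * c + t ^ 2 * b) : c ^ 2 ≤ a * b := by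
  have := discrim_le_zero (a := b) (b := 2 * c) (c := a) (fun x => by have := h x; nlinarith)
  unfold discrim at this
  nlinarith

lemma inner_grad_sum (a b : E3 → ℝ) (x : E3) : inner ℝ (gradient a x) (gradient b x) =
      ∑ i, fderiv ℝ a x (EuclideanSpace.single i 1) * fderiv ℝ b x (EuclideanSpace.single i 1) := by
  rw [inner_gradient_left]
  conv_lhs => rw [← (EuclideanSpace.basisFun (Fin 3) ℝ).sum_repr (gradient b x)]
  simp only [map_sum, map_smul]
  refine Finset.sum_congr rfl fun i _ => ?_
  rw [smul_eq_mul, mul_comm]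
  congr 1
  · simp
  · have : inner ℝ (gradient b x) (EuclideanSpace.single i (1:ℝ)) = fderiv ℝ b x (EuclideanSpace.single i 1) :=
      inner_gradient_left 
    rw [← this, EuclideanSpace.inner_single_right]
    simp

lemma lap_exists {v : E3 → ℝ} (hv : IsTest v) :
    ∃ D : E3 → ℝ, Continuous D ∧ HasCompactSupport D ∧
      ∀ u : E3 → ℝ, ContDiff ℝ 1 u → ∫ x, inner ℝ (gradient u x) (gradient v x) = - ∫ x, u x * D x := by
  let g : Fin 3 → E3 → ℝ := fun i x => fderiv ℝ v x (EuclideanSpace.single i 1)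
  have hg : ∀ i, ContDiff ℝ 1 (g i) := by
    intro i
    have h1 : ContDiff ℝ 1 (fderiv ℝ v) := hv.1.fderiv_right (m := 1) (by rw [show ((1:WithTop ℕ∞) + 1) = ((2:ℕ∞) : WithTop ℕ∞) by rfl]; exact WithTop.coe_le_coe.2 le_top)
    exact h1.clm_apply contDiff_const
  have hgs : ∀ i, HasCompactSupport (g i) := fun i => hv.2.fderiv_apply (𝕜 := ℝ) _
  let d : Fin 3 → E3 → ℝ := fun i x => fderiv ℝ (g i) x (EuclideanSpace.single i 1)
  have hd : ∀ i, Continuous (d i) := fun i =>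
    ((hg i).continuous_fderiv (by norm_num)).clm_apply continuous_const
  have hds : ∀ i, HasCompactSupport (d i) := fun i => (hgs i).fderiv_apply (𝕜 := ℝ) _
  refine ⟨fun x => ∑ i, d i x, by fun_prop, ?_, ?_⟩
  · simp only [Fin.sum_univ_three]
    exact ((hds 0).add (hds 1)).add (hds 2)
  · intro u hu
    have hfu : ∀ i : Fin 3, Continuous (fun x => fderiv ℝ u x (EuclideanSpace.single i 1)) := fun i =>
      (hu.continuous_fderiv (by norm_num)).clm_apply continuous_const
    have key : ∀ i, ∫ x, u x * d i x = - ∫ x, fderiv ℝ u x (EuclideanSpace.single i 1) * g i x := by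
      intro i
      refine integral_mul_fderiv_eq_neg_fderiv_mul_of_integrable (μ := volume) (𝕜 := ℝ) ?_ ?_ ?_ ?_ ?_
      · exact ((hfu i).mul (hg i).continuous).integrable_of_hasCompactSupport (hgs i).mul_left
      · exact (hu.continuous.mul (hd i)).integrable_of_hasCompactSupport (hds i).mul_left
      · exact (hu.continuous.mul (hg i).continuous).integrable_of_hasCompactSupport (hgs i).mul_left
      · intro x _; exact hu.differentiable (by norm_num) x
      · intro x _; exact (hg i).differentiable (by norm_num) x
    simp_rw [inner_grad_sum, Finset.mul_sum]
    rw [integral_finsetSum, integral_finsetSum]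
    · simp_rw [key]; simp [g]
    · intro i _
      exact (hu.continuous.mul (hd i)).integrable_of_hasCompactSupport (hds i).mul_left
    · intro i _
      exact ((hfu i).mul (hg i).continuous).integrable_of_hasCompactSupport (hgs i).mul_left

lemma weak_eq {V φ : E3 → ℝ} (hV : Continuous V) (hpos : ∀ u, IsTest u → 0 ≤ Qf V u) (hφ : GroundState V φ) :
    WeakSol V φ := by
  obtain ⟨hφ1, hφ0, un, ⟨hu1, -, -, hu4⟩, hconv⟩ := hφ
  refine weak_of_test hV hφ1 fun v hv => ?_
  have hvc := hv.c1c
  obtain ⟨D, hDc, hDs, hD⟩ := lap_exists hv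
  have hvcont := hvc.1.continuous
  let G : E3 → ℝ := fun x => - D x + V x * v x
  have hGc : Continuous G := by fun_prop
  have hGs : HasCompactSupport G := (hDs.neg).add hvc.2.mul_left
  have bil : ∀ u : E3 → ℝ, ContDiff ℝ 1 u →
      ∫ x, (inner ℝ (gradient u x) (gradient v x) + V x * u x * v x) = ∫ x, u x * G x := by
    intro u hu
    have i1 : Integrable fun x => u x * D x := (hu.continuous.mul hDc).integrable_of_hasCompactSupport hDs.mul_left
    have i2 : Integrable fun x => V x * u x * v x := hvc.int_mul (F := fun x => V x * u x) (hV.mul hu.continuous)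
    rw [integral_add (hvc.int_grad_inner (C1.cont_grad hu)) i2, hD u hu, ← integral_neg, ← integral_add (f := fun x => -(u x * D x)) i1.neg i2]
    refine integral_congr_ae (Eventually.of_forall fun x => ?_)
    simp only [G]; ring
  -- the bilinear form tends to zero
  have hb : ∀ n, (∫ x, un n x * G x) ^ 2 ≤ Qf V (un n) * Qf V v := by
    intro n
    have hun := (hu1 n).c1c
    rw [← bil _ hun.1]
    refine disc_le fun t => ?_
    have htst : C1c (fun x => un n x + t * v x) := hun.add (C1c.mul contDiff_const hvc)
    have h0 := Q_nonneg_c1c htst hV hpos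
    have hg : ∀ x, gradient (fun x => un n x + t * v x) x = gradient (un n) x + t • gradient v x := by
      intro x
      have := (hg_add (C1.hg hun.1 x) (hg_comp (k := fun s => t * s) ((hasDerivAt_id _).const_mul t) (C1.hg hvc.1 x))).gradient
      simpa using this
    have i1 : Integrable fun x => ‖gradient (un n) x‖ ^ 2 + V x * un n x ^ 2 := hun.int_grad_sq.add (hun.int_sq hV)
    have i2 : Integrable fun x => ‖gradient v x‖ ^ 2 + V x * v x ^ 2 := hvc.int_grad_sq.add (hvc.int_sq hV)
    have i3 : Integrable fun x => inner ℝ (gradient (un n) x) (gradient v x) + V x * un n x * v x :=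
      (hvc.int_grad_inner (C1.cont_grad hun.1)).add (hvc.int_mul (F := fun x => V x * un n x) (hV.mul hun.1.continuous))
    have e : Qf V (fun x => un n x + t * v x) = Qf V (un n) + 2 * t * (∫ x, (inner ℝ (gradient (un n) x) (gradient v x) + V x * un n x * v x)) + t ^ 2 * Qf V v := by
      unfold Qf
      rw [← integral_const_mul, ← integral_const_mul, ← integral_add i1 (i3.const_mul _),
        ← integral_add (by exact i1.add (i3.const_mul _)) (i2.const_mul _)]
      refine integral_congr_ae (Eventually.of_forall fun x => ?_)
      simp only [hg]
      rw [@norm_add_sq_real, norm_smul, inner_smul_right, mul_pow, Real.norm_eq_abs, sq_abs]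
      ring
    rw [← e]; exact h0
  have hlim0 : Tendsto (fun n => (∫ x, un n x * G x)) atTop (𝓝 0) := by
    have : Tendsto (fun n => (∫ x, un n x * G x) ^ 2) atTop (𝓝 0) := by
      refine squeeze_zero (fun n => sq_nonneg _) hb ?_
      simpa using hu4.mul_const (Qf V v)
    have h2 := this.sqrt
    simp only [Real.sqrt_sq_eq_abs, Real.sqrt_zero] at h2
    exact (tendsto_zero_iff_abs_tendsto_zero _).2 h2
  set K := tsupport G with hK
  have hKc : IsCompact K := hGs.isCompact
  have hdiff : ∀ n, (∫ x, (un n x - φ x) * G x) ^ 2 ≤ (∫ x in K, (un n x - φ x) ^ 2) * ∫ x in K, G x ^ 2 := by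
    intro n
    have hcn := (hu1 n).1.continuous
    have hcφ := hφ1.continuous
    have e : ∫ x, (un n x - φ x) * G x = ∫ x in K, (un n x - φ x) * G x := by
      rw [setIntegral_eq_integral_of_forall_compl_eq_zero]
      intro x hx; rw [image_eq_zero_of_notMem_tsupport hx, mul_zero]
    rw [e]
    refine disc_le fun t => ?_
    have i1 : IntegrableOn (fun x => (un n x - φ x) ^ 2) K :=
      ((hcn.sub hcφ).pow 2).continuousOn.integrableOn_compact hKc
    have i2 : IntegrableOn (fun x => (un n x - φ x) * G x) K :=
      ((hcn.sub hcφ).mul hGc).continuousOn.integrableOn_compact hKc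
    have i3 : IntegrableOn (fun x => G x ^ 2) K := (hGc.pow 2).continuousOn.integrableOn_compact hKc
    rw [← integral_const_mul, ← integral_const_mul, ← integral_add i1 (i2.const_mul _),
        ← integral_add (by exact i1.add (i2.const_mul _)) (i3.const_mul _)]
    refine integral_nonneg fun x => ?_
    simp only [Pi.zero_apply]
    nlinarith [sq_nonneg ((un n x - φ x) + t * G x)]
  have hlim1 : Tendsto (fun n => (∫ x, (un n x - φ x) * G x)) atTop (𝓝 0) := by
    have : Tendsto (fun n => (∫ x, (un n x - φ x) * G x) ^ 2) atTop (𝓝 0) := by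
      refine squeeze_zero (fun n => sq_nonneg _) hdiff ?_
      simpa using (hconv K hKc).mul_const (∫ x in K, G x ^ 2)
    have h2 := this.sqrt
    simp only [Real.sqrt_sq_eq_abs, Real.sqrt_zero] at h2
    exact (tendsto_zero_iff_abs_tendsto_zero _).2 h2
  rw [bil φ hφ1]
  have e3 : ∀ n, (∫ x, un n x * G x) - (∫ x, (un n x - φ x) * G x) = ∫ x, φ x * G x := by
    intro n
    have hcn : Continuous (un n) := (hu1 n).1.continuous
    have hcφ := hφ1.continuous
    rw [← integral_sub]
    · refine integral_congr_ae (Eventually.of_forall fun x => ?_)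
      simp only; ring
    · exact (hcn.mul hGc).integrable_of_hasCompactSupport hGs.mul_left
    · exact ((hcn.sub hcφ).mul hGc).integrable_of_hasCompactSupport hGs.mul_left
  have h5 := hlim0.sub hlim1
  simp only [e3, sub_zero] at h5
  exact tendsto_nhds_unique tendsto_const_nhds h5

lemma ims {u θ V : E3 → ℝ} (hu : C1c u) (hθ : ContDiff ℝ 1 θ) (hV : Continuous V) :
    Qf V (fun x => Real.sin (θ x) * u x) + Qf V (fun x => Real.cos (θ x) * u x)
      = Qf V u + ∫ x, ‖gradient θ x‖ ^ 2 * u x ^ 2 := by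
  have h1 : C1c (fun x => Real.sin (θ x) * u x) := C1c.mul (Real.contDiff_sin.comp hθ) hu
  have h2 : C1c (fun x => Real.cos (θ x) * u x) := C1c.mul (Real.contDiff_cos.comp hθ) hu
  have g1 : ∀ x, gradient (fun x => Real.sin (θ x) * u x) x =
      Real.sin (θ x) • gradient u x + u x • Real.cos (θ x) • gradient θ x := fun x =>
    (hg_mul (hg_comp (Real.hasDerivAt_sin _) (C1.hg hθ x)) (C1.hg hu.1 x)).gradient
  have g2 : ∀ x, gradient (fun x => Real.cos (θ x) * u x) x =
      Real.cos (θ x) • gradient u x + u x • (-Real.sin (θ x)) • gradient θ x := fun x =>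
    (hg_mul (hg_comp (Real.hasDerivAt_cos _) (C1.hg hθ x)) (C1.hg hu.1 x)).gradient
  unfold Qf
  have hg := C1.cont_grad hθ
  have huc := hu.1.continuous
  have i3 : Integrable fun x => ‖gradient θ x‖ ^ 2 * u x ^ 2 := hu.int_sq (by fun_prop)
  rw [← integral_add (by exact h1.int_grad_sq.add (h1.int_sq hV)) (by exact h2.int_grad_sq.add (h2.int_sq hV)),
    ← integral_add (by exact hu.int_grad_sq.add (hu.int_sq hV)) i3]
  refine integral_congr_ae (Eventually.of_forall fun x => ?_)
  simp only [g1, g2]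
  rw [@norm_add_sq_real, @norm_add_sq_real]
  simp only [norm_smul, mul_pow, Real.norm_eq_abs, sq_abs, inner_smul_left, inner_smul_right, smul_smul, neg_sq,
    RCLike.conj_to_real]
  have := Real.sin_sq_add_cos_sq (θ x)
  linear_combination (‖gradient u x‖ ^ 2 + V x * u x ^ 2 + ‖gradient θ x‖^2 * u x ^2) * this

lemma jb_cd (a : ℝ) : ContDiff ℝ 1 (fun x : E3 => (1 + ‖x‖ ^ 2) ^ a) := by
  refine ContDiff.rpow_const_of_ne (contDiff_const.add (contDiff_norm_sq ℝ)) fun x => ?_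
  positivity

lemma sin_two_arctan (t : ℝ) : Real.sin (2 * Real.arctan t) = 2 * t / (1 + t ^ 2) := by
  rw [Real.sin_two_mul, Real.sin_arctan, Real.cos_arctan]
  have h : 0 < 1 + t ^ 2 := by positivity
  have := Real.sq_sqrt h.le
  field_simp
  rw [this]

set_option maxHeartbeats 800000 in
lemma weighted_test {V : E3 → ℝ} (hV : Continuous V) (hpos : ∀ u, IsTest u → 0 ≤ Qf V u)
    {C β a : ℝ} (hβ : 2 < β) (hC : 0 < C) (ha0 : 0 < a) (ha : a < 1 / 2)
    (hb : ∀ x : E3, |V x| ≤ C * (1 + ‖x‖ ^ 2) ^ (-β / 2)) :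
    ∃ δ M C' : ℝ, 0 < δ ∧ 0 ≤ C' ∧ ∀ N : ℝ, 0 ≤ N → ∃ L : ℝ, ∀ u, IsTest u →
      δ * ∫ x in Metric.closedBall (0:E3) N, (1 + ‖x‖ ^ 2) ^ (a - 1) * u x ^ 2 ≤
        L * Qf V u + C' * ∫ x in Metric.closedBall (0:E3) M, u x ^ 2 := by
  set δ := (1/4 - a ^ 2) / 2 with hδ
  have hδ0 : 0 < δ := by rw [hδ]; nlinarith
  -- the radius M
  obtain ⟨M, hM0, hM⟩ : ∃ M : ℝ, 0 ≤ M ∧ ∀ x : E3, M < ‖x‖ → |V x| ≤ δ / (1 + ‖x‖ ^ 2) := by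
    have ht : Tendsto (fun t : ℝ => C * t ^ (1 - β / 2)) atTop (𝓝 0) := by
      have := (tendsto_rpow_neg_atTop (y := β / 2 - 1) (by linarith)).const_mul C
      simpa using this
    obtain ⟨T, hT⟩ := eventually_atTop.1 (ht.eventually_lt_const hδ0)
    refine ⟨max T 1, by positivity, fun x hx => ?_⟩
    have h1 : 1 < ‖x‖ := lt_of_le_of_lt (le_max_right _ _) hx
    have h2 : T < ‖x‖ := lt_of_le_of_lt (le_max_left _ _) hx
    have hp : 0 < 1 + ‖x‖ ^ 2 := by positivity
    have h3 := hT (1 + ‖x‖^2) (by nlinarith)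
    rw [le_div_iff₀ hp]
    refine le_trans (mul_le_mul_of_nonneg_right (hb x) hp.le) ?_
    rw [mul_assoc, ← Real.rpow_add_one hp.ne']
    refine le_trans (le_of_eq ?_) h3.le
    ring_nf
  have hVC : ∀ x, |V x| ≤ C := by
    intro x
    refine (hb x).trans ?_
    have : (1 + ‖x‖ ^ 2) ^ (-β / 2) ≤ 1 := Real.rpow_le_one_of_one_le_of_nonpos (by nlinarith [sq_nonneg ‖x‖]) (by linarith)
    nlinarith
  refine ⟨δ, M, C * 4 * (1 + M^2) ^ a, hδ0, by positivity, fun N hN => ?_⟩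
  set L := (1 + N ^ 2) ^ a with hL
  have hLp : 0 < L := by positivity
  refine ⟨L, fun u hu => ?_⟩
  have huc := hu.c1c
  have hcu := huc.1.continuous
  -- the weight
  let k := (Real.sqrt L)⁻¹
  have hk : 0 < k := by positivity
  have hk2 : k ^ 2 = L⁻¹ := by simp only [k, inv_pow]; rw [Real.sq_sqrt hLp.le]
  let t : E3 → ℝ := fun x => (1 + ‖x‖ ^ 2) ^ (a/2) * k
  let θ : E3 → ℝ := fun x => 2 * Real.arctan (t x)
  have htc : ContDiff ℝ 1 t := (jb_cd _).mul contDiff_const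
  have hθc : ContDiff ℝ 1 θ := contDiff_const.mul (Real.contDiff_arctan.comp htc)
  have hp : ∀ x : E3, 0 < 1 + ‖x‖ ^ 2 := fun x => by positivity
  have htp : ∀ x, 0 < t x := fun x => by have := hp x; positivity
  have ht2 : ∀ x, t x ^ 2 = (1 + ‖x‖ ^ 2) ^ a / L := by
    intro x
    simp only [t, mul_pow, hk2]
    rw [← Real.rpow_natCast, ← Real.rpow_mul (hp x).le]
    rw [show a / 2 * ((2:ℕ):ℝ) = a by push_cast; ring, div_eq_mul_inv]
  have hs : ∀ x, Real.sin (θ x) = 2 * t x / (1 + t x ^ 2) := fun x => sin_two_arctan _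
  have hgt : ∀ x, HasGradientAt t ((a * t x / (1 + ‖x‖^2)) • x) x := by
    intro x
    have hk : HasDerivAt (fun s : ℝ => (1 + s) ^ (a/2) * k) (1 * (a/2) * (1 + ‖x - 0‖^2) ^ (a/2 - 1) * k) (‖x - 0‖^2) :=
      (((hasDerivAt_id _).const_add 1).rpow_const (Or.inl (by positivity))).mul_const k
    have := hg_comp hk (hg_normsq 0 x)
    simp only [sub_zero, smul_smul] at this
    convert this using 2
    rw [Real.rpow_sub_one (hp x).ne']
    simp only [t]
    field_simp
  have hgθ : ∀ x, gradient θ x = ((a * Real.sin (θ x) / (1 + ‖x‖^2)) • x) := by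
    intro x
    have := (hg_comp (k := fun s => 2 * Real.arctan s) ((Real.hasDerivAt_arctan _).const_mul 2) (hgt x)).gradient
    rw [show gradient θ x = _ from this, smul_smul, hs]
    congr 1
    field_simp
  have hgθ2 : ∀ x, ‖gradient θ x‖ ^ 2 ≤ a ^ 2 * (Real.sin (θ x) ^ 2 / (1 + ‖x‖ ^ 2)) := by
    intro x
    rw [hgθ, norm_smul, mul_pow, Real.norm_eq_abs, sq_abs]
    have := hp x
    rw [div_pow, mul_pow, div_mul_eq_mul_div, mul_div_assoc', div_le_div_iff₀ (by positivity) this]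
    have : 0 ≤ a ^ 2 * Real.sin (θ x) ^ 2 := by positivity
    nlinarith [mul_nonneg this (hp x).le]
  have hims := ims huc hθc hV
  have hcos : 0 ≤ Qf V (fun x => Real.cos (θ x) * u x) :=
    Q_nonneg_c1c (C1c.mul (Real.contDiff_cos.comp hθc) huc) hV hpos
  set w : E3 → ℝ := fun x => Real.sin (θ x) * u x with hw
  have hwc : C1c w := C1c.mul (Real.contDiff_sin.comp hθc) huc
  have hwcc := hwc.1.continuous
  have hH := hardy hwc
  rw [Qf_eq hwc hV] at hims
  have iw : Integrable (fun x => w x ^ 2 / (1 + ‖x‖ ^ 2)) := by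
    refine hwc.integrable_of (by fun_prop (disch := intro x; positivity)) ?_
    intro x h0 _; simp [h0]
  have h1 : ∫ x, ‖gradient θ x‖ ^ 2 * u x ^ 2 ≤ a ^ 2 * ∫ x, w x ^ 2 / (1 + ‖x‖ ^ 2) := by
    rw [← integral_const_mul]
    refine integral_mono (huc.int_sq ((C1.cont_grad hθc).norm.pow 2)) (iw.const_mul _) fun x => ?_
    have := mul_le_mul_of_nonneg_right (hgθ2 x) (sq_nonneg (u x))
    refine this.trans (le_of_eq ?_)
    simp only [hw]; ring
  have hBm : MeasurableSet (Metric.closedBall (0:E3) M) := Metric.isClosed_closedBall.measurableSet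
  have hBn : MeasurableSet (Metric.closedBall (0:E3) N) := Metric.isClosed_closedBall.measurableSet
  have iM : IntegrableOn (fun x => u x ^ 2) (Metric.closedBall (0:E3) M) :=
    (hcu.pow 2).continuousOn.integrableOn_compact (isCompact_closedBall _ _)
  have h2 : -(δ * ∫ x, w x ^ 2 / (1 + ‖x‖ ^ 2)) - (C * 4 * (1 + M^2) ^ a / L) * ∫ x in Metric.closedBall (0:E3) M, u x ^ 2
      ≤ ∫ x, V x * w x ^ 2 := by
    rw [← integral_const_mul, ← integral_const_mul, ← integral_indicator hBm, ← integral_neg, ← integral_sub]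
    · refine integral_mono ?_ (hwc.int_sq hV) fun x => ?_
      · exact ((iw.const_mul _).neg).sub ((integrable_indicator_iff hBm).2 (iM.const_mul _))
      · by_cases hx : x ∈ Metric.closedBall (0:E3) M
        · simp only [Set.indicator_of_mem hx]
          have hx' : ‖x‖ ≤ M := by simpa using hx
          have e1 : w x ^ 2 ≤ 4 * (1 + M^2) ^ a / L * u x ^ 2 := by
            simp only [hw, mul_pow]
            refine mul_le_mul_of_nonneg_right ?_ (sq_nonneg _)
            have e3 : Real.sin (θ x) ^ 2 ≤ 4 * t x ^ 2 := by
              rw [hs, div_pow]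
              refine div_le_of_le_mul₀ (by positivity) (by positivity) ?_
              have h13 : 1 ≤ (1 + t x ^ 2)^2 := one_le_pow₀ (by linarith [sq_nonneg (t x)])
              calc (2 * t x) ^ 2 = 4 * t x ^ 2 * 1 := by ring
                _ ≤ _ := mul_le_mul_of_nonneg_left h13 (by positivity)
            refine e3.trans ?_
            rw [ht2, mul_div_assoc]
            have : (1 + ‖x‖ ^ 2) ^ a ≤ (1 + M ^ 2) ^ a :=
              Real.rpow_le_rpow (hp x).le (by nlinarith [norm_nonneg x]) ha0.le
            gcongr
          have e2 : -(C * w x ^ 2) ≤ V x * w x ^ 2 := by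
            have := neg_le_of_abs_le (hVC x)
            nlinarith [sq_nonneg (w x)]
          have e4 : 0 ≤ δ * (w x ^ 2 / (1 + ‖x‖ ^ 2)) := by have := hp x; positivity
          have e5 : C * 4 * (1 + M ^ 2) ^ a / L * u x ^ 2 = C * (4 * (1 + M^2) ^ a / L * u x ^ 2) := by ring
          rw [e5]
          nlinarith
        · simp only [Set.indicator_of_notMem hx]
          have hx' : M < ‖x‖ := by simpa using hx
          have := neg_le_of_abs_le (hM x hx')
          have := mul_le_mul_of_nonneg_right this (sq_nonneg (w x))
          refine le_trans (le_of_eq ?_) this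
          ring
    · exact (iw.const_mul _).neg
    · exact (integrable_indicator_iff hBm).2 (iM.const_mul _)
  have h3 : ∫ x in Metric.closedBall (0:E3) N, (1 + ‖x‖ ^ 2) ^ (a - 1) * u x ^ 2 ≤ L * ∫ x, w x ^ 2 / (1 + ‖x‖ ^ 2) := by
    rw [← integral_indicator hBn, ← integral_const_mul]
    have hcc : Continuous (fun x : E3 => (1 + ‖x‖ ^ 2) ^ (a - 1) * u x ^ 2) := (jb_cd _).continuous.mul (hcu.pow 2)
    refine integral_mono ((hcc.continuousOn.integrableOn_compact (isCompact_closedBall _ _)).integrable_indicator hBn)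
      (iw.const_mul _) fun x => ?_
    by_cases hx : x ∈ Metric.closedBall (0:E3) N
    · simp only [Set.indicator_of_mem hx]
      have hx' : ‖x‖ ≤ N := by simpa using hx
      have e1 : t x ^ 2 ≤ 1 := by
        rw [ht2, div_le_one hLp]
        exact Real.rpow_le_rpow (hp x).le (by nlinarith [norm_nonneg x]) ha0.le
      have e2 : t x ^ 2 ≤ Real.sin (θ x) ^ 2 := by
        rw [hs, div_pow, le_div_iff₀ (by positivity)]
        have h12 : 1 + t x ^ 2 ≤ 2 := by linarith
        have h13 : (1 + t x ^ 2)^2 ≤ 2 ^ 2 := pow_le_pow_left₀ (by positivity) h12 2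
        calc t x ^ 2 * (1 + t x ^ 2)^2 ≤ t x ^ 2 * 2 ^ 2 := mul_le_mul_of_nonneg_left h13 (sq_nonneg _)
          _ = _ := by ring
      rw [ht2] at e2
      have e3 : (1 + ‖x‖ ^ 2) ^ a ≤ L * Real.sin (θ x) ^ 2 := by
        rw [div_le_iff₀ hLp] at e2; linarith
      rw [Real.rpow_sub_one (hp x).ne']
      simp only [hw, mul_pow]
      calc (1 + ‖x‖ ^ 2) ^ a / (1 + ‖x‖ ^ 2) * u x ^ 2 ≤ (L * Real.sin (θ x) ^ 2) / (1 + ‖x‖ ^ 2) * u x ^ 2 := by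
            have := hp x
            gcongr
        _ = _ := by ring
    · simp only [Set.indicator_of_notMem hx]
      have := hp x
      positivity
  have h4 : δ * ∫ x, w x ^ 2 / (1 + ‖x‖ ^ 2) ≤ Qf V u + (C * 4 * (1 + M^2) ^ a / L) * ∫ x in Metric.closedBall (0:E3) M, u x ^ 2 := by
    have e : ∀ I : ℝ, 1 / 4 * I = a ^ 2 * I + 2 * (δ * I) := by intro I; rw [hδ]; ring
    rw [e] at hH
    linarith
  calc _ ≤ δ * (L * ∫ x, w x ^ 2 / (1 + ‖x‖ ^ 2)) := mul_le_mul_of_nonneg_left h3 hδ0.le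
    _ = L * (δ * ∫ x, w x ^ 2 / (1 + ‖x‖ ^ 2)) := by ring
    _ ≤ L * (Qf V u + (C * 4 * (1 + M^2) ^ a / L) * ∫ x in Metric.closedBall (0:E3) M, u x ^ 2) :=
      mul_le_mul_of_nonneg_left h4 hLp.le
    _ = _ := by field_simp

lemma weighted_int {V φ : E3 → ℝ} (hV : Continuous V) (hpos : ∀ u, IsTest u → 0 ≤ Qf V u)
    {C β a : ℝ} (hβ : 2 < β) (hC : 0 < C) (ha0 : 0 < a) (ha : a < 1 / 2)
    (hb : ∀ x : E3, |V x| ≤ C * (1 + ‖x‖ ^ 2) ^ (-β / 2)) (hφ : GroundState V φ) :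
    Integrable (fun x : E3 => (1 + ‖x‖ ^ 2) ^ (a - 1) * φ x ^ 2) := by
  obtain ⟨hφ1, hφ0, un, ⟨hu1, -, -, hu4⟩, hconv⟩ := hφ
  obtain ⟨δ, M, C', hδ, hC', H⟩ := weighted_test hV hpos hβ hC ha0 ha hb
  have hcφ := hφ1.continuous
  have hcw := (jb_cd (a - 1)).continuous
  have hw0 : ∀ x : E3, 0 ≤ (1 + ‖x‖ ^ 2) ^ (a - 1) := fun x => by positivity
  have hw1 : ∀ x : E3, (1 + ‖x‖ ^ 2) ^ (a - 1) ≤ 1 := fun x =>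
    Real.rpow_le_one_of_one_le_of_nonpos (by nlinarith [sq_nonneg ‖x‖]) (by linarith)
  have hi : ∀ (N : ℝ) (f : E3 → ℝ), Continuous f → IntegrableOn f (Metric.closedBall (0:E3) N) := fun N f hf =>
    hf.continuousOn.integrableOn_compact (isCompact_closedBall _ _)
  have key : ∀ N : ℝ, 0 ≤ N → ∫ x in Metric.closedBall (0:E3) N, (1 + ‖x‖ ^ 2) ^ (a - 1) * φ x ^ 2 ≤
      4 * C' / δ * ∫ x in Metric.closedBall (0:E3) M, φ x ^ 2 := by
    intro N hN
    obtain ⟨L, hL⟩ := H N hN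
    have hb : ∀ n, δ * ∫ x in Metric.closedBall (0:E3) N, (1 + ‖x‖ ^ 2) ^ (a - 1) * φ x ^ 2 ≤
        2 * δ * (∫ x in Metric.closedBall (0:E3) N, (un n x - φ x) ^ 2) + 2 * (L * Qf V (un n)) +
        4 * C' * (∫ x in Metric.closedBall (0:E3) M, (un n x - φ x) ^ 2)
        + 4 * C' * ∫ x in Metric.closedBall (0:E3) M, φ x ^ 2 := by
      intro n
      have hcn : Continuous (un n) := (hu1 n).1.continuous
      have e1 : ∫ x in Metric.closedBall (0:E3) N, (1 + ‖x‖ ^ 2) ^ (a - 1) * φ x ^ 2 ≤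
          2 * (∫ x in Metric.closedBall (0:E3) N, (un n x - φ x) ^ 2) +
          2 * ∫ x in Metric.closedBall (0:E3) N, (1 + ‖x‖ ^ 2) ^ (a - 1) * un n x ^ 2 := by
        rw [← integral_const_mul, ← integral_const_mul, ← integral_add (hi _ _ (by fun_prop)) (hi _ _ (by fun_prop))]
        refine integral_mono (hi _ _ (by fun_prop)) (hi _ _ (by fun_prop)) fun x => ?_
        simp only
        have := hw0 x
        have := hw1 x
        have e : φ x ^ 2 ≤ 2 * (un n x - φ x) ^ 2 + 2 * un n x ^ 2 := by nlinarith [sq_nonneg (un n x - φ x + un n x)]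
        have := mul_le_mul_of_nonneg_left e (hw0 x)
        nlinarith [mul_le_mul_of_nonneg_right (hw1 x) (sq_nonneg (un n x - φ x))]
      have e2 : ∫ x in Metric.closedBall (0:E3) M, un n x ^ 2 ≤
          2 * (∫ x in Metric.closedBall (0:E3) M, (un n x - φ x) ^ 2) +
          2 * ∫ x in Metric.closedBall (0:E3) M, φ x ^ 2 := by
        rw [← integral_const_mul, ← integral_const_mul, ← integral_add (hi _ _ (by fun_prop)) (hi _ _ (by fun_prop))]
        refine integral_mono (hi _ _ (by fun_prop)) (hi _ _ (by fun_prop)) fun x => ?_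
        simp only
        nlinarith [sq_nonneg (un n x - φ x - φ x)]
      have e3 := hL _ (hu1 n)
      have e4 := mul_le_mul_of_nonneg_left e2 hC'
      have e5 := mul_le_mul_of_nonneg_left e1 hδ.le
      nlinarith
    have hl : Tendsto (fun n => 2 * δ * (∫ x in Metric.closedBall (0:E3) N, (un n x - φ x) ^ 2) + 2 * (L * Qf V (un n)) +
        4 * C' * (∫ x in Metric.closedBall (0:E3) M, (un n x - φ x) ^ 2)
        + 4 * C' * ∫ x in Metric.closedBall (0:E3) M, φ x ^ 2) atTop
        (𝓝 (2 * δ * 0 + 2 * (L * 0) + 4 * C' * 0 + 4 * C' * ∫ x in Metric.closedBall (0:E3) M, φ x ^ 2)) := by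
      refine Tendsto.add (Tendsto.add (Tendsto.add ?_ ?_) ?_) tendsto_const_nhds
      · exact (hconv _ (isCompact_closedBall _ _)).const_mul _
      · exact (hu4.const_mul L).const_mul 2
      · exact (hconv _ (isCompact_closedBall _ _)).const_mul _
    have := ge_of_tendsto' hl hb
    simp only [mul_zero, zero_add] at this
    rw [div_mul_eq_mul_div, le_div_iff₀ hδ]
    linarith
  have hcov : AECover (volume : Measure E3) atTop (fun n : ℕ => Metric.closedBall (0:E3) (n:ℝ)) :=
    aecover_closedBall tendsto_natCast_atTop_atTop
  refine hcov.integrable_of_integral_bounded_of_nonneg_ae (4 * C' / δ * ∫ x in Metric.closedBall (0:E3) M, φ x ^ 2) ?_ ?_ ?_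
  · intro n; exact hi _ _ (by fun_prop)
  · exact Eventually.of_forall fun x => mul_nonneg (hw0 x) (sq_nonneg _)
  · exact Eventually.of_forall fun n => key n n.cast_nonneg

lemma C1_of_grad {f : E3 → ℝ} {g : E3 → E3} (h : ∀ x, HasGradientAt f (g x) x) (hg : Continuous g) :
    ContDiff ℝ 1 f := by
  rw [contDiff_one_iff_fderiv]
  have h' := fun x => (hasGradientAt_iff_hasFDerivAt.1 (h x))
  refine ⟨fun x => (h' x).differentiableAt, ?_⟩
  have : fderiv ℝ f = fun x => InnerProductSpace.toDual ℝ E3 (g x) := funext fun x => (h' x).fderiv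
  rw [this]
  exact (InnerProductSpace.toDual ℝ E3).continuous.comp hg

/-- the surface constant -/
def om : ℝ := 3 * volume.real (Metric.ball (0:E3) 1)

lemma om_pos : 0 < om := by
  unfold om
  have : 0 < volume.real (Metric.ball (0:E3) 1) :=
    ENNReal.toReal_pos (Metric.measure_ball_pos _ _ one_pos).ne' (measure_ball_lt_top).ne
  positivity

lemma rad_integrable {f : ℝ → ℝ} (p : E3) :
    Integrable (fun y : E3 => f ‖y - p‖) ↔ IntegrableOn (fun r : ℝ => r ^ 2 * f r) (Set.Ioi 0) := by
  have h0 : Integrable (fun y : E3 => f ‖y - p‖) ↔ Integrable (fun y : E3 => f ‖y‖) := by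
    constructor
    · intro h
      have := h.comp_add_right p
      simpa using this
    · intro h; exact h.comp_sub_right p
  rw [h0, integrable_fun_norm_addHaar]
  simp

lemma rad_integral (f : ℝ → ℝ) (p : E3) :
    ∫ y : E3, f ‖y - p‖ = om * ∫ r in Set.Ioi (0:ℝ), r ^ 2 * f r := by
  rw [integral_sub_right_eq_self (fun y : E3 => f ‖y‖) p, integral_fun_norm_addHaar]
  simp [om]; ring

lemma inv2_aux (R : ℝ) : Set.EqOn (fun r : ℝ => r ^ 2 * (Set.Iic R).indicator (fun r => (r ^ 2)⁻¹) r)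
    ((Set.Iic R).indicator (fun _ => 1)) (Set.Ioi 0) := by
  intro r hr
  have : r ≠ 0 := ne_of_gt hr
  by_cases h : r ≤ R
  · simp [Set.indicator, h]; field_simp
  · simp [Set.indicator, h]

lemma ind_ball (p : E3) (R : ℝ) (f : ℝ → ℝ) :
    (fun y : E3 => (Set.Iic R).indicator f ‖y - p‖) = (Metric.closedBall p R).indicator (fun y => f ‖y - p‖) := by
  ext y
  by_cases h : ‖y - p‖ ≤ R
  · simp [Set.indicator, h, dist_eq_norm]
  · simp [Set.indicator, h, dist_eq_norm]

lemma inv2_int (p : E3) {R : ℝ} :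
    IntegrableOn (fun y : E3 => (‖y - p‖ ^ 2)⁻¹) (Metric.closedBall p R) := by
  rw [← integrable_indicator_iff Metric.isClosed_closedBall.measurableSet, ← ind_ball p R (fun r => (r ^ 2)⁻¹),
    rad_integrable, integrableOn_congr_fun (inv2_aux R) measurableSet_Ioi, IntegrableOn,
    integrable_indicator_iff measurableSet_Iic, IntegrableOn, Measure.restrict_restrict measurableSet_Iic]
  refine integrableOn_const ?_
  have : Set.Iic R ∩ Set.Ioi 0 ⊆ Set.Icc 0 R := fun r hr => ⟨le_of_lt hr.2, hr.1⟩
  exact (lt_of_le_of_lt (measure_mono this) measure_Icc_lt_top).ne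

lemma inv2_val (p : E3) {R : ℝ} (hR : 0 ≤ R) :
    ∫ y in Metric.closedBall p R, (‖y - p‖ ^ 2)⁻¹ = om * R := by
  rw [← integral_indicator Metric.isClosed_closedBall.measurableSet, ← ind_ball p R (fun r => (r ^ 2)⁻¹),
    rad_integral, setIntegral_congr_fun measurableSet_Ioi (inv2_aux R),
    integral_indicator measurableSet_Iic, Measure.restrict_restrict measurableSet_Iic]
  have : Set.Iic R ∩ Set.Ioi 0 = Set.Ioc 0 R := by ext r; simp [and_comm]
  rw [this]
  simp [hR]

/-- functions dominated by `C/r²` on a ball -/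
lemma near_int {g : E3 → ℝ} (hg : AEStronglyMeasurable g) {p : E3} {R C : ℝ} (hR : 0 ≤ R)
    (h1 : ∀ y, ‖y - p‖ ≤ R → y ≠ p → |g y| ≤ C * (‖y - p‖ ^ 2)⁻¹) (h2 : ∀ y, R < ‖y - p‖ → g y = 0) :
    Integrable g ∧ |∫ y, g y| ≤ C * (om * R) ∧ ∫ y, |g y| ≤ C * (om * R) := by
  have hm : MeasurableSet (Metric.closedBall p R) := Metric.isClosed_closedBall.measurableSet
  have hi : Integrable ((Metric.closedBall p R).indicator (fun y => C * (‖y - p‖ ^ 2)⁻¹)) :=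
    (integrable_indicator_iff hm).2 ((inv2_int p).const_mul C)
  have hne : ∀ᵐ y : E3, y ≠ p := by
    have : ({p}ᶜ : Set E3) ∈ ae volume := by
      rw [mem_ae_iff, compl_compl]; exact measure_singleton p
    exact this
  have hb : ∀ᵐ y, ‖g y‖ ≤ (Metric.closedBall p R).indicator (fun y => C * (‖y - p‖ ^ 2)⁻¹) y := by
    filter_upwards [hne] with y hy
    by_cases h : ‖y - p‖ ≤ R
    · rw [Set.indicator_of_mem (by simpa [dist_eq_norm] using h)]; exact h1 y h hy
    · rw [Set.indicator_of_notMem (by simpa [dist_eq_norm] using h), h2 y (not_le.1 h)]; simp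
  have hig : Integrable g := hi.mono' hg hb
  have hv : ∫ y, (Metric.closedBall p R).indicator (fun y => C * (‖y - p‖ ^ 2)⁻¹) y = C * (om * R) := by
    rw [integral_indicator hm, integral_const_mul, inv2_val p hR]
  have h3 : ∫ y, |g y| ≤ C * (om * R) := by
    rw [← hv]
    exact integral_mono_ae hig.norm hi hb
  exact ⟨hig, (norm_integral_le_integral_norm g).trans h3, h3⟩

/-- cutoff function -/
lemma cutoff : ∃ (ξ ξ1 ξ2 : ℝ → ℝ) (B : ℝ), 0 < B ∧ (∀ t, HasDerivAt ξ (ξ1 t) t) ∧ (∀ t, HasDerivAt ξ1 (ξ2 t) t) ∧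
    Continuous ξ2 ∧ (∀ t, t ≤ 1 → ξ t = 1 ∧ ξ1 t = 0 ∧ ξ2 t = 0) ∧ (∀ t, 2 ≤ t → ξ t = 0 ∧ ξ1 t = 0 ∧ ξ2 t = 0) ∧
    (∀ t, 0 ≤ ξ t ∧ ξ t ≤ 1) ∧ (∀ t, ξ1 t ≤ 0) ∧ (∀ t, |ξ1 t| ≤ B ∧ |ξ2 t| ≤ B) := by
  let ξ : ℝ → ℝ := fun t => Real.smoothTransition (2 - t)
  have hs : ContDiff ℝ 2 ξ := Real.smoothTransition.contDiff.comp (contDiff_const.sub contDiff_id)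
  have hd1 : ContDiff ℝ 1 (deriv ξ) := by
    have := (contDiff_succ_iff_deriv (n := 1) (f := ξ)).1 (by exact_mod_cast hs)
    exact this.2.2
  have hD1 : ∀ t, HasDerivAt ξ (deriv ξ t) t := fun t => (hs.differentiable (by norm_num) t).hasDerivAt
  have hD2 : ∀ t, HasDerivAt (deriv ξ) (deriv (deriv ξ) t) t := fun t =>
    (hd1.differentiable (by norm_num) t).hasDerivAt
  have hc2 : Continuous (deriv (deriv ξ)) := hd1.continuous_deriv (by norm_num)
  have hle : ∀ t, ξ t ≤ 1 := fun t => Real.smoothTransition.le_one _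
  have hge : ∀ t, 0 ≤ ξ t := fun t => Real.smoothTransition.nonneg _
  have hanti : Antitone ξ := fun a b hab => Real.smoothTransition.monotone (by linarith)
  have h1 : ∀ t, deriv ξ t ≤ 0 := fun t => hanti.deriv_nonpos
  have ha : ∀ t, t ≤ 1 → ξ t = 1 := fun t ht => Real.smoothTransition.one_of_one_le (by linarith)
  have hb : ∀ t, 2 ≤ t → ξ t = 0 := fun t ht => Real.smoothTransition.zero_of_nonpos (by linarith)
  have ha1 : ∀ t, t ≤ 1 → deriv ξ t = 0 := fun t ht =>
    IsLocalMax.deriv_eq_zero (Eventually.of_forall fun y => by rw [ha t ht]; exact hle y)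
  have hb1 : ∀ t, 2 ≤ t → deriv ξ t = 0 := fun t ht =>
    IsLocalMin.deriv_eq_zero (Eventually.of_forall fun y => by rw [hb t ht]; exact hge y)
  have hz2 : ∀ t, deriv ξ t = 0 → deriv (deriv ξ) t = 0 := fun t ht =>
    IsLocalMax.deriv_eq_zero (Eventually.of_forall fun y => by rw [ht]; exact h1 y)
  obtain ⟨B1, hB1⟩ := (isCompact_Icc (a := (1:ℝ)) (b := 2)).exists_bound_of_continuousOn hd1.continuous.continuousOn
  obtain ⟨B2, hB2⟩ := (isCompact_Icc (a := (1:ℝ)) (b := 2)).exists_bound_of_continuousOn hc2.continuousOn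
  refine ⟨ξ, deriv ξ, deriv (deriv ξ), max 1 (max B1 B2), by positivity, hD1, hD2, hc2,
    fun t ht => ⟨ha t ht, ha1 t ht, hz2 t (ha1 t ht)⟩, fun t ht => ⟨hb t ht, hb1 t ht, hz2 t (hb1 t ht)⟩,
    fun t => ⟨hge t, hle t⟩, h1, fun t => ?_⟩
  rcases le_total t 1 with h | h
  · rw [hz2 t (ha1 t h), ha1 t h]; simp
  rcases le_total 2 t with h' | h'
  · rw [hz2 t (hb1 t h'), hb1 t h']; simp
  · exact ⟨(hB1 t ⟨h, h'⟩).trans ((le_max_left _ _).trans (le_max_right _ _)),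
      (hB2 t ⟨h, h'⟩).trans ((le_max_right _ _).trans (le_max_right _ _))⟩

lemma rad_C1 {p : E3} {G G1 : ℝ → ℝ} (h1 : ∀ s, 0 ≤ s → HasDerivAt G (G1 s) s)
    (hc : ContinuousOn G1 (Set.Ici 0)) :
    ContDiff ℝ 1 (fun y : E3 => G (‖y - p‖ ^ 2)) ∧
    ∀ y : E3, HasGradientAt (fun y : E3 => G (‖y - p‖ ^ 2)) ((2 * G1 (‖y - p‖ ^ 2)) • (y - p)) y := by
  have hg : ∀ y : E3, HasGradientAt (fun y : E3 => G (‖y - p‖ ^ 2)) ((2 * G1 (‖y - p‖ ^ 2)) • (y - p)) y := by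
    intro y
    have := hg_comp (f := fun y : E3 => ‖y - p‖ ^ 2) (h1 (‖y - p‖ ^ (2:ℕ)) (by positivity)) (hg_normsq p y)
    rw [smul_smul, mul_comm] at this
    exact this
  refine ⟨C1_of_grad hg ?_, hg⟩
  have : Continuous (fun y : E3 => G1 (‖y - p‖ ^ 2)) :=
    hc.comp_continuous (by fun_prop) (fun y => by simp)
  exact (continuous_const.mul this).smul (continuous_id.sub continuous_const)

lemma cs_ball {f : E3 → ℝ} {p : E3} {S : ℝ} (h : ∀ y, S ≤ ‖y - p‖ ^ 2 → f y = 0) : HasCompactSupport f := by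
  refine HasCompactSupport.intro (isCompact_closedBall p (1 + |S|)) fun y hy => h y ?_
  have : 1 + |S| < ‖y - p‖ := by simpa [dist_eq_norm] using hy
  have := abs_nonneg S
  have := le_abs_self S
  nlinarith

/-- testing with a radial function -/
lemma radial_test {V φ : E3 → ℝ} (hφ : ContDiff ℝ 1 φ) (hw : WeakSol V φ) (p : E3) {G G1 G2 : ℝ → ℝ} {S : ℝ}
    (h1 : ∀ s, 0 ≤ s → HasDerivAt G (G1 s) s) (h2 : ∀ s, 0 ≤ s → HasDerivAt G1 (G2 s) s)
    (hc : ContinuousOn G2 (Set.Ici 0)) (hS : ∀ s, S ≤ s → G s = 0 ∧ G1 s = 0) :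
    ∫ y, V y * φ y * G (‖y - p‖ ^ 2) =
      ∫ y, φ y * (6 * G1 (‖y - p‖ ^ 2) + 4 * ‖y - p‖ ^ 2 * G2 (‖y - p‖ ^ 2)) := by
  have hc1 : ContinuousOn G1 (Set.Ici 0) := fun s hs => (h2 s hs).continuousAt.continuousWithinAt
  obtain ⟨c1, g1⟩ := rad_C1 (p := p) h1 hc1
  obtain ⟨c2, g2⟩ := rad_C1 (p := p) h2 hc
  have hG : C1c (fun y : E3 => G (‖y - p‖ ^ 2)) := ⟨c1, cs_ball fun y hy => (hS _ hy).1⟩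
  have hG1 : C1c (fun y : E3 => G1 (‖y - p‖ ^ 2)) := ⟨c2, cs_ball fun y hy => (hS _ hy).2⟩
  have hH : C1c (fun y => φ y * G1 (‖y - p‖ ^ 2)) := C1c.mul hφ hG1
  have he := euler hH p
  have hgc := C1.cont_grad hφ
  have hφc := hφ.continuous
  have hcG2 : Continuous (fun y : E3 => G2 (‖y - p‖ ^ 2)) :=
    hc.comp_continuous (by fun_prop) (fun y => by simp)
  have hcs2 : HasCompactSupport (fun y : E3 => G2 (‖y - p‖ ^ 2)) := by
    refine cs_ball (p := p) (S := max 0 (S + 1)) fun y hy => ?_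
    have h0 : 0 ≤ ‖y - p‖ ^ 2 := by positivity
    have hlt : S < ‖y - p‖ ^ 2 := by have := (le_max_right _ _).trans hy; linarith
    have e : G1 =ᶠ[𝓝 (‖y - p‖ ^ 2)] fun _ => 0 := by
      filter_upwards [lt_mem_nhds hlt] with s hs using (hS s hs.le).2
    have := (h2 _ h0).congr_of_eventuallyEq e.symm
    exact this.unique (hasDerivAt_const _ _)
  have i1 : Integrable (fun y => φ y * (6 * G1 (‖y - p‖ ^ 2))) :=
    (hφc.mul (continuous_const.mul hG1.1.continuous)).integrable_of_hasCompactSupport (hG1.2.mul_left (f := fun _ => 6)).mul_left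
  have i2 : Integrable (fun y => φ y * (4 * ‖y - p‖ ^ 2 * G2 (‖y - p‖ ^ 2))) :=
    (hφc.mul ((by fun_prop : Continuous fun y : E3 => 4 * ‖y - p‖^2).mul hcG2)).integrable_of_hasCompactSupport
      (hcs2.mul_left (f := fun y : E3 => 4 * ‖y - p‖^2)).mul_left
  have e1 : ∀ y, inner ℝ (gradient φ y) (gradient (fun y : E3 => G (‖y - p‖ ^ 2)) y) =
      2 * inner ℝ (y - p) (gradient (fun y => φ y * G1 (‖y - p‖ ^ 2)) y) - φ y * (4 * ‖y - p‖ ^ 2 * G2 (‖y - p‖ ^ 2)) := by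
    intro y
    rw [(g1 y).gradient, (hg_mul (C1.hg hφ y) (g2 y)).gradient]
    simp only [inner_add_right, inner_smul_right, real_inner_self_eq_norm_sq]
    rw [real_inner_comm]
    ring
  have hwk := hw _ hG
  simp_rw [e1] at hwk
  rw [integral_sub ((hH.int_grad_inner (by fun_prop)).const_mul 2) i2, integral_const_mul, he] at hwk
  have e2 : ∫ y, 3 * (φ y * G1 (‖y - p‖ ^ 2)) = (1/2) * ∫ y, φ y * (6 * G1 (‖y - p‖ ^ 2)) := by
    rw [← integral_const_mul]
    refine integral_congr_ae (Eventually.of_forall fun y => ?_)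
    simp only; ring
  rw [e2] at hwk
  have e3 : ∫ y, φ y * (6 * G1 (‖y - p‖ ^ 2) + 4 * ‖y - p‖ ^ 2 * G2 (‖y - p‖ ^ 2)) =
    (∫ y, φ y * (6 * G1 (‖y - p‖ ^ 2))) + ∫ y, φ y * (4 * ‖y - p‖ ^ 2 * G2 (‖y - p‖ ^ 2)) := by
    rw [← integral_add i1 i2]
    refine integral_congr_ae (Eventually.of_forall fun y => ?_)
    simp only; ring
  rw [e3]
  linarith

/-- kernel -/
def kq (e s : ℝ) : ℝ := (Real.sqrt (s + e))⁻¹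

lemma kq_deriv {e s : ℝ} (h : 0 < s + e) : HasDerivAt (kq e) (-(1/2) * kq e s * (s + e)⁻¹) s := by
  have h1 : HasDerivAt (fun s => s + e) 1 s := (hasDerivAt_id s).add_const e
  have h2 := (h1.sqrt h.ne').inv (Real.sqrt_pos.2 h).ne'
  refine h2.congr_deriv ?_
  rw [Real.sq_sqrt h.le]
  unfold kq
  have := Real.sqrt_pos.2 h
  field_simp

/-- the constant 4π -/
def Ac : ℝ := ∫ z : E3, 3 * (kq 1 (‖z‖ ^ 2) * ((‖z‖ ^ 2 + 1)⁻¹) ^ 2)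

lemma Ac_int : Integrable (fun z : E3 => 3 * (kq 1 (‖z‖ ^ 2) * ((‖z‖ ^ 2 + 1)⁻¹) ^ 2)) := by
  have h : Integrable (fun z : E3 => ((1:ℝ) + ‖z‖ ^ 2) ^ (-(5:ℝ) / 2)) :=
    integrable_rpow_neg_one_add_norm_sq (by simp; norm_num)
  refine (h.const_mul 3).congr (Eventually.of_forall fun z => ?_)
  have hp : 0 < 1 + ‖z‖ ^ 2 := by positivity
  simp only [kq]
  rw [add_comm (‖z‖ ^ 2) 1]
  generalize 1 + ‖z‖ ^ 2 = q at hp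
  have h1 : (q⁻¹) ^ 2 = q ^ (-(2:ℝ)) := by
    rw [Real.rpow_neg hp.le, inv_pow]; norm_num
  rw [h1, Real.sqrt_eq_rpow, ← Real.rpow_neg hp.le, ← Real.rpow_add hp]
  norm_num

lemma Ac_pos : 0 < Ac := by
  have h0 : ∀ z : E3, 0 < 3 * (kq 1 (‖z‖ ^ 2) * ((‖z‖ ^ 2 + 1)⁻¹) ^ 2) := by
    intro z
    have : 0 < ‖z‖ ^ 2 + 1 := by positivity
    unfold kq
    have := Real.sqrt_pos.2 this
    positivity
  refine (integral_pos_iff_support_of_nonneg (fun z => (h0 z).le) Ac_int).2 ?_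
  have : Function.support (fun z : E3 => 3 * (kq 1 (‖z‖ ^ 2) * ((‖z‖ ^ 2 + 1)⁻¹) ^ 2)) = Set.univ :=
    Set.eq_univ_of_forall fun z => (h0 z).ne'
  rw [this]; simp

lemma delta {ψ : E3 → ℝ} (hc : Continuous ψ) (hs : HasCompactSupport ψ) (x : E3) :
    Tendsto (fun n : ℕ => ∫ y : E3, 3 * (1 / ((n:ℝ) + 1)) ^ 2 * (kq ((1 / ((n:ℝ) + 1)) ^ 2) (‖y - x‖ ^ 2) *
      ((‖y - x‖ ^ 2 + (1 / ((n:ℝ) + 1)) ^ 2)⁻¹) ^ 2) * ψ y) atTop (𝓝 (Ac * ψ x)) := by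
  have key : ∀ ε : ℝ, 0 < ε → ∫ y : E3, 3 * ε ^ 2 * (kq (ε ^ 2) (‖y - x‖ ^ 2) *
      ((‖y - x‖ ^ 2 + ε ^ 2)⁻¹) ^ 2) * ψ y = ∫ z : E3, 3 * (kq 1 (‖z‖ ^ 2) * ((‖z‖ ^ 2 + 1)⁻¹) ^ 2) * ψ (ε • z + x) := by
    intro ε hε
    rw [← integral_add_right_eq_self _ x]
    simp only [add_sub_cancel_right]
    have := Measure.integral_comp_smul (volume : Measure E3) (fun y : E3 => 3 * ε ^ 2 * (kq (ε ^ 2) (‖y‖ ^ 2) *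
      ((‖y‖ ^ 2 + ε ^ 2)⁻¹) ^ 2) * ψ (y + x)) ε
    have h3 : Module.finrank ℝ E3 = 3 := by simp
    rw [h3, abs_of_pos (by positivity), smul_eq_mul] at this
    have h4 : ∫ y : E3, 3 * ε ^ 2 * (kq (ε ^ 2) (‖y‖ ^ 2) * ((‖y‖ ^ 2 + ε ^ 2)⁻¹) ^ 2) * ψ (y + x) =
      ε ^ 3 * ∫ z : E3, 3 * ε ^ 2 * (kq (ε ^ 2) (‖ε • z‖ ^ 2) *
      ((‖ε • z‖ ^ 2 + ε ^ 2)⁻¹) ^ 2) * ψ (ε • z + x) := by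
      rw [this]; field_simp
    rw [h4, ← integral_const_mul]
    refine integral_congr_ae (Eventually.of_forall fun z => ?_)
    simp only [norm_smul, Real.norm_eq_abs, abs_of_pos hε, mul_pow, kq]
    rw [show ε ^ 2 * ‖z‖ ^ 2 + ε ^ 2 = ε ^ 2 * (‖z‖ ^ 2 + 1) by ring, Real.sqrt_mul (by positivity), Real.sqrt_sq hε.le]
    have hp : 0 < ‖z‖ ^ 2 + 1 := by positivity
    have := Real.sqrt_pos.2 hp
    field_simp
  simp_rw [fun n : ℕ => key (1 / ((n:ℝ) + 1)) (by positivity)]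
  have hlim : Tendsto (fun n : ℕ => 1 / ((n:ℝ) + 1)) atTop (𝓝 0) := tendsto_one_div_add_atTop_nhds_zero_nat
  obtain ⟨M, hM⟩ := hs.exists_bound_of_continuous hc
  have hAc := Ac_int
  have e : Ac * ψ x = ∫ z : E3, 3 * (kq 1 (‖z‖ ^ 2) * ((‖z‖ ^ 2 + 1)⁻¹) ^ 2) * ψ x := by
    rw [integral_mul_const]; rfl
  rw [e]
  refine tendsto_integral_of_dominated_convergence (fun z => ‖3 * (kq 1 (‖z‖ ^ 2) * ((‖z‖ ^ 2 + 1)⁻¹) ^ 2)‖ * M) ?_ ?_ ?_ ?_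
  · intro n
    exact hAc.aestronglyMeasurable.mul (by fun_prop : Continuous fun z : E3 => ψ ((1 / ((n:ℝ) + 1)) • z + x)).aestronglyMeasurable
  · exact hAc.norm.mul_const M
  · intro n
    refine Eventually.of_forall fun z => ?_
    rw [norm_mul]
    exact mul_le_mul_of_nonneg_left (hM _) (norm_nonneg _)
  · refine Eventually.of_forall fun z => ?_
    refine Tendsto.const_mul _ ?_
    refine (hc.tendsto x).comp ?_
    have : Tendsto (fun n : ℕ => (1 / ((n:ℝ) + 1)) • z + x) atTop (𝓝 ((0:ℝ) • z + x)) :=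
      (hlim.smul_const z).add_const x
    simpa using this

lemma kq_le {e s : ℝ} (he : 0 ≤ e) (hs : 0 < s) : kq e s ≤ (Real.sqrt s)⁻¹ := by
  unfold kq
  exact inv_anti₀ (Real.sqrt_pos.2 hs) (Real.sqrt_le_sqrt (by linarith))

lemma kq_nonneg (e s : ℝ) : 0 ≤ kq e s := by unfold kq; positivity

lemma rep_int {f : E3 → ℝ} (hf : Integrable f) (hc : Continuous f) (x : E3) :
    Integrable (fun y => f y * ‖y - x‖⁻¹) := by
  obtain ⟨M, hM⟩ := (isCompact_closedBall x 1).exists_bound_of_continuousOn hc.continuousOn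
  have hm : Measurable (fun y : E3 => ‖y - x‖⁻¹) := by fun_prop
  have h1 : Integrable ((Metric.closedBall x 1).indicator fun y => f y * ‖y - x‖⁻¹) := by
    refine (near_int (p := x) (R := 1) (C := M) ?_ zero_le_one ?_ ?_).1
    · exact ((hc.measurable.mul hm).indicator Metric.isClosed_closedBall.measurableSet).aestronglyMeasurable
    · intro y hy hne
      have hp : 0 < ‖y - x‖ := norm_pos_iff.2 (sub_ne_zero.2 hne)
      have hmem : y ∈ Metric.closedBall x 1 := by simpa [dist_eq_norm] using hy
      rw [Set.indicator_of_mem hmem, abs_mul, abs_of_pos (inv_pos.2 hp)]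
      have h3 : ‖y - x‖⁻¹ ≤ (‖y - x‖ ^ 2)⁻¹ := inv_anti₀ (by positivity) (by nlinarith)
      exact mul_le_mul (hM y hmem) h3 (by positivity) ((norm_nonneg _).trans (hM y hmem))
    · intro y hy
      rw [Set.indicator_of_notMem]; simpa [dist_eq_norm] using hy
  refine (h1.norm.add hf.norm).mono' (hc.measurable.mul hm).aestronglyMeasurable (Eventually.of_forall fun y => ?_)
  simp only [Pi.add_apply]
  by_cases hy : y ∈ Metric.closedBall x 1
  · rw [Set.indicator_of_mem hy]
    have := norm_nonneg (f y); linarith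
  · rw [Set.indicator_of_notMem hy]
    have hp : 1 < ‖y - x‖ := by simpa [dist_eq_norm] using hy
    rw [norm_mul, norm_inv, norm_norm, norm_zero, zero_add]
    exact mul_le_of_le_one_right (norm_nonneg _) (inv_le_one_of_one_le₀ hp.le)

/-- error term bound, for fixed `L` and uniformly in `e` -/
lemma rep_step {V φ : E3 → ℝ} (hV : Continuous V) (hφ : ContDiff ℝ 1 φ) (hφ0 : ∀ x, 0 < φ x) (hw : WeakSol V φ)
    {w : E3 → ℝ} (hw1 : ∀ y, 0 < w y) (hw2 : ∀ y, (w y)⁻¹ ≤ 1 + ‖y‖ ^ 2) (hwI : Integrable fun y => w y * φ y ^ 2)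
    {ξ ξ1 ξ2 : ℝ → ℝ} {B : ℝ} (hB : 0 < B) (hd1 : ∀ t, HasDerivAt ξ (ξ1 t) t) (hd2 : ∀ t, HasDerivAt ξ1 (ξ2 t) t)
    (hc2 : Continuous ξ2) (hl : ∀ t, t ≤ 1 → ξ t = 1 ∧ ξ1 t = 0 ∧ ξ2 t = 0)
    (hr : ∀ t, 2 ≤ t → ξ t = 0 ∧ ξ1 t = 0 ∧ ξ2 t = 0) (hbd : ∀ t, |ξ1 t| ≤ B ∧ |ξ2 t| ≤ B)
    (x : E3) {m : ℝ} (hm : 1 ≤ m) (hmx : ‖x‖ ≤ m) {e : ℝ} (he : 0 < e) :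
    |(∫ y, V y * φ y * (ξ (‖y - x‖ ^ 2 / m ^ 4) * kq e (‖y - x‖ ^ 2))) +
      ∫ y, 3 * e * (kq e (‖y - x‖ ^ 2) * ((‖y - x‖ ^ 2 + e)⁻¹) ^ 2) * (ξ (‖y - x‖ ^ 2 / m ^ 4) * φ y)| ≤
      9 * B * ((∫ y, w y * φ y ^ 2) + 80 * om) / m := by
  have hm0 : 0 < m := by linarith
  let G : ℝ → ℝ := fun s => ξ (s / m ^ 4) * kq e s
  let G1 : ℝ → ℝ := fun s => ξ1 (s / m ^ 4) / m ^ 4 * kq e s - (1/2) * ξ (s / m ^ 4) * kq e s * (s + e)⁻¹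
  let G2 : ℝ → ℝ := fun s => ξ2 (s / m ^ 4) / m ^ 8 * kq e s - ξ1 (s / m ^ 4) / m ^ 4 * kq e s * (s + e)⁻¹
    + (3/4) * ξ (s / m ^ 4) * kq e s * (s + e)⁻¹ ^ 2
  have a1 : ∀ s, HasDerivAt (fun s => ξ (s / m ^ 4)) (ξ1 (s / m ^ 4) / m ^ 4) s := by
    intro s
    have := (hd1 (s / m ^ 4)).comp s ((hasDerivAt_id s).div_const (m ^ 4))
    exact this.congr_deriv (by ring)
  have a2 : ∀ s, HasDerivAt (fun s => ξ1 (s / m ^ 4)) (ξ2 (s / m ^ 4) / m ^ 4) s := by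
    intro s
    have := (hd2 (s / m ^ 4)).comp s ((hasDerivAt_id s).div_const (m ^ 4))
    exact this.congr_deriv (by ring)
  have a3 : ∀ s, 0 ≤ s → HasDerivAt (fun s => (s + e)⁻¹) (-((s + e)⁻¹ ^ 2)) s := by
    intro s hs
    have hp : s + e ≠ 0 := by positivity
    have := ((hasDerivAt_id s).add_const e).inv hp
    exact this.congr_deriv (by simp [neg_div])
  have hcξ : Continuous ξ := continuous_iff_continuousAt.2 fun t => (hd1 t).continuousAt
  have hcξ1 : Continuous ξ1 := continuous_iff_continuousAt.2 fun t => (hd2 t).continuousAt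
  have hck : ContinuousOn (kq e) (Set.Ici 0) := fun s (hs : 0 ≤ s) =>
    (kq_deriv (by positivity)).continuousAt.continuousWithinAt
  have hci : ContinuousOn (fun s => (s + e)⁻¹) (Set.Ici 0) := fun s (hs : 0 ≤ s) =>
    (a3 s hs).continuousAt.continuousWithinAt
  have h1 : ∀ s, 0 ≤ s → HasDerivAt G (G1 s) s := by
    intro s hs
    have hp : 0 < s + e := by positivity
    refine ((a1 s).mul (kq_deriv hp)).congr_deriv ?_
    simp only [G1]; ring
  have h2 : ∀ s, 0 ≤ s → HasDerivAt G1 (G2 s) s := by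
    intro s hs
    have hp : 0 < s + e := by positivity
    have t1 := ((a2 s).div_const (m ^ 4)).mul (kq_deriv hp)
    have t2 := (((a1 s).const_mul (1/2)).mul (kq_deriv hp)).mul (a3 s hs)
    refine (t1.sub t2).congr_deriv ?_
    simp only [G2, Pi.mul_apply]; field_simp; ring
  have hcG2 : ContinuousOn G2 (Set.Ici 0) := by
    have b1 : ContinuousOn (fun s => ξ (s / m ^ 4)) (Set.Ici 0) := (by fun_prop : Continuous fun s => ξ (s / m ^ 4)).continuousOn
    have b2 : ContinuousOn (fun s => ξ1 (s / m ^ 4)) (Set.Ici 0) := (by fun_prop : Continuous fun s => ξ1 (s / m ^ 4)).continuousOn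
    have b3 : ContinuousOn (fun s => ξ2 (s / m ^ 4)) (Set.Ici 0) := (by fun_prop : Continuous fun s => ξ2 (s / m ^ 4)).continuousOn
    exact (((b3.div_const _).mul hck).sub (((b2.div_const _).mul hck).mul hci)).add
      (((continuousOn_const.mul b1).mul hck).mul (hci.pow 2))
  have hm4 : 0 < m ^ 4 := by positivity
  have hz : ∀ s, 2 * m ^ 4 ≤ s → G s = 0 ∧ G1 s = 0 := by
    intro s hs
    obtain ⟨z0, z1, z2⟩ := hr (s / m ^ 4) (by rw [le_div_iff₀ hm4]; exact hs)
    simp only [G, G1, z0, z1]; simp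
  have hR := radial_test hφ hw x h1 h2 hcG2 hz
  let E : ℝ → ℝ := fun s => 6 * (ξ1 (s / m ^ 4) / m ^ 4 * kq e s) + 4 * s * (ξ2 (s / m ^ 4) / m ^ 8 * kq e s) -
    4 * s * (ξ1 (s / m ^ 4) / m ^ 4 * kq e s * (s + e)⁻¹)
  have hE : ∀ s, 0 ≤ s → 6 * G1 s + 4 * s * G2 s = E s - 3 * e * (kq e s * ((s + e)⁻¹) ^ 2) * ξ (s / m ^ 4) := by
    intro s hs
    have hp : 0 < s + e := by positivity
    simp only [G1, G2, E]
    field_simp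
    ring
  have hEz : ∀ s, 2 * m ^ 4 ≤ s → E s = 0 := by
    intro s hs
    obtain ⟨z0, z1, z2⟩ := hr (s / m ^ 4) (by rw [le_div_iff₀ hm4]; exact hs)
    simp only [E, z2, z1]; simp
  have hEb : ∀ s, 0 ≤ s → |E s| ≤ 18 * B / m ^ 6 := by
    intro s hs
    by_cases hs1 : s ≤ m ^ 4
    · obtain ⟨z0, z1, z2⟩ := hl (s / m ^ 4) (by rw [div_le_one hm4]; exact hs1)
      simp only [E, z1, z2]; simp; positivity
    by_cases hs2 : 2 * m ^ 4 ≤ s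
    · rw [hEz s hs2, abs_zero]; positivity
    push Not at hs1 hs2
    have hs0 : 0 < s := by nlinarith
    have hk : kq e s ≤ (m ^ 2)⁻¹ := by
      refine (kq_le he.le hs0).trans (inv_anti₀ (by positivity) ?_)
      rw [show m ^ 2 = Real.sqrt (m ^ 4) by rw [show m ^ 4 = (m ^ 2) ^ 2 by ring, Real.sqrt_sq (by positivity)]]
      exact Real.sqrt_le_sqrt hs1.le
    have hk0 := kq_nonneg e s
    obtain ⟨hb1, hb2⟩ := hbd (s / m ^ 4)
    have hsi : s * (s + e)⁻¹ ≤ 1 := by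
      rw [← div_eq_mul_inv, div_le_one (by positivity)]; linarith
    have hsi0 : 0 ≤ s * (s + e)⁻¹ := by positivity
    have c1 : |ξ1 (s / m ^ 4) / m ^ 4 * kq e s| ≤ B / m ^ 4 * (m ^ 2)⁻¹ := by
      rw [abs_mul, abs_div, abs_of_pos hm4, abs_of_nonneg hk0]
      gcongr
    have c2 : |s * (ξ2 (s / m ^ 4) / m ^ 8 * kq e s)| ≤ (2 * m ^ 4) * (B / m ^ 8 * (m ^ 2)⁻¹) := by
      rw [abs_mul, abs_mul, abs_div, abs_of_pos (show (0:ℝ) < m ^ 8 by positivity), abs_of_nonneg hk0, abs_of_pos hs0]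
      gcongr
    have c3 : |ξ1 (s / m ^ 4) / m ^ 4 * kq e s * (s * (s + e)⁻¹)| ≤ B / m ^ 4 * (m ^ 2)⁻¹ := by
      rw [abs_mul, abs_of_nonneg hsi0]
      exact (mul_le_of_le_one_right (abs_nonneg _) hsi).trans c1
    have e1 : E s = 6 * (ξ1 (s / m ^ 4) / m ^ 4 * kq e s) + 4 * (s * (ξ2 (s / m ^ 4) / m ^ 8 * kq e s)) -
      4 * (ξ1 (s / m ^ 4) / m ^ 4 * kq e s * (s * (s + e)⁻¹)) := by simp only [E]; ring
    have e2 : B / m ^ 4 * (m ^ 2)⁻¹ = B / m ^ 6 := by field_simp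
    have e3 : (2 * m ^ 4) * (B / m ^ 8 * (m ^ 2)⁻¹) = 2 * (B / m ^ 6) := by field_simp
    rw [e2] at c1 c3
    rw [e3] at c2
    rw [e1, show 18 * B / m ^ 6 = 18 * (B / m ^ 6) by ring]
    have := abs_le.1 c1
    have := abs_le.1 c2
    have := abs_le.1 c3
    rw [abs_le]
    constructor <;> linarith
  have hφc := hφ.continuous
  have hckx : Continuous (fun y : E3 => kq e (‖y - x‖ ^ 2)) := hck.comp_continuous (by fun_prop) fun y => by simp
  have hcix : Continuous (fun y : E3 => (‖y - x‖ ^ 2 + e)⁻¹) := hci.comp_continuous (f := fun y : E3 => ‖y - x‖ ^ 2) (by fun_prop) fun y => by simp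
  have hcE : Continuous (fun y : E3 => φ y * E (‖y - x‖ ^ 2)) := by
    simp only [E]; fun_prop
  have hsE : HasCompactSupport (fun y : E3 => φ y * E (‖y - x‖ ^ 2)) :=
    cs_ball (p := x) (S := 2 * m ^ 4) fun y hy => by rw [hEz _ hy, mul_zero]
  have iE : Integrable (fun y : E3 => φ y * E (‖y - x‖ ^ 2)) := hcE.integrable_of_hasCompactSupport hsE
  have iD : Integrable (fun y : E3 => 3 * e * (kq e (‖y - x‖ ^ 2) * ((‖y - x‖ ^ 2 + e)⁻¹) ^ 2) * (ξ (‖y - x‖ ^ 2 / m ^ 4) * φ y)) := by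
    refine Continuous.integrable_of_hasCompactSupport (by fun_prop) (cs_ball (p := x) (S := 2 * m ^ 4) fun y hy => ?_)
    rw [(hr (‖y - x‖ ^ 2 / m ^ 4) (by rw [le_div_iff₀ hm4]; exact hy)).1]; simp
  have hR2 : (∫ y, V y * φ y * (ξ (‖y - x‖ ^ 2 / m ^ 4) * kq e (‖y - x‖ ^ 2))) +
      ∫ y, 3 * e * (kq e (‖y - x‖ ^ 2) * ((‖y - x‖ ^ 2 + e)⁻¹) ^ 2) * (ξ (‖y - x‖ ^ 2 / m ^ 4) * φ y) =
      ∫ y, φ y * E (‖y - x‖ ^ 2) := by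
    have e1 : ∫ y, φ y * (6 * G1 (‖y - x‖ ^ 2) + 4 * ‖y - x‖ ^ 2 * G2 (‖y - x‖ ^ 2)) =
        (∫ y, φ y * E (‖y - x‖ ^ 2)) - ∫ y, 3 * e * (kq e (‖y - x‖ ^ 2) * ((‖y - x‖ ^ 2 + e)⁻¹) ^ 2) * (ξ (‖y - x‖ ^ 2 / m ^ 4) * φ y) := by
      rw [← integral_sub iE iD]
      refine integral_congr_ae (Eventually.of_forall fun y => ?_)
      simp only
      rw [hE _ (by positivity)]
      ring
    rw [e1] at hR
    linarith
  rw [hR2]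
  -- final bound
  have hball := near_int (g := (Metric.closedBall x (2 * m ^ 2)).indicator fun _ => (1:ℝ)) (p := x) (R := 2 * m ^ 2) (C := (2 * m ^ 2) ^ 2)
    ((measurable_const.indicator Metric.isClosed_closedBall.measurableSet).aestronglyMeasurable) (by positivity)
    (by
      intro y hy hne
      have hp : 0 < ‖y - x‖ := norm_pos_iff.2 (sub_ne_zero.2 hne)
      rw [Set.indicator_of_mem (by simpa [dist_eq_norm] using hy), abs_one, ← div_eq_mul_inv, one_le_div (by positivity)]
      exact pow_le_pow_left₀ hp.le hy 2)
    (by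
      intro y hy
      rw [Set.indicator_of_notMem]; simpa [dist_eq_norm] using hy)
  have hb1 : ∫ y, (Metric.closedBall x (2 * m ^ 2)).indicator (fun _ => (1:ℝ)) y ≤ 8 * om * m ^ 6 := by
    refine (le_abs_self _).trans (hball.2.1.trans (le_of_eq ?_)); ring
  have hpt : ∀ y, |φ y * E (‖y - x‖ ^ 2)| ≤ 9 * B / m ^ 6 * (m ^ 5 * (w y * φ y ^ 2)
      + 10 / m * (Metric.closedBall x (2 * m ^ 2)).indicator (fun _ => (1:ℝ)) y) := by
    intro y
    have hwy := hw1 y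
    by_cases hy : y ∈ Metric.closedBall x (2 * m ^ 2)
    · rw [Set.indicator_of_mem hy, abs_mul, abs_of_pos (hφ0 y)]
      have hyx : ‖y - x‖ ≤ 2 * m ^ 2 := by simpa [dist_eq_norm] using hy
      have hyn : ‖y‖ ≤ 3 * m ^ 2 := by
        have : ‖y‖ ≤ ‖y - x‖ + ‖x‖ := by simpa using norm_add_le (y - x) x
        nlinarith
      have hwi : (w y)⁻¹ ≤ 10 * m ^ 4 := by
        refine (hw2 y).trans ?_
        have h5 : ‖y‖ ^ 2 ≤ (3 * m ^ 2) ^ 2 := pow_le_pow_left₀ (norm_nonneg _) hyn 2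
        have h6 : 1 ≤ m ^ 4 := one_le_pow₀ hm
        nlinarith
      have hyo : 2 * φ y ≤ m ^ 5 * (w y * φ y ^ 2) + (m ^ 5)⁻¹ * (w y)⁻¹ := by
        have hq : 0 < m ^ 5 * w y := by positivity
        have h7 : 0 ≤ (m ^ 5 * w y) * (φ y - (m ^ 5 * w y)⁻¹) ^ 2 := by positivity
        have h8 : (m ^ 5 * w y) * (φ y - (m ^ 5 * w y)⁻¹) ^ 2 = m ^ 5 * (w y * φ y ^ 2) - 2 * φ y + (m ^ 5)⁻¹ * (w y)⁻¹ := by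
          field_simp; ring
        linarith
      have h9 : (m ^ 5)⁻¹ * (w y)⁻¹ ≤ 10 / m := by
        calc (m ^ 5)⁻¹ * (w y)⁻¹ ≤ (m ^ 5)⁻¹ * (10 * m ^ 4) := by gcongr
          _ = 10 / m := by field_simp
      calc φ y * |E (‖y - x‖ ^ 2)| ≤ φ y * (18 * B / m ^ 6) :=
            mul_le_mul_of_nonneg_left (hEb _ (by positivity)) (hφ0 y).le
        _ = 9 * B / m ^ 6 * (2 * φ y) := by ring
        _ ≤ _ := by
            refine mul_le_mul_of_nonneg_left ?_ (by positivity)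
            linarith
    · have hyx : 2 * m ^ 2 < ‖y - x‖ := by simpa [dist_eq_norm] using hy
      rw [hEz (‖y - x‖ ^ 2) (by nlinarith), mul_zero, abs_zero, Set.indicator_of_notMem hy]
      positivity
  have hfin := integral_mono iE.abs ((((hwI.const_mul (m ^ 5))).add (hball.1.const_mul (10 / m))).const_mul (9 * B / m ^ 6)) hpt
  refine (abs_integral_le_integral_abs).trans (hfin.trans ?_)
  simp only [Pi.add_apply]
  rw [integral_const_mul, integral_add (hwI.const_mul _) (hball.1.const_mul _), integral_const_mul, integral_const_mul]
  calc 9 * B / m ^ 6 * (m ^ 5 * (∫ y, w y * φ y ^ 2) + 10 / m * ∫ y, (Metric.closedBall x (2 * m ^ 2)).indicator (fun _ => (1:ℝ)) y)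
      ≤ 9 * B / m ^ 6 * (m ^ 5 * (∫ y, w y * φ y ^ 2) + 10 / m * (8 * om * m ^ 6)) := by gcongr
    _ = _ := by field_simp; ring

lemma f_int {V φ : E3 → ℝ} (hV : Continuous V) (hφ : Continuous φ) {C β : ℝ} (hβ : 2 < β)
    (hb : ∀ x : E3, |V x| ≤ C * (1 + ‖x‖ ^ 2) ^ (-β / 2))
    (hI : Integrable (fun x : E3 => (1 + ‖x‖ ^ 2) ^ ((3 - β) / 2 - 1) * φ x ^ 2)) :
    Integrable (fun x => V x * φ x) := by
  have h1 : Integrable (fun z : E3 => ((1:ℝ) + ‖z‖ ^ 2) ^ (-(β + 1) / 2)) :=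
    integrable_rpow_neg_one_add_norm_sq (by simp; linarith)
  refine ((h1.add hI).const_mul C).mono' (hV.mul hφ).aestronglyMeasurable (Eventually.of_forall fun x => ?_)
  have hp : (0:ℝ) < 1 + ‖x‖ ^ 2 := by positivity
  have hC : 0 ≤ C := by
    have h0 := (abs_nonneg _).trans (hb x)
    by_contra h
    have : C * (1 + ‖x‖ ^ 2) ^ (-β / 2) < 0 := mul_neg_of_neg_of_pos (not_le.1 h) (by positivity)
    linarith
  simp only [Pi.add_apply]
  have hb := hb x
  generalize 1 + ‖x‖ ^ 2 = q at *
  rw [norm_mul, Real.norm_eq_abs, Real.norm_eq_abs]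
  have e1 : q ^ (-(β + 1) / 2) = (q ^ (-(β + 1) / 4)) ^ 2 := by
    rw [← Real.rpow_natCast, ← Real.rpow_mul hp.le]; congr 1; push_cast; ring
  have e2 : q ^ ((3 - β) / 2 - 1) = (q ^ ((1 - β) / 4)) ^ 2 := by
    rw [← Real.rpow_natCast, ← Real.rpow_mul hp.le]; congr 1; push_cast; ring
  have e3 : q ^ (-β / 2) = q ^ (-(β + 1) / 4) * q ^ ((1 - β) / 4) := by
    rw [← Real.rpow_add hp]; congr 1; ring
  rw [e3] at hb
  rw [e1, e2, ← sq_abs (φ x)]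
  have p1 : 0 < q ^ (-(β + 1) / 4) := by positivity
  have p2 : 0 < q ^ ((1 - β) / 4) := by positivity
  generalize q ^ (-(β + 1) / 4) = u at *
  generalize q ^ ((1 - β) / 4) = v at *
  have h3 := abs_nonneg (φ x)
  generalize |φ x| = f at *
  calc |V x| * f ≤ C * (u * v) * f := by gcongr
    _ = C * (u * (v * f)) := by ring
    _ ≤ C * (u ^ 2 + v ^ 2 * f ^ 2) := by
      gcongr
      nlinarith [sq_nonneg (u - v * f), sq_nonneg u, sq_nonneg (v * f)]

lemma rep {V φ : E3 → ℝ} (hV : Continuous V) (hφ : ContDiff ℝ 1 φ) (hφ0 : ∀ x, 0 < φ x) (hw : WeakSol V φ)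
    {w : E3 → ℝ} (hw1 : ∀ y, 0 < w y) (hw2 : ∀ y, (w y)⁻¹ ≤ 1 + ‖y‖ ^ 2) (hwI : Integrable fun y => w y * φ y ^ 2)
    (hf : Integrable (fun x => V x * φ x)) (x : E3) :
    ∫ y, V y * φ y * ‖y - x‖⁻¹ = - (Ac * φ x) := by
  obtain ⟨ξ, ξ1, ξ2, B, hB, hd1, hd2, hc2, hl, hr, h01, -, hbd⟩ := cutoff
  have hcξ : Continuous ξ := continuous_iff_continuousAt.2 fun t => (hd1 t).continuousAt
  have hφc := hφ.continuous
  have hfc : Continuous (fun y => V y * φ y) := hV.mul hφc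
  have hint := rep_int hf hfc x
  have hne : ∀ᵐ y : E3, y ≠ x := by
    have : ({x}ᶜ : Set E3) ∈ ae volume := by
      rw [mem_ae_iff, compl_compl]; exact measure_singleton x
    exact this
  set K := 9 * B * ((∫ y, w y * φ y ^ 2) + 80 * om) with hK
  have hmi : Measurable (fun y : E3 => ‖y - x‖⁻¹) := by fun_prop
  have hbdd : ∀ y : E3, ∀ t a : ℝ, 0 ≤ a → a ≤ ‖y - x‖⁻¹ → ‖V y * φ y * (ξ t * a)‖ ≤ ‖V y * φ y * ‖y - x‖⁻¹‖ := by
    intro y t a ha h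
    rw [norm_mul, norm_mul (V y * φ y)]
    refine mul_le_mul_of_nonneg_left ?_ (norm_nonneg _)
    rw [Real.norm_eq_abs, Real.norm_eq_abs, abs_of_nonneg (mul_nonneg (h01 t).1 ha), abs_of_nonneg (ha.trans h)]
    exact (mul_le_of_le_one_left ha (h01 t).2).trans h
  have A : ∀ m : ℝ, 1 ≤ m → ‖x‖ ≤ m → |(∫ y, V y * φ y * (ξ (‖y - x‖ ^ 2 / m ^ 4) * ‖y - x‖⁻¹)) + Ac * φ x| ≤ K / m := by
    intro m hm hmx
    have hm4 : 0 < m ^ 4 := by positivity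
    have hε : ∀ n : ℕ, 0 < (1 / ((n:ℝ) + 1)) ^ 2 := fun n => by positivity
    have hε0 : Tendsto (fun n : ℕ => (1 / ((n:ℝ) + 1)) ^ 2) atTop (𝓝 0) := by
      have := (tendsto_one_div_add_atTop_nhds_zero_nat (𝕜 := ℝ)).pow 2
      simpa using this
    have t1 : Tendsto (fun n : ℕ => ∫ y, V y * φ y * (ξ (‖y - x‖ ^ 2 / m ^ 4) * kq ((1 / ((n:ℝ) + 1)) ^ 2) (‖y - x‖ ^ 2)))
        atTop (𝓝 (∫ y, V y * φ y * (ξ (‖y - x‖ ^ 2 / m ^ 4) * ‖y - x‖⁻¹))) := by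
      refine tendsto_integral_of_dominated_convergence (fun y => ‖V y * φ y * ‖y - x‖⁻¹‖) ?_ hint.norm ?_ ?_
      · intro n
        refine (hfc.measurable.mul ((hcξ.comp (by fun_prop)).measurable.mul ?_)).aestronglyMeasurable
        unfold kq; fun_prop
      · intro n
        filter_upwards [hne] with y hy
        have hp : 0 < ‖y - x‖ := norm_pos_iff.2 (sub_ne_zero.2 hy)
        refine hbdd y _ _ (kq_nonneg _ _) ?_
        have := kq_le (hε n).le (show 0 < ‖y - x‖ ^ 2 by positivity)
        rwa [Real.sqrt_sq hp.le] at this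
      · filter_upwards [hne] with y hy
        have hp : 0 < ‖y - x‖ := norm_pos_iff.2 (sub_ne_zero.2 hy)
        refine Tendsto.const_mul _ (Tendsto.const_mul _ ?_)
        have h1 : Tendsto (fun e : ℝ => (Real.sqrt (‖y - x‖ ^ 2 + e))⁻¹) (𝓝 0) (𝓝 (Real.sqrt (‖y - x‖ ^ 2 + 0))⁻¹) := by
          refine ContinuousAt.tendsto (f := fun e : ℝ => (Real.sqrt (‖y - x‖ ^ 2 + e))⁻¹) ?_
          refine ContinuousAt.inv₀ (by fun_prop) ?_
          rw [add_zero, Real.sqrt_sq hp.le]; exact hp.ne'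
        rw [add_zero, Real.sqrt_sq hp.le] at h1
        exact h1.comp hε0
    have hψc : Continuous (fun y => ξ (‖y - x‖ ^ 2 / m ^ 4) * φ y) := (hcξ.comp (by fun_prop)).mul hφc
    have hψs : HasCompactSupport (fun y => ξ (‖y - x‖ ^ 2 / m ^ 4) * φ y) :=
      cs_ball (p := x) (S := 2 * m ^ 4) fun y hy => by
        rw [(hr (‖y - x‖ ^ 2 / m ^ 4) (by rw [le_div_iff₀ hm4]; exact hy)).1]; simp
    have t2 := delta hψc hψs x
    simp only [sub_self, norm_zero, ne_eq, OfNat.ofNat_ne_zero, not_false_eq_true, zero_pow, zero_div,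
      (hl 0 zero_le_one).1, one_mul] at t2
    refine le_of_tendsto (t1.add t2).abs (Eventually.of_forall fun n => ?_)
    exact rep_step hV hφ hφ0 hw hw1 hw2 hwI hB hd1 hd2 hc2 hl hr hbd x hm hmx (hε n)
  have hmt : Tendsto (fun n : ℕ => (n:ℝ) + (1 + ‖x‖)) atTop atTop :=
    tendsto_atTop_add_const_right _ _ tendsto_natCast_atTop_atTop
  have t3 : Tendsto (fun n : ℕ => ∫ y, V y * φ y * (ξ (‖y - x‖ ^ 2 / ((n:ℝ) + (1 + ‖x‖)) ^ 4) * ‖y - x‖⁻¹))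
        atTop (𝓝 (∫ y, V y * φ y * ‖y - x‖⁻¹)) := by
    refine tendsto_integral_of_dominated_convergence (fun y => ‖V y * φ y * ‖y - x‖⁻¹‖) ?_ hint.norm ?_ ?_
    · intro n
      exact (hfc.measurable.mul ((hcξ.comp (by fun_prop)).measurable.mul hmi)).aestronglyMeasurable
    · intro n
      exact Eventually.of_forall fun y => hbdd y _ _ (by positivity) le_rfl
    · refine Eventually.of_forall fun y => tendsto_const_nhds.congr' ?_
      filter_upwards [hmt.eventually_ge_atTop (1 + ‖y - x‖ ^ 2)] with n hn
      rw [(hl _ _).1, one_mul]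
      have h1 : 1 ≤ (n:ℝ) + (1 + ‖x‖) := by have := norm_nonneg x; have := Nat.cast_nonneg (α := ℝ) n; linarith
      rw [div_le_one (by positivity)]
      have h2 : ((n:ℝ) + (1 + ‖x‖)) ^ 1 ≤ ((n:ℝ) + (1 + ‖x‖)) ^ 4 := pow_le_pow_right₀ h1 (by norm_num)
      rw [pow_one] at h2
      linarith
  have t4 : Tendsto (fun n : ℕ => K / ((n:ℝ) + (1 + ‖x‖))) atTop (𝓝 0) := tendsto_const_nhds.div_atTop hmt
  have h5 : |(∫ y, V y * φ y * ‖y - x‖⁻¹) + Ac * φ x| ≤ 0 := by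
    refine le_of_tendsto_of_tendsto (t3.add_const (Ac * φ x)).abs t4 (Eventually.of_forall fun n => ?_)
    have := norm_nonneg x
    have := Nat.cast_nonneg (α := ℝ) n
    exact A _ (by linarith) (by linarith)
  have := abs_nonpos_iff.1 h5
  linarith

lemma near_pt {V φ : E3 → ℝ} {C β : ℝ} (hC : 0 < C) (hβ : 2 < β)
    (hb : ∀ x : E3, |V x| ≤ C * (1 + ‖x‖ ^ 2) ^ (-β / 2)) {x : E3} (hx : 0 < ‖x‖) {lam : ℝ} (hl : 0 < lam)
    (y : E3) (hy : y ∈ Metric.closedBall x (‖x‖ / 2)) : |V y * φ y * ‖y - x‖⁻¹ * ‖x‖| ≤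
      ‖x‖ / 2 * (lam * (C ^ 2 * (4:ℝ) ^ ((β + 1) / 2) * ‖x‖ ^ (-(β + 1))) * ((1 + ‖y‖ ^ 2) ^ ((3 - β) / 2 - 1) * φ y ^ 2) + lam⁻¹ * (‖y - x‖ ^ 2)⁻¹) := by
  have hyx : ‖y - x‖ ≤ ‖x‖ / 2 := by simpa [dist_eq_norm] using hy
  have hyn : ‖x‖ / 2 ≤ ‖y‖ := by
    have : ‖x‖ ≤ ‖y‖ + ‖y - x‖ := by
      have := norm_sub_le y (y - x); simpa using this
    linarith
  have hp : (0:ℝ) < 1 + ‖y‖ ^ 2 := by positivity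
  have h1 : (V y * φ y) ^ 2 ≤ (C ^ 2 * (4:ℝ) ^ ((β + 1) / 2) * ‖x‖ ^ (-(β + 1))) * ((1 + ‖y‖ ^ 2) ^ ((3 - β) / 2 - 1) * φ y ^ 2) := by
    have hb2 : V y ^ 2 ≤ (C * (1 + ‖y‖ ^ 2) ^ (-β / 2)) ^ 2 := by
      rw [← sq_abs]; exact pow_le_pow_left₀ (abs_nonneg _) (hb y) 2
    have e1 : (C * (1 + ‖y‖ ^ 2) ^ (-β / 2)) ^ 2 = C ^ 2 * (1 + ‖y‖ ^ 2) ^ (-(β + 1) / 2) * (1 + ‖y‖ ^ 2) ^ ((3 - β) / 2 - 1) := by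
      rw [mul_pow, mul_assoc, ← Real.rpow_add hp, ← Real.rpow_natCast ((1 + ‖y‖ ^ 2) ^ (-β / 2)), ← Real.rpow_mul hp.le]
      congr 2; push_cast; ring
    have e2 : (1 + ‖y‖ ^ 2) ^ (-(β + 1) / 2) ≤ (4:ℝ) ^ ((β + 1) / 2) * ‖x‖ ^ (-(β + 1)) := by
      have h3 : (1 + ‖y‖ ^ 2) ^ (-(β + 1) / 2) ≤ (‖x‖ ^ 2 / 4) ^ (-(β + 1) / 2) := by
        refine Real.rpow_le_rpow_of_nonpos (by positivity) ?_ (by linarith)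
        nlinarith
      refine h3.trans (le_of_eq ?_)
      rw [Real.div_rpow (by positivity) (by norm_num), ← Real.rpow_natCast, ← Real.rpow_mul hx.le, div_eq_mul_inv,
        ← Real.rpow_neg (by norm_num), mul_comm]
      congr 2
      · ring
      · push_cast; ring
    calc (V y * φ y) ^ 2 = V y ^ 2 * φ y ^ 2 := by ring
      _ ≤ (C ^ 2 * (1 + ‖y‖ ^ 2) ^ (-(β + 1) / 2) * (1 + ‖y‖ ^ 2) ^ ((3 - β) / 2 - 1)) * φ y ^ 2 := by
          rw [← e1]; gcongr
      _ ≤ (C ^ 2 * ((4:ℝ) ^ ((β + 1) / 2) * ‖x‖ ^ (-(β + 1))) * (1 + ‖y‖ ^ 2) ^ ((3 - β) / 2 - 1)) * φ y ^ 2 := by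
          gcongr
      _ = _ := by ring
  rw [abs_mul, abs_mul, abs_of_pos hx, abs_of_nonneg (inv_nonneg.2 (norm_nonneg (y - x)))]
  rw [← sq_abs] at h1
  have h2 : 2 * (|V y * φ y| * ‖y - x‖⁻¹) ≤ lam * |V y * φ y| ^ 2 + lam⁻¹ * (‖y - x‖ ^ 2)⁻¹ := by
    rw [← inv_pow]
    generalize |V y * φ y| = f
    generalize ‖y - x‖⁻¹ = t
    have h7 : 0 ≤ lam * (f - lam⁻¹ * t) ^ 2 := by positivity
    have h8 : lam * (f - lam⁻¹ * t) ^ 2 = lam * f ^ 2 - 2 * (f * t) + lam⁻¹ * t ^ 2 := by field_simp; ring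
    linarith
  calc |V y * φ y| * ‖y - x‖⁻¹ * ‖x‖ = ‖x‖ / 2 * (2 * (|V y * φ y| * ‖y - x‖⁻¹)) := by ring
    _ ≤ ‖x‖ / 2 * (lam * ((C ^ 2 * (4:ℝ) ^ ((β + 1) / 2) * ‖x‖ ^ (-(β + 1))) * ((1 + ‖y‖ ^ 2) ^ ((3 - β) / 2 - 1) * φ y ^ 2)) + lam⁻¹ * (‖y - x‖ ^ 2)⁻¹) := by
        refine mul_le_mul_of_nonneg_left (h2.trans ?_) (by positivity)
        gcongr
    _ = _ := by ring

lemma near_part {V φ : E3 → ℝ} (hV : Continuous V) (hφ : Continuous φ) {C β : ℝ} (hC : 0 < C) (hβ : 2 < β)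
    (hb : ∀ x : E3, |V x| ≤ C * (1 + ‖x‖ ^ 2) ^ (-β / 2))
    (hI : Integrable (fun x : E3 => (1 + ‖x‖ ^ 2) ^ ((3 - β) / 2 - 1) * φ x ^ 2))
    (hf : Integrable (fun x => V x * φ x)) {x : E3} (hx : 0 < ‖x‖) :
    |∫ y in Metric.closedBall x (‖x‖ / 2), V y * φ y * ‖y - x‖⁻¹ * ‖x‖| ≤
      (C ^ 2 * (4:ℝ) ^ ((β + 1) / 2) * (∫ y, (1 + ‖y‖ ^ 2) ^ ((3 - β) / 2 - 1) * φ y ^ 2) + om) * ‖x‖ ^ (-((β - 2) / 2)) := by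
  set J := ∫ y, (1 + ‖y‖ ^ 2) ^ ((3 - β) / 2 - 1) * φ y ^ 2 with hJ
  have hfc : Continuous (fun y => V y * φ y) := hV.mul hφ
  set D := C ^ 2 * (4:ℝ) ^ ((β + 1) / 2) * ‖x‖ ^ (-(β + 1)) with hD
  set lam := ‖x‖ ^ (2 + (β - 2) / 2) with hlam
  have hl : 0 < lam := by positivity
  have hD0 : 0 ≤ D := by positivity
  clear_value J D lam
  have hmS : MeasurableSet (Metric.closedBall x (‖x‖ / 2)) := Metric.isClosed_closedBall.measurableSet
  have i1 : IntegrableOn (fun y => V y * φ y * ‖y - x‖⁻¹ * ‖x‖) (Metric.closedBall x (‖x‖ / 2)) :=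
    ((rep_int hf hfc x).mul_const _).integrableOn
  have i2 : IntegrableOn (fun y => lam * D * ((1 + ‖y‖ ^ 2) ^ ((3 - β) / 2 - 1) * φ y ^ 2)) (Metric.closedBall x (‖x‖ / 2)) :=
    (hI.const_mul _).integrableOn
  have i3 : IntegrableOn (fun y : E3 => lam⁻¹ * (‖y - x‖ ^ 2)⁻¹) (Metric.closedBall x (‖x‖ / 2)) :=
    (inv2_int x).const_mul _
  calc _ ≤ ∫ y in Metric.closedBall x (‖x‖ / 2), |V y * φ y * ‖y - x‖⁻¹ * ‖x‖| := abs_integral_le_integral_abs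
    _ ≤ ∫ y in Metric.closedBall x (‖x‖ / 2), ‖x‖ / 2 * (lam * D * ((1 + ‖y‖ ^ 2) ^ ((3 - β) / 2 - 1) * φ y ^ 2) + lam⁻¹ * (‖y - x‖ ^ 2)⁻¹) :=
        setIntegral_mono_on i1.abs (by exact (i2.add i3).const_mul _) hmS (by rw [hD]; exact near_pt hC hβ hb hx hl)
    _ = ‖x‖ / 2 * (lam * D * (∫ y in Metric.closedBall x (‖x‖ / 2), (1 + ‖y‖ ^ 2) ^ ((3 - β) / 2 - 1) * φ y ^ 2) + lam⁻¹ * (om * (‖x‖ / 2))) := by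
        rw [integral_const_mul, integral_add i2 i3, integral_const_mul, integral_const_mul, inv2_val _ (by positivity)]
    _ ≤ ‖x‖ / 2 * (lam * D * J + lam⁻¹ * (om * (‖x‖ / 2))) := by
        gcongr
        rw [hJ]; exact setIntegral_le_integral hI (Eventually.of_forall fun y => by positivity)
    _ = (C ^ 2 * (4:ℝ) ^ ((β + 1) / 2) * J) / 2 * (‖x‖ * lam * ‖x‖ ^ (-(β + 1))) + om / 4 * (‖x‖ * ‖x‖ * lam⁻¹) := by
        rw [hD]; ring
    _ = (C ^ 2 * (4:ℝ) ^ ((β + 1) / 2) * J) / 2 * ‖x‖ ^ (-((β - 2) / 2)) + om / 4 * ‖x‖ ^ (-((β - 2) / 2)) := by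
        have a1 : ‖x‖ * lam * ‖x‖ ^ (-(β + 1)) = ‖x‖ ^ (-((β - 2) / 2)) := by
          nth_rw 1 [← Real.rpow_one ‖x‖]
          rw [hlam, ← Real.rpow_add hx, ← Real.rpow_add hx]; congr 1; ring
        have a2 : ‖x‖ * ‖x‖ * lam⁻¹ = ‖x‖ ^ (-((β - 2) / 2)) := by
          have : ‖x‖ * ‖x‖ = ‖x‖ ^ (2:ℝ) := by rw [Real.rpow_two, sq]
          rw [hlam, ← Real.rpow_neg hx.le, this, ← Real.rpow_add hx]; congr 1; ring
        rw [a1, a2]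
    _ ≤ _ := by
        have hJ0 : 0 ≤ J := by rw [hJ]; exact integral_nonneg fun y => by positivity
        have h9 : 0 ≤ ‖x‖ ^ (-((β - 2) / 2)) := by positivity
        have h10 : 0 ≤ C ^ 2 * (4:ℝ) ^ ((β + 1) / 2) * J := mul_nonneg (by positivity) hJ0
        rw [add_mul]
        have h11 := mul_nonneg h10 h9
        have h12 := mul_nonneg om_pos.le h9
        linarith

lemma decay {V φ : E3 → ℝ} (hV : Continuous V) (hφ : ContDiff ℝ 1 φ) (hφ0 : ∀ x, 0 < φ x) (hw : WeakSol V φ)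
    {C β : ℝ} (hC : 0 < C) (hβ : 2 < β) (hβ2 : β ≤ 5 / 2)
    (hb : ∀ x : E3, |V x| ≤ C * (1 + ‖x‖ ^ 2) ^ (-β / 2))
    (hI : Integrable (fun x : E3 => (1 + ‖x‖ ^ 2) ^ ((3 - β) / 2 - 1) * φ x ^ 2)) :
    ∃ c : ℝ, Tendsto (fun x => ‖x‖ * φ x) (comap (fun x : E3 => ‖x‖) atTop) (𝓝 c) := by
  have hφc := hφ.continuous
  have hf := f_int hV hφc hβ hb hI
  have hfc : Continuous (fun y => V y * φ y) := hV.mul hφc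
  have hrep := rep hV hφ hφ0 hw (w := fun y => (1 + ‖y‖ ^ 2) ^ ((3 - β) / 2 - 1)) (fun y => by positivity) (fun y => by
      have h1 : (1:ℝ) ≤ 1 + ‖y‖ ^ 2 := by nlinarith [norm_nonneg y]
      rw [← Real.rpow_neg (by positivity)]
      nth_rw 2 [← Real.rpow_one (1 + ‖y‖ ^ 2)]
      exact Real.rpow_le_rpow_of_exponent_le h1 (by linarith)) hI hf
  have hN : Tendsto (fun x : E3 => ‖x‖) (comap (fun x : E3 => ‖x‖) atTop) atTop := tendsto_comap
  have T1 : Tendsto (fun x : E3 => ∫ y in Metric.closedBall x (‖x‖ / 2), V y * φ y * ‖y - x‖⁻¹ * ‖x‖)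
      (comap (fun x : E3 => ‖x‖) atTop) (𝓝 0) := by
    refine squeeze_zero_norm' (a := fun x : E3 => (C ^ 2 * (4:ℝ) ^ ((β + 1) / 2) * (∫ y, (1 + ‖y‖ ^ 2) ^ ((3 - β) / 2 - 1) * φ y ^ 2) + om) * ‖x‖ ^ (-((β - 2) / 2))) ?_ ?_
    · filter_upwards [hN.eventually_gt_atTop 0] with x hx
      exact near_part hV hφc hC hβ hb hI hf hx
    · have := ((tendsto_rpow_neg_atTop (y := (β - 2) / 2) (by linarith)).comp hN).const_mul (C ^ 2 * (4:ℝ) ^ ((β + 1) / 2) * (∫ y, (1 + ‖y‖ ^ 2) ^ ((3 - β) / 2 - 1) * φ y ^ 2) + om)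
      rw [mul_zero] at this
      exact this
  have T2 : Tendsto (fun x : E3 => ∫ y, (Metric.closedBall x (‖x‖ / 2))ᶜ.indicator (fun y => V y * φ y * ‖y - x‖⁻¹ * ‖x‖) y)
      (comap (fun x : E3 => ‖x‖) atTop) (𝓝 (∫ y, V y * φ y)) := by
    refine tendsto_integral_filter_of_dominated_convergence (fun y => 2 * ‖V y * φ y‖) ?_ ?_ (hf.norm.const_mul 2) ?_
    · refine Eventually.of_forall fun x => ?_
      have hmi : Measurable (fun y : E3 => ‖y - x‖⁻¹) := by fun_prop
      exact (((hfc.measurable.mul hmi).mul_const _).indicator Metric.isClosed_closedBall.measurableSet.compl).aestronglyMeasurable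
    · filter_upwards [hN.eventually_gt_atTop 0] with x hx
      refine Eventually.of_forall fun y => ?_
      by_cases hy : y ∈ Metric.closedBall x (‖x‖ / 2)
      · rw [Set.indicator_of_notMem (by simpa using hy), norm_zero]; positivity
      · rw [Set.indicator_of_mem hy]
        have hyx : ‖x‖ / 2 < ‖y - x‖ := by simpa [dist_eq_norm] using hy
        have hp : 0 < ‖y - x‖ := by linarith
        rw [mul_assoc, norm_mul, mul_comm 2]
        refine mul_le_mul_of_nonneg_left ?_ (norm_nonneg _)
        rw [Real.norm_of_nonneg (by positivity), inv_mul_le_iff₀ hp]; linarith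
    · refine Eventually.of_forall fun y => ?_
      have h1 : Tendsto (fun x : E3 => V y * φ y * (‖y - x‖⁻¹ * ‖x‖)) (comap (fun x : E3 => ‖x‖) atTop) (𝓝 (V y * φ y * 1)) := by
        refine Tendsto.const_mul _ ?_
        have h2 : Tendsto (fun x : E3 => ‖y‖ / (‖x‖ - ‖y‖)) (comap (fun x : E3 => ‖x‖) atTop) (𝓝 0) :=
          tendsto_const_nhds.div_atTop (tendsto_atTop_add_const_right _ _ hN)
        rw [tendsto_iff_norm_sub_tendsto_zero]
        refine squeeze_zero' (Eventually.of_forall fun x => norm_nonneg _) ?_ h2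
        filter_upwards [hN.eventually_gt_atTop ‖y‖] with x hx
        have h3 : ‖x‖ - ‖y‖ ≤ ‖y - x‖ := by rw [norm_sub_rev]; exact norm_sub_norm_le x y
        have h3' : ‖y - x‖ ≤ ‖x‖ + ‖y‖ := by rw [norm_sub_rev]; exact norm_sub_le x y
        have hp : 0 < ‖y - x‖ := by linarith
        have e1 : ‖y - x‖⁻¹ * ‖x‖ - 1 = (‖x‖ - ‖y - x‖) / ‖y - x‖ := by field_simp
        rw [e1, norm_div, norm_norm, Real.norm_eq_abs]
        refine div_le_div₀ (norm_nonneg _) ?_ (by linarith) h3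
        rw [abs_le]; constructor <;> linarith
      rw [mul_one] at h1
      refine h1.congr' ?_
      filter_upwards [hN.eventually_gt_atTop (2 * ‖y‖)] with x hx
      rw [Set.indicator_of_mem, mul_assoc (V y * φ y)]
      have h3 : ‖x‖ - ‖y‖ ≤ ‖y - x‖ := by rw [norm_sub_rev]; exact norm_sub_norm_le x y
      refine fun hh => ?_
      have h4 : ‖y - x‖ ≤ ‖x‖ / 2 := by simpa [dist_eq_norm] using hh
      linarith
  have T3 := (T1.add T2).const_mul (-(Ac⁻¹))
  refine ⟨_, T3.congr fun x => ?_⟩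
  have hmS : MeasurableSet (Metric.closedBall x (‖x‖ / 2)) := Metric.isClosed_closedBall.measurableSet
  rw [integral_indicator hmS.compl, integral_add_compl hmS ((rep_int hf hfc x).mul_const _), integral_mul_const, hrep x]
  have := Ac_pos
  field_simp

lemma barrier {C μ : ℝ} (hC : 0 < C) (hμ : 0 < μ) (hμ2 : μ ≤ 1 / 4) :
    ∃ H H1 H2 : ℝ → ℝ, (∀ s, 0 ≤ s → HasDerivAt H (H1 s) s) ∧ (∀ s, 0 ≤ s → HasDerivAt H1 (H2 s) s) ∧
      ContinuousOn H2 (Set.Ici 0) ∧ (∀ s, 0 ≤ s → 0 < H s ∧ H s ≤ 1) ∧ (∀ s, 0 ≤ s → 0 ≤ s * H1 s ∧ s * H1 s ≤ C + 1) ∧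
      ∀ s, 0 ≤ s → C * (1 + s) ^ (-(μ + 1)) * H s < 6 * H1 s + 4 * s * H2 s := by
  set k := C + 1 with hk
  have hk0 : 0 < k := by linarith
  let H : ℝ → ℝ := fun s => Real.exp (-(k / μ) * (1 + s) ^ (-μ))
  let H1 : ℝ → ℝ := fun s => H s * (k * (1 + s) ^ (-μ - 1))
  let H2 : ℝ → ℝ := fun s => H s * ((k * (1 + s) ^ (-μ - 1)) ^ 2 + k * ((-μ - 1) * (1 + s) ^ (-μ - 1 - 1)))
  have hq : ∀ a s : ℝ, 0 ≤ s → HasDerivAt (fun s : ℝ => (1 + s) ^ a) (a * (1 + s) ^ (a - 1)) s := by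
    intro a s hs
    have h1 : HasDerivAt (fun s : ℝ => 1 + s) 1 s := (hasDerivAt_id s).const_add 1
    exact (h1.rpow_const (p := a) (Or.inl (by positivity))).congr_deriv (by ring)
  have d1 : ∀ s, 0 ≤ s → HasDerivAt H (H1 s) s := by
    intro s hs
    refine ((hq (-μ) s hs).const_mul (-(k / μ))).exp.congr_deriv ?_
    simp only [H1, H]
    field_simp
  have d2 : ∀ s, 0 ≤ s → HasDerivAt H1 (H2 s) s := by
    intro s hs
    refine ((d1 s hs).mul ((hq (-μ - 1) s hs).const_mul k)).congr_deriv ?_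
    simp only [H1, H2]
    ring
  have hcH : ContinuousOn H (Set.Ici 0) := fun s hs => (d1 s hs).continuousAt.continuousWithinAt
  have hcq : ∀ a : ℝ, ContinuousOn (fun s : ℝ => (1 + s) ^ a) (Set.Ici 0) := fun a s hs =>
    (hq a s hs).continuousAt.continuousWithinAt
  have hpos : ∀ s, 0 < H s := fun s => Real.exp_pos _
  refine ⟨H, H1, H2, d1, d2, ?_, ?_, ?_, ?_⟩
  · exact hcH.mul ((((hcq (-μ - 1)).const_mul k).pow 2).add (((hcq (-μ - 1 - 1)).const_mul (-μ - 1)).const_mul k))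
  · intro s hs
    refine ⟨hpos s, ?_⟩
    rw [Real.exp_le_one_iff]
    have : 0 ≤ k / μ * (1 + s) ^ (-μ) := by positivity
    linarith
  · intro s hs
    have hH1 : H s ≤ 1 := by
      rw [Real.exp_le_one_iff]
      have : 0 ≤ k / μ * (1 + s) ^ (-μ) := by positivity
      linarith
    have h1 : (1 + s) ^ (-μ - 1) ≤ (1 + s) ^ (-1 : ℝ) :=
      Real.rpow_le_rpow_of_exponent_le (by linarith) (by linarith)
    rw [Real.rpow_neg_one] at h1
    have h2 : s * (1 + s) ^ (-μ - 1) ≤ 1 := by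
      calc s * (1 + s) ^ (-μ - 1) ≤ s * (1 + s)⁻¹ := by gcongr
        _ ≤ 1 := by rw [← div_eq_mul_inv, div_le_one (by positivity)]; linarith
    have h3 : 0 ≤ s * (1 + s) ^ (-μ - 1) := by positivity
    have e : s * H1 s = H s * (k * (s * (1 + s) ^ (-μ - 1))) := by simp only [H1]; ring
    have := hpos s
    rw [e]
    refine ⟨by positivity, ?_⟩
    calc _ ≤ 1 * (k * 1) := by gcongr
      _ = k := by ring
  · intro s hs
    have hp : 0 < 1 + s := by positivity
    have e1 : (1 + s) ^ (-μ - 1) = (1 + s) * (1 + s) ^ (-μ - 1 - 1) := by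
      nth_rw 2 [← Real.rpow_one (1 + s)]
      rw [← Real.rpow_add hp]; congr 1; ring
    have e2 : (-(μ + 1)) = -μ - 1 := by ring
    rw [e2]
    simp only [H1, H2]
    have hH := hpos s
    have hz : 0 < (1 + s) ^ (-μ - 1 - 1) := by positivity
    rw [e1]
    generalize (1 + s) ^ (-μ - 1 - 1) = z at *
    have key : C * ((1 + s) * z) < 6 * (k * ((1 + s) * z)) + 4 * s * (k * ((-μ - 1) * z)) := by
      have : 0 < z * (5 * k * (1 + s) + 1 * (1 + s) - 4 * s * k * (μ + 1)) := by
        refine mul_pos hz ?_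
        have h5 : s * k * (μ + 1) ≤ s * k * (5 / 4) := by
          refine mul_le_mul_of_nonneg_left (by linarith) (by positivity)
        nlinarith
      rw [hk] at this ⊢
      nlinarith
    have h0 : 0 ≤ 4 * s * (k * ((1 + s) * z)) ^ 2 := by positivity
    have : C * ((1 + s) * z) * H s < (6 * (k * ((1 + s) * z)) + 4 * s * (k * ((-μ - 1) * z)) + 4 * s * (k * ((1 + s) * z)) ^ 2) * H s := by
      refine mul_lt_mul_of_pos_right (by linarith) hH
    linarith

set_option maxHeartbeats 1000000 in
lemma c_pos {V φ : E3 → ℝ} (hV : Continuous V) (hφ : ContDiff ℝ 1 φ) (hφ0 : ∀ x, 0 < φ x) (hw : WeakSol V φ)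
    {C β : ℝ} (hC : 0 < C) (hβ : 2 < β) (hβ2 : β ≤ 5 / 2)
    (hb : ∀ x : E3, |V x| ≤ C * (1 + ‖x‖ ^ 2) ^ (-β / 2)) {c : ℝ}
    (hc : Tendsto (fun x => ‖x‖ * φ x) (comap (fun x : E3 => ‖x‖) atTop) (𝓝 c)) : 0 < c := by
  have hφc := hφ.continuous
  have hN : Tendsto (fun x : E3 => ‖x‖) (comap (fun x : E3 => ‖x‖) atTop) atTop := tendsto_comap
  have : (comap (fun x : E3 => ‖x‖) atTop).NeBot := by
    rw [comap_norm_atTop]; infer_instance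
  have hc0 : 0 ≤ c := ge_of_tendsto hc (Eventually.of_forall fun x => mul_nonneg (norm_nonneg _) (hφ0 x).le)
  rcases hc0.lt_or_eq with h | h
  · exact h
  exfalso
  subst h
  obtain ⟨ξ, ξ1, ξ2, B, hB, hd1, hd2, hc2, hl, hr, h01, hneg, hbd⟩ := cutoff
  have hcξ : Continuous ξ := continuous_iff_continuousAt.2 fun t => (hd1 t).continuousAt
  have hcξ1 : Continuous ξ1 := continuous_iff_continuousAt.2 fun t => (hd2 t).continuousAt
  have hanti : Antitone ξ := antitone_of_deriv_nonpos (fun t => (hd1 t).differentiableAt) fun t => by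
    rw [(hd1 t).deriv]; exact hneg t
  obtain ⟨H, H1, H2, e1, e2, hcH2, hH, hsH, hT⟩ := barrier hC (μ := (β - 2) / 2) (by linarith) (by linarith)
  have hcH : ContinuousOn H (Set.Ici 0) := fun s hs => (e1 s hs).continuousAt.continuousWithinAt
  have hcH1 : ContinuousOn H1 (Set.Ici 0) := fun s hs => (e2 s hs).continuousAt.continuousWithinAt
  have co : ∀ F : ℝ → ℝ, ContinuousOn F (Set.Ici 0) → Continuous (fun y : E3 => F (‖y - 0‖ ^ 2)) := fun F hF =>
    hF.comp_continuous (f := fun y : E3 => ‖y - 0‖ ^ 2) (by fun_prop) fun y => by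
      simp only [Set.mem_Ici]; positivity
  have cH := co H hcH
  have cH1 := co H1 hcH1
  have cH2 := co H2 hcH2
  let T : E3 → ℝ := fun y => 6 * H1 (‖y - 0‖ ^ 2) + 4 * ‖y - 0‖ ^ 2 * H2 (‖y - 0‖ ^ 2) - V y * H (‖y - 0‖ ^ 2)
  have cN : Continuous (fun y : E3 => ‖y - 0‖ ^ 2) := by fun_prop
  have hTc : Continuous T := ((cH1.const_mul 6).add ((cN.const_mul 4).mul cH2)).sub (hV.mul cH)
  have hTp : ∀ y, 0 < T y := by
    intro y
    have h1 := hT (‖y - 0‖ ^ 2) (by positivity)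
    have h2 := hb y
    have h3 := (hH (‖y - 0‖ ^ 2) (by positivity)).1
    have h4 : V y * H (‖y - 0‖ ^ 2) ≤ C * (1 + ‖y - 0‖ ^ 2) ^ (-((β - 2) / 2 + 1)) * H (‖y - 0‖ ^ 2) := by
      refine mul_le_mul_of_nonneg_right ((le_abs_self _).trans (h2.trans (le_of_eq ?_))) h3.le
      rw [sub_zero]; congr 2; ring
    simp only [T]; linarith
  have hzero : ∀ n : ℝ, 0 < n → ∀ y : E3, 2 * n ^ 2 ≤ ‖y - 0‖ ^ 2 → 2 ≤ ‖y - 0‖ ^ 2 / n ^ 2 := by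
    intro n hn y hy
    rw [le_div_iff₀ (by positivity)]; exact hy
  have iP : ∀ n : ℝ, 0 < n → Integrable (fun y => φ y * ξ (‖y - 0‖ ^ 2 / n ^ 2) * T y) := by
    intro n hn
    refine Continuous.integrable_of_hasCompactSupport (by fun_prop) (cs_ball (p := 0) (S := 2 * n ^ 2) fun y hy => ?_)
    rw [(hr _ (hzero n hn y hy)).1]; simp
  have hP1 : 0 < ∫ y, φ y * ξ (‖y - 0‖ ^ 2 / 1 ^ 2) * T y := by
    refine Continuous.integral_pos_of_hasCompactSupport_nonneg_nonzero (x := 0) (by fun_prop) (cs_ball (p := 0) (S := 2 * 1 ^ 2) fun y hy => ?_) ?_ ?_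
    · rw [(hr _ (hzero 1 one_pos y hy)).1]; simp
    · exact fun y => mul_nonneg (mul_nonneg (hφ0 y).le (h01 _).1) (hTp y).le
    · rw [(hl _ (by simp)).1]
      have := mul_pos (hφ0 0) (hTp 0)
      rw [mul_one]; exact this.ne'
  set a := ∫ y, φ y * ξ (‖y - 0‖ ^ 2 / 1 ^ 2) * T y with ha
  clear_value a
  set D := B * (14 + 8 * (C + 1)) with hD
  have hD0 : 0 < D := by positivity
  have hom := om_pos
  -- choose n
  obtain ⟨δ, hδ, hδa⟩ : ∃ δ > 0, D * δ * 4 * (om * 2) < a :=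
    ⟨a / (D * 4 * (om * 2)) / 2, by positivity, by
      have : D * (a / (D * 4 * (om * 2)) / 2) * 4 * (om * 2) = a / 2 := by field_simp
      rw [this]; linarith⟩
  obtain ⟨n, hn1, hn⟩ : ∃ n : ℝ, 1 ≤ n ∧ ∀ y : E3, n ≤ ‖y‖ → ‖y‖ * φ y ≤ δ := by
    have h1 := hc.eventually_le_const hδ
    rw [eventually_comap] at h1
    obtain ⟨n, hn⟩ := (h1.and (eventually_ge_atTop 1)).exists_forall_of_atTop
    exact ⟨max n 1, le_max_right _ _, fun y hy => (hn _ ((le_max_left _ _).trans hy)).1 y rfl⟩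
  have hn0 : 0 < n := by linarith
  let G : ℝ → ℝ := fun s => H s * ξ (s / n ^ 2)
  let G1 : ℝ → ℝ := fun s => H1 s * ξ (s / n ^ 2) + H s * (ξ1 (s / n ^ 2) / n ^ 2)
  let G2 : ℝ → ℝ := fun s => H2 s * ξ (s / n ^ 2) + 2 * H1 s * (ξ1 (s / n ^ 2) / n ^ 2) + H s * (ξ2 (s / n ^ 2) / n ^ 2 / n ^ 2)
  have a1 : ∀ s, HasDerivAt (fun s => ξ (s / n ^ 2)) (ξ1 (s / n ^ 2) / n ^ 2) s := by
    intro s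
    have := (hd1 (s / n ^ 2)).comp s ((hasDerivAt_id s).div_const (n ^ 2))
    exact this.congr_deriv (by ring)
  have a2 : ∀ s, HasDerivAt (fun s => ξ1 (s / n ^ 2)) (ξ2 (s / n ^ 2) / n ^ 2) s := by
    intro s
    have := (hd2 (s / n ^ 2)).comp s ((hasDerivAt_id s).div_const (n ^ 2))
    exact this.congr_deriv (by ring)
  have hS : ∀ s, 2 * n ^ 2 ≤ s → 2 ≤ s / n ^ 2 := fun s hs => by
    rw [le_div_iff₀ (by positivity)]; exact hs
  have hR := radial_test hφ hw 0 (G := G) (G1 := G1) (G2 := G2) (S := 2 * n ^ 2)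
    (fun s hs => ((e1 s hs).mul (a1 s)).congr_deriv (by simp only [G1]))
    (fun s hs => (((e2 s hs).mul (a1 s)).add ((e1 s hs).mul ((a2 s).div_const (n ^ 2)))).congr_deriv (by simp only [G2]; ring))
    (by
      have x0 : ContinuousOn (fun s : ℝ => ξ (s / n ^ 2)) (Set.Ici 0) := by fun_prop
      have x1 : ContinuousOn (fun s : ℝ => ξ1 (s / n ^ 2)) (Set.Ici 0) := by fun_prop
      have x2 : ContinuousOn (fun s : ℝ => ξ2 (s / n ^ 2)) (Set.Ici 0) := by fun_prop
      simp only [G2]; fun_prop)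
    (fun s hs => by
      obtain ⟨z0, z1, z2⟩ := hr _ (hS s hs)
      simp only [G, G1, z0, z1]; simp)
  let E : ℝ → ℝ := fun s => 6 * (H s * (ξ1 (s / n ^ 2) / n ^ 2)) + 8 * ((s * H1 s) * (ξ1 (s / n ^ 2) / n ^ 2)) + 4 * (H s * (s * (ξ2 (s / n ^ 2) / n ^ 2 / n ^ 2)))
  have cE : Continuous (fun y : E3 => E (‖y - 0‖ ^ 2)) := by
    have y1 : Continuous (fun y : E3 => ξ1 (‖y - 0‖ ^ 2 / n ^ 2) / n ^ 2) := by fun_prop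
    have y2 : Continuous (fun y : E3 => ξ2 (‖y - 0‖ ^ 2 / n ^ 2) / n ^ 2 / n ^ 2) := by fun_prop
    exact (((cH.mul y1).const_mul 6).add (((cN.mul cH1).mul y1).const_mul 8)).add ((cH.mul (cN.mul y2)).const_mul 4)
  have iE : Integrable (fun y => φ y * E (‖y - 0‖ ^ 2)) := by
    refine Continuous.integrable_of_hasCompactSupport (hφc.mul cE) (cs_ball (p := 0) (S := 2 * n ^ 2) fun y hy => ?_)
    obtain ⟨z0, z1, z2⟩ := hr _ (hzero n hn0 y hy)
    simp only [E, z1, z2]; simp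
  have iG : Integrable (fun y => V y * φ y * G (‖y - 0‖ ^ 2)) := by
    refine Continuous.integrable_of_hasCompactSupport ?_ (cs_ball (p := 0) (S := 2 * n ^ 2) fun y hy => ?_)
    · have y0 : Continuous (fun y : E3 => ξ (‖y - 0‖ ^ 2 / n ^ 2)) := by fun_prop
      exact (hV.mul hφc).mul (cH.mul y0)
    · obtain ⟨z0, z1, z2⟩ := hr _ (hzero n hn0 y hy)
      simp only [G, z0]; simp
  have hmain : ∫ y, φ y * ξ (‖y - 0‖ ^ 2 / n ^ 2) * T y = - ∫ y, φ y * E (‖y - 0‖ ^ 2) := by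
    have h1 : ∫ y, φ y * (6 * G1 (‖y - 0‖ ^ 2) + 4 * ‖y - 0‖ ^ 2 * G2 (‖y - 0‖ ^ 2)) =
        ((∫ y, φ y * ξ (‖y - 0‖ ^ 2 / n ^ 2) * T y) + ∫ y, φ y * E (‖y - 0‖ ^ 2)) + ∫ y, V y * φ y * G (‖y - 0‖ ^ 2) := by
      rw [← integral_add (iP n hn0) iE, ← integral_add (by exact (iP n hn0).add iE) iG]
      refine integral_congr_ae (Eventually.of_forall fun y => ?_)
      simp only [G, G1, G2, T, E]; ring
    linarith
  have hlow : a ≤ ∫ y, φ y * ξ (‖y - 0‖ ^ 2 / n ^ 2) * T y := by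
    rw [ha]
    refine integral_mono (iP 1 one_pos) (iP n hn0) fun y => ?_
    simp only
    refine mul_le_mul_of_nonneg_right (mul_le_mul_of_nonneg_left (hanti ?_) (hφ0 y).le) (hTp y).le
    gcongr
  have hup := (near_int (g := fun y => φ y * E (‖y - 0‖ ^ 2)) (p := 0) (R := 2 * n) (C := D * δ * 4 / n)
    (hφc.mul cE).aestronglyMeasurable (by positivity)
    (by
      intro y hy hne
      have hp : 0 < ‖y - 0‖ := norm_pos_iff.2 (sub_ne_zero.2 hne)
      by_cases hyn : ‖y - 0‖ < n
      · have : ‖y - 0‖ ^ 2 / n ^ 2 ≤ 1 := by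
          rw [div_le_one (by positivity)]; exact pow_le_pow_left₀ hp.le hyn.le 2
        obtain ⟨z0, z1, z2⟩ := hl _ this
        simp only [E, z1, z2]; simp; positivity
      · push Not at hyn
        have hφn : φ y ≤ δ / n := by
          have h5 := hn y (by simpa using hyn)
          rw [le_div_iff₀ hn0]
          have h6 : n ≤ ‖y‖ := by simpa using hyn
          have h7 := hφ0 y
          nlinarith
        have hEb : |E (‖y - 0‖ ^ 2)| ≤ D / n ^ 2 := by
          have hs2 : ‖y - 0‖ ^ 2 ≤ 4 * n ^ 2 := by nlinarith
          by_cases hs : 2 * n ^ 2 ≤ ‖y - 0‖ ^ 2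
          · obtain ⟨z0, z1, z2⟩ := hr _ (hS _ hs)
            simp only [E, z1, z2]; simp; positivity
          push Not at hs
          have hs0 : 0 ≤ ‖y - 0‖ ^ 2 := by positivity
          generalize ‖y - 0‖ ^ 2 = s at *
          obtain ⟨b1, b2⟩ := hbd (s / n ^ 2)
          obtain ⟨p1, p2⟩ := hH s hs0
          obtain ⟨p3, p4⟩ := hsH s hs0
          have n2 : 0 < n ^ 2 := by positivity
          have x1 : |H s * (ξ1 (s / n ^ 2) / n ^ 2)| ≤ 1 * (B / n ^ 2) := by
            rw [abs_mul, abs_div, abs_of_pos p1, abs_of_pos n2]; gcongr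
          have x2 : |(s * H1 s) * (ξ1 (s / n ^ 2) / n ^ 2)| ≤ (C + 1) * (B / n ^ 2) := by
            rw [abs_mul, abs_div, abs_of_nonneg p3, abs_of_pos n2]; gcongr
          have x3 : |H s * (s * (ξ2 (s / n ^ 2) / n ^ 2 / n ^ 2))| ≤ 1 * (2 * n ^ 2 * (B / n ^ 2 / n ^ 2)) := by
            rw [abs_mul, abs_mul, abs_div, abs_div, abs_of_pos p1, abs_of_pos n2, abs_of_nonneg hs0]; gcongr
          have x4 : 1 * (2 * n ^ 2 * (B / n ^ 2 / n ^ 2)) = 2 * (B / n ^ 2) := by field_simp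
          rw [x4] at x3
          have x5 : D / n ^ 2 = 6 * (1 * (B / n ^ 2)) + 8 * ((C + 1) * (B / n ^ 2)) + 4 * (2 * (B / n ^ 2)) := by
            rw [hD]; ring
          rw [x5]
          simp only [E]
          have := abs_le.1 x1
          have := abs_le.1 x2
          have := abs_le.1 x3
          rw [abs_le]; constructor <;> linarith
        rw [abs_mul, abs_of_pos (hφ0 y)]
        calc φ y * |E (‖y - 0‖ ^ 2)| ≤ δ / n * (D / n ^ 2) := by gcongr
          _ = D * δ * 4 / n * (4 * n ^ 2)⁻¹ := by field_simp
          _ ≤ D * δ * 4 / n * (‖y - 0‖ ^ 2)⁻¹ := by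
            refine mul_le_mul_of_nonneg_left (inv_anti₀ (by positivity) ?_) (by positivity)
            nlinarith)
    (by
      intro y hy
      obtain ⟨z0, z1, z2⟩ := hr _ (hS (‖y - 0‖ ^ 2) (by nlinarith))
      simp only [E, z1, z2]; simp)).2.1
  have h9 : D * δ * 4 / n * (om * (2 * n)) = D * δ * 4 * (om * 2) := by field_simp
  rw [h9] at hup
  have := abs_le.1 hup
  linarith

lemma ground_asymp {V : E3 → ℝ} (hV : Continuous V) {C β : ℝ} (hC : 0 < C) (hβ : 2 < β)
    (hb : ∀ x : E3, |V x| ≤ C * (1 + ‖x‖ ^ 2) ^ (-β / 2)) (hcr : Crit V) :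
    ∃ φ : E3 → ℝ, ContDiff ℝ 1 φ ∧ (∀ x, 0 < φ x) ∧ WeakSol V φ ∧
      Tendsto (fun x => ‖x‖ * φ x) (comap (fun x : E3 => ‖x‖) atTop) (𝓝 1) := by
  obtain ⟨hpos, φ, hg⟩ := hcr
  have hβ1 : 2 < min β (5 / 2) := lt_min hβ (by norm_num)
  have hβ2 : min β (5 / 2) ≤ 5 / 2 := min_le_right _ _
  have hb' : ∀ x : E3, |V x| ≤ C * (1 + ‖x‖ ^ 2) ^ (-(min β (5 / 2)) / 2) := by
    intro x
    refine (hb x).trans (mul_le_mul_of_nonneg_left (Real.rpow_le_rpow_of_exponent_le ?_ ?_) hC.le)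
    · nlinarith [norm_nonneg x]
    · have := min_le_left β (5 / 2); linarith
  generalize min β (5 / 2) = β' at *
  have hI := weighted_int hV hpos hβ1 hC (a := (3 - β') / 2) (by linarith) (by linarith) hb' hg
  have hw := weak_eq hV hpos hg
  obtain ⟨h1, h2, -⟩ := hg
  obtain ⟨c, hc⟩ := decay hV h1 h2 hw hC hβ1 hβ2 hb' hI
  have hc0 := c_pos hV h1 h2 hw hC hβ1 hβ2 hb' hc
  refine ⟨fun x => c⁻¹ * φ x, contDiff_const.mul h1, fun x => mul_pos (inv_pos.2 hc0) (h2 x), ?_, ?_⟩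
  · intro v hv
    have hgr : ∀ x, gradient (fun x => c⁻¹ * φ x) x = c⁻¹ • gradient φ x := by
      intro x
      have h3 := hg_mul (f := fun _ : E3 => c⁻¹) (g := φ) (x := x) (hasGradientAt_const x _) (C1.hg h1 x)
      rw [smul_zero, add_zero] at h3
      exact h3.gradient
    simp only [hgr, real_inner_smul_left]
    rw [integral_const_mul, hw v hv, mul_neg, ← integral_const_mul]
    congr 1
    refine integral_congr_ae (Eventually.of_forall fun x => ?_)
    simp only; ring
  · have := hc.const_mul c⁻¹
    rw [inv_mul_cancel₀ hc0.ne'] at this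
    refine this.congr fun x => ?_
    ring

lemma hg_aff {f : E3 → ℝ} {a : ℝ} {q g x : E3} (h : HasGradientAt f g (a • x + q)) :
    HasGradientAt (fun x => f (a • x + q)) (a • g) x := by
  rw [hasGradientAt_iff_hasFDerivAt] at h ⊢
  have h1 : HasFDerivAt (fun x : E3 => a • x + q) (a • ContinuousLinearMap.id ℝ E3) x :=
    ((hasFDerivAt_id x).const_smul a).add_const q
  refine HasFDerivAt.congr_fderiv (h.comp x h1) ?_
  ext v
  simp

lemma C1c.aff {f : E3 → ℝ} (h : C1c f) {a : ℝ} (ha : a ≠ 0) (q : E3) : C1c (fun x => f (a • x + q)) := by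
  refine ⟨h.1.comp (by fun_prop), ?_⟩
  have := h.2.comp_homeomorph ((Homeomorph.smulOfNeZero a ha).trans (Homeomorph.addRight q))
  exact this

lemma int_aff (F : E3 → ℝ) {a : ℝ} (ha : 0 < a) (q : E3) :
    ∫ x, F (a • x + q) = (a ^ 3)⁻¹ * ∫ x, F x := by
  have := Measure.integral_comp_smul (volume : Measure E3) (fun y : E3 => F (y + q)) a
  have h3 : Module.finrank ℝ E3 = 3 := by simp
  rw [h3, abs_of_pos (by positivity), smul_eq_mul, integral_add_right_eq_self (fun y => F y) q] at this
  exact this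

lemma weak_scale {V φ : E3 → ℝ} (hφ : ContDiff ℝ 1 φ) (hw : WeakSol V φ) {l : ℝ} (hl : 0 < l) (q : E3) :
    WeakSol (fun y => l ^ 2 * V (l • y + q)) (fun y => l * φ (l • y + q)) := by
  intro v hv
  have hu : C1c (fun x => v (l⁻¹ • x + -(l⁻¹ • q))) := hv.aff (inv_ne_zero hl.ne') _
  have e0 : ∀ y : E3, l⁻¹ • (l • y + q) + -(l⁻¹ • q) = y := by
    intro y; rw [smul_add, smul_smul, inv_mul_cancel₀ hl.ne', one_smul]; abel
  have g1 : ∀ y, gradient (fun y => l * φ (l • y + q)) y = l • l • gradient φ (l • y + q) := by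
    intro y
    have h3 := hg_mul (f := fun _ : E3 => l) (x := y) (hasGradientAt_const y _) (hg_aff (C1.hg hφ (l • y + q)))
    rw [smul_zero, add_zero] at h3
    exact h3.gradient
  have g2 : ∀ y, gradient v y = l • gradient (fun x => v (l⁻¹ • x + -(l⁻¹ • q))) (l • y + q) := by
    intro y
    have h3 := hg_aff (f := v) (a := l⁻¹) (q := -(l⁻¹ • q)) (x := l • y + q) (by rw [e0]; exact C1.hg hv.1 y)
    rw [h3.gradient, smul_smul, mul_inv_cancel₀ hl.ne', one_smul]
  have h1 := int_aff (fun x => inner ℝ (gradient φ x) (gradient (fun x => v (l⁻¹ • x + -(l⁻¹ • q))) x)) hl q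
  have h2 := int_aff (fun x => V x * φ x * v (l⁻¹ • x + -(l⁻¹ • q))) hl q
  have h3 := hw _ hu
  simp only [e0] at h2
  calc _ = l ^ 3 * ∫ y, inner ℝ (gradient φ (l • y + q)) (gradient (fun x => v (l⁻¹ • x + -(l⁻¹ • q))) (l • y + q)) := by
        rw [← integral_const_mul]
        refine integral_congr_ae (Eventually.of_forall fun y => ?_)
        simp only [g1, g2, real_inner_smul_left, real_inner_smul_right]; ring
    _ = -(l ^ 3 * ∫ y, V (l • y + q) * φ (l • y + q) * v y) := by
        rw [h1, h2, h3]; ring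
    _ = _ := by
        rw [← integral_const_mul]
        congr 1
        refine integral_congr_ae (Eventually.of_forall fun y => ?_)
        simp only; ring

lemma Q_scale {V u : E3 → ℝ} (hu : C1c u) {l : ℝ} (hl : 0 < l) :
    Qf (fun y => l ^ 2 * V (l • y)) (fun y => u (l • y)) = l⁻¹ * Qf V u ∧
    ∫ y : E3, u (l • y) ^ 2 = (l ^ 3)⁻¹ * ∫ y, u y ^ 2 := by
  have g1 : ∀ y, gradient (fun y => u (l • y)) y = l • gradient u (l • y) := by
    intro y
    have := hg_aff (f := u) (a := l) (q := 0) (x := y) (C1.hg hu.1 _)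
    simp only [add_zero] at this
    exact this.gradient
  have h1 := int_aff (fun x => ‖gradient u x‖ ^ 2 + V x * u x ^ 2) hl 0
  have h2 := int_aff (fun x => u x ^ 2) hl 0
  simp only [add_zero] at h1 h2
  refine ⟨?_, h2⟩
  unfold Qf
  calc _ = l ^ 2 * ∫ y, (‖gradient u (l • y)‖ ^ 2 + V (l • y) * u (l • y) ^ 2) := by
        rw [← integral_const_mul]
        refine integral_congr_ae (Eventually.of_forall fun y => ?_)
        simp only [g1, norm_smul, Real.norm_of_nonneg hl.le]; ring
    _ = _ := by rw [h1]; field_simp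

/-- a rescaled critical potential with its ground state -/
structure Site (p : E3) (W A : E3 → ℝ) (τ η M : ℝ) : Prop where
  cW : Continuous W
  cA : ContDiff ℝ 1 A
  pos : ∀ y, 0 < A y
  weak : WeakSol W A
  farW : ∀ y, η ≤ ‖y - p‖ → |W y| ≤ τ
  farA : ∀ y, η ≤ ‖y - p‖ → |‖y - p‖ * A y - 1| ≤ τ
  bd : ∀ y, ‖y - p‖ * A y ≤ M

lemma site_exists {V : E3 → ℝ} (hV : Continuous V) {C β : ℝ} (hC : 0 < C) (hβ : 2 < β)
    (hb : ∀ x : E3, |V x| ≤ C * (1 + ‖x‖ ^ 2) ^ (-β / 2)) (hcr : Crit V) :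
    ∃ M : ℝ, 0 < M ∧ ∀ τ η : ℝ, 0 < τ → 0 < η → ∃ L : ℝ, 0 < L ∧ ∀ l, L ≤ l → ∀ p : E3,
      ∃ A, Site p (fun y => l ^ 2 * V (l • (y - p))) A τ η M := by
  obtain ⟨φ, h1, h2, hw, hlim⟩ := ground_asymp hV hC hβ hb hcr
  have far : ∀ τ : ℝ, 0 < τ → ∃ n : ℝ, 1 ≤ n ∧ ∀ y : E3, n ≤ ‖y‖ → |‖y‖ * φ y - 1| ≤ τ := by
    intro τ hτ
    have h3 : ∀ᶠ x in comap (fun x : E3 => ‖x‖) atTop, |‖x‖ * φ x - 1| ≤ τ := by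
      filter_upwards [hlim.eventually (Metric.closedBall_mem_nhds 1 hτ)] with x hx
      simpa [Real.dist_eq] using hx
    rw [eventually_comap] at h3
    obtain ⟨n, hn⟩ := (h3.and (eventually_ge_atTop 1)).exists_forall_of_atTop
    exact ⟨max n 1, le_max_right _ _, fun y hy => (hn _ ((le_max_left _ _).trans hy)).1 y rfl⟩
  obtain ⟨n1, hn1, hf1⟩ := far 1 one_pos
  obtain ⟨M0, hM0⟩ := (isCompact_closedBall (0:E3) n1).exists_bound_of_continuousOn (f := fun y => ‖y‖ * φ y)
    (by have := h1.continuous; fun_prop)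
  refine ⟨max M0 2, lt_max_of_lt_right two_pos, fun τ η hτ hη => ?_⟩
  have hM : ∀ y, ‖y‖ * φ y ≤ max M0 2 := by
    intro y
    by_cases hy : y ∈ Metric.closedBall (0:E3) n1
    · exact (le_abs_self _).trans ((hM0 y hy).trans (le_max_left _ _))
    · have : n1 < ‖y‖ := by simpa using hy
      have := (abs_le.1 (hf1 y this.le)).2
      exact le_trans (by linarith) (le_max_right _ _)
  obtain ⟨n, hn, hf⟩ := far τ hτ
  have ht : Tendsto (fun l : ℝ => C * η ^ (-β) * l ^ (-(β - 2))) atTop (𝓝 0) := by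
    have := (tendsto_rpow_neg_atTop (y := β - 2) (by linarith)).const_mul (C * η ^ (-β))
    rwa [mul_zero] at this
  obtain ⟨L, hL⟩ := ((ht.eventually_le_const hτ).and (eventually_ge_atTop (n / η))).exists_forall_of_atTop
  have hnη : 0 < n / η := by positivity
  refine ⟨max L 1, lt_max_of_lt_right one_pos, fun l hl p => ⟨fun y => l * φ (l • (y - p)), ?_⟩⟩
  obtain ⟨hl1, hl2⟩ := hL l ((le_max_left _ _).trans hl)
  have hl0 : 0 < l := lt_of_lt_of_le hnη hl2
  have e0 : ∀ y, l • (y - p) = l • y + -(l • p) := fun y => by rw [smul_sub]; abel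
  have en : ∀ y, ‖l • (y - p)‖ = l * ‖y - p‖ := fun y => by rw [norm_smul, Real.norm_of_nonneg hl0.le]
  have hbig : ∀ y, η ≤ ‖y - p‖ → n ≤ ‖l • (y - p)‖ := by
    intro y hy
    rw [en]
    have h5 : n / η * η ≤ l * ‖y - p‖ := by gcongr
    rwa [div_mul_cancel₀ _ hη.ne'] at h5
  constructor
  · fun_prop
  · have := h1.comp (g := φ) (f := fun y : E3 => l • (y - p)) (by fun_prop)
    exact contDiff_const.mul this
  · exact fun y => mul_pos hl0 (h2 _)
  · have := weak_scale h1 hw hl0 (-(l • p))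
    simp only [e0]; exact this
  · intro y hy
    have hp : 0 < ‖y - p‖ := by linarith
    rw [abs_mul, abs_of_pos (by positivity)]
    refine le_trans ?_ hl1
    calc l ^ 2 * |V (l • (y - p))| ≤ l ^ 2 * (C * (1 + ‖l • (y - p)‖ ^ 2) ^ (-β / 2)) := by gcongr; exact hb _
      _ ≤ l ^ 2 * (C * ((l * η) ^ 2) ^ (-β / 2)) := by
          refine mul_le_mul_of_nonneg_left (mul_le_mul_of_nonneg_left (Real.rpow_le_rpow_of_nonpos (by positivity) ?_ (by linarith)) hC.le) (by positivity)
          rw [en]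
          have : (l * η) ^ 2 ≤ (l * ‖y - p‖) ^ 2 := by gcongr
          linarith
      _ = C * η ^ (-β) * l ^ (-(β - 2)) := by
          rw [← Real.rpow_natCast (l * η) 2, ← Real.rpow_mul (by positivity), Real.mul_rpow hl0.le hη.le,
            ← Real.rpow_natCast l 2, show ((2:ℕ):ℝ) * (-β / 2) = -β by push_cast; ring,
            show (-(β - 2)) = ((2:ℕ):ℝ) + -β by push_cast; ring, Real.rpow_add hl0]
          ring
  · intro y hy
    have := hf _ (hbig y hy)
    rw [en] at this
    rwa [show ‖y - p‖ * (l * φ (l • (y - p))) = l * ‖y - p‖ * φ (l • (y - p)) by ring]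
  · intro y
    have := hM (l • (y - p))
    rw [en] at this
    rwa [show ‖y - p‖ * (l * φ (l • (y - p))) = l * ‖y - p‖ * φ (l • (y - p)) by ring]

/-- vanishing near a point -/
def VanNear (w : E3 → ℝ) (p : E3) : Prop := ∀ᶠ y in 𝓝 p, w y = 0

lemma VanNear.cd {w f : E3 → ℝ} {p y : E3} (h : VanNear w p) (hw : ContDiff ℝ 1 w)
    (hf : y ≠ p → ContDiffAt ℝ 1 f y) : ContDiffAt ℝ 1 (fun y => f y * w y) y := by
  by_cases hy : y = p
  · subst hy
    refine contDiffAt_const.congr_of_eventuallyEq (f := fun _ => (0:ℝ)) ?_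
    filter_upwards [h] with z hz
    rw [hz, mul_zero]
  · exact (hf hy).mul hw.contDiffAt

lemma norm_cd {p y : E3} (hy : y ≠ p) : ContDiffAt ℝ 1 (fun y : E3 => ‖y - p‖) y := by
  have h1 : ContDiffAt ℝ 1 (fun y : E3 => y - p) y := by fun_prop
  exact h1.norm ℝ (sub_ne_zero.2 hy)

/-- radial functions `g(r)/r` -/
def Yk (g : ℝ → ℝ) (p y : E3) : ℝ := g ‖y - p‖ / ‖y - p‖

lemma cd1_of {g g1 : ℝ → ℝ} (h1 : ∀ r, HasDerivAt g (g1 r) r) (hc : Continuous g1) : ContDiff ℝ 1 g := by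
  rw [contDiff_one_iff_deriv]
  refine ⟨fun r => (h1 r).differentiableAt, ?_⟩
  have : deriv g = g1 := funext fun r => (h1 r).deriv
  rw [this]; exact hc

lemma hg_rad {k : ℝ → ℝ} {k' : ℝ} {p y : E3} (hy : y ≠ p) (h : HasDerivAt k k' ‖y - p‖) :
    HasGradientAt (fun y => k ‖y - p‖) ((k' / ‖y - p‖) • (y - p)) y := by
  have := hg_comp (f := fun y : E3 => ‖y - p‖) h (hg_norm p y hy)
  rw [smul_smul, mul_one_div] at this
  exact this

lemma Yk_hg {g : ℝ → ℝ} {g' : ℝ} {p y : E3} (hy : y ≠ p) (h1 : HasDerivAt g g' ‖y - p‖) :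
    HasGradientAt (Yk g p) (((g' * ‖y - p‖ - g ‖y - p‖) / ‖y - p‖ ^ 3) • (y - p)) y := by
  have hp : 0 < ‖y - p‖ := norm_pos_iff.2 (sub_ne_zero.2 hy)
  have h2 : HasDerivAt (fun r => g r / r) ((g' * ‖y - p‖ - g ‖y - p‖ * 1) / ‖y - p‖ ^ 2) ‖y - p‖ :=
    h1.div (hasDerivAt_id _) hp.ne'
  have h3 := hg_rad hy h2
  rw [show (g' * ‖y - p‖ - g ‖y - p‖) / ‖y - p‖ ^ 3 = (g' * ‖y - p‖ - g ‖y - p‖ * 1) / ‖y - p‖ ^ 2 / ‖y - p‖ by field_simp]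
  exact h3

lemma Yk_cd {g : ℝ → ℝ} (hg : ContDiff ℝ 1 g) {p y : E3} (hy : y ≠ p) : ContDiffAt ℝ 1 (Yk g p) y := by
  have hp : 0 < ‖y - p‖ := norm_pos_iff.2 (sub_ne_zero.2 hy)
  exact (hg.contDiffAt.comp y (norm_cd hy)).div (norm_cd hy) hp.ne'

lemma ae_ne (p : E3) : ∀ᵐ y : E3, y ≠ p := by
  have : ({p}ᶜ : Set E3) ∈ ae volume := by
    rw [mem_ae_iff, compl_compl]; exact measure_singleton p
  exact this

lemma Yk_weak {g g1 g2 : ℝ → ℝ} (h1 : ∀ r, HasDerivAt g (g1 r) r) (h2 : ∀ r, HasDerivAt g1 (g2 r) r)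
    (hc : Continuous g2) {p : E3} {w : E3 → ℝ} (hw : C1c w) (hv : VanNear w p) :
    Integrable (fun y => inner ℝ (gradient (Yk g p) y) (gradient w y)) ∧
    ∫ y, inner ℝ (gradient (Yk g p) y) (gradient w y) = - ∫ y, g2 ‖y - p‖ / ‖y - p‖ * w y := by
  have hc1 : Continuous g1 := continuous_iff_continuousAt.2 fun t => (h2 t).continuousAt
  have c1 := cd1_of h1 hc1
  have c2 := cd1_of h2 hc
  let k : ℝ → ℝ := fun r => (g1 r * r - g r) / r ^ 3
  let H : E3 → ℝ := fun y => k ‖y - p‖ * w y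
  have hkc : ∀ y : E3, y ≠ p → ContDiffAt ℝ 1 (fun y : E3 => k ‖y - p‖) y := by
    intro y hy
    have hp : 0 < ‖y - p‖ := norm_pos_iff.2 (sub_ne_zero.2 hy)
    have n1 := norm_cd hy
    exact (((c2.contDiffAt.comp y n1).mul n1).sub (c1.contDiffAt.comp y n1)).div (n1.pow 3) (by positivity)
  have hH : C1c H := by
    refine ⟨contDiff_iff_contDiffAt.2 fun y => hv.cd hw.1 (hkc y), hw.2.mul_left⟩
  have hkd : ∀ y : E3, y ≠ p → HasDerivAt k (g2 ‖y - p‖ / ‖y - p‖ ^ 2 - 3 * k ‖y - p‖ / ‖y - p‖) ‖y - p‖ := by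
    intro y hy
    have hp : 0 < ‖y - p‖ := norm_pos_iff.2 (sub_ne_zero.2 hy)
    have := (((h2 ‖y - p‖).mul (hasDerivAt_id _)).sub (h1 ‖y - p‖)).div ((hasDerivAt_id ‖y - p‖).pow 3) (by simp; exact (norm_pos_iff.1 hp))
    refine this.congr_deriv ?_
    simp only [k, id]
    simp
    field_simp
  have he := euler hH p
  have hz : ∀ᵐ y, inner ℝ (y - p) (gradient H y) + 3 * H y = inner ℝ (gradient (Yk g p) y) (gradient w y) + g2 ‖y - p‖ / ‖y - p‖ * w y := by
    filter_upwards [ae_ne p] with y hy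
    have hp : 0 < ‖y - p‖ := norm_pos_iff.2 (sub_ne_zero.2 hy)
    have e1 := (hg_mul (hg_rad hy (hkd y hy)) (C1.hg hw.1 y)).gradient
    rw [(Yk_hg hy (h1 _)).gradient, show gradient H y = _ from e1]
    simp only [inner_add_right, real_inner_smul_left, real_inner_smul_right, real_inner_self_eq_norm_sq, H]
    rw [show k ‖y - p‖ = (g1 ‖y - p‖ * ‖y - p‖ - g ‖y - p‖) / ‖y - p‖ ^ 3 from rfl]
    field_simp
    ring
  have i1 : Integrable (fun y => inner ℝ (y - p) (gradient H y)) := hH.int_grad_inner (by fun_prop)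
  have i2 : Integrable (fun y => 3 * H y) := (hH.1.continuous.integrable_of_hasCompactSupport hH.2).const_mul 3
  have i3 : Integrable (fun y => g2 ‖y - p‖ / ‖y - p‖ * w y) := by
    refine Continuous.integrable_of_hasCompactSupport (continuous_iff_continuousAt.2 fun y => ?_) hw.2.mul_left
    by_cases hy : y = p
    · subst hy
      refine continuousAt_const.congr (f := fun _ => (0:ℝ)) ?_
      filter_upwards [hv] with z hz
      rw [hz, mul_zero]
    · have hp : 0 < ‖y - p‖ := norm_pos_iff.2 (sub_ne_zero.2 hy)
      have hwc := hw.1.continuous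
      exact ((by fun_prop : ContinuousAt (fun y => g2 ‖y - p‖) y).div (by fun_prop) hp.ne').mul hwc.continuousAt
  have i4 : Integrable (fun y => inner ℝ (gradient (Yk g p) y) (gradient w y)) := by
    refine ((i1.add i2).sub i3).congr ?_
    filter_upwards [hz] with y hy
    simp only [Pi.sub_apply, Pi.add_apply]
    linarith
  refine ⟨i4, ?_⟩
  have h5 := integral_congr_ae hz
  rw [integral_add i1 i2, integral_add i4 i3] at h5
  linarith

lemma lower_alg {g a1 a2 b d1 d2 : E3} {u α1 α2 c1 c2 : ℝ} (hα1 : 0 ≤ α1) (hα2 : 0 ≤ α2) (hα : α1 + α2 ≤ 1)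
    (hc1 : c1 ≤ 0) (hc2 : c2 ≤ 0) (e1 : d1 = c1 • (a1 - b)) (e2 : d2 = c2 • (a2 - b)) :
    inner ℝ a1 (u ^ 2 • d1 + (2 * α1 * u) • g - (α1 * u ^ 2) • a1) + inner ℝ a2 (u ^ 2 • d2 + (2 * α2 * u) • g - (α2 * u ^ 2) • a2) +
      inner ℝ b (u ^ 2 • (- d1 - d2) + (2 * (1 - α1 - α2) * u) • g - ((1 - α1 - α2) * u ^ 2) • b) ≤ ‖g‖ ^ 2 := by
  have k1 : 0 ≤ α1 * ‖g - u • a1‖ ^ 2 := by positivity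
  have k2 : 0 ≤ α2 * ‖g - u • a2‖ ^ 2 := by positivity
  have k3 : 0 ≤ (1 - α1 - α2) * ‖g - u • b‖ ^ 2 := mul_nonneg (by linarith) (by positivity)
  have k4 : 0 ≤ (u ^ 2 * (-c1)) * ‖a1 - b‖ ^ 2 := mul_nonneg (mul_nonneg (by positivity) (by linarith)) (by positivity)
  have k5 : 0 ≤ (u ^ 2 * (-c2)) * ‖a2 - b‖ ^ 2 := mul_nonneg (mul_nonneg (by positivity) (by linarith)) (by positivity)
  subst e1 e2
  rw [norm_sub_sq_real] at k1 k2 k3 k4 k5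
  simp only [norm_smul, mul_pow, real_inner_smul_right, Real.norm_eq_abs, sq_abs, ← real_inner_self_eq_norm_sq] at k1 k2 k3 k4 k5 ⊢
  simp only [inner_add_right, inner_sub_right, inner_neg_right, real_inner_smul_right]
  rw [real_inner_comm a1 g] at k1
  rw [real_inner_comm a2 g] at k2
  rw [real_inner_comm b g] at k3
  rw [real_inner_comm b a1] at k4
  rw [real_inner_comm b a2] at k5
  rw [real_inner_comm b a1, real_inner_comm b a2]
  nlinarith

lemma glue_test {A α u : E3 → ℝ} {y a d : E3} (hA : HasGradientAt A a y) (hpos : 0 < A y) (hα : HasGradientAt α d y) {g : E3}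
    (hu : HasGradientAt u g y) :
    HasGradientAt (fun y => (A y)⁻¹ * (α y * (u y * u y)))
      ((A y)⁻¹ • ((u y) ^ 2 • d + (2 * α y * u y) • g - (α y * u y ^ 2) • ((A y)⁻¹ • a))) y := by
  have h1 := hg_comp (f := A) (hasDerivAt_inv hpos.ne') hA
  have h2 := hg_mul h1 (hg_mul hα (hg_mul hu hu))
  convert h2 using 1
  simp only [smul_smul, smul_add, smul_sub]
  module

lemma lower_glue {p1 p2 : E3} {W1 W2 A1 A2 α1 α2 B : E3 → ℝ} {k : ℝ}
    (cA1 : ContDiff ℝ 1 A1) (cA2 : ContDiff ℝ 1 A2) (pos1 : ∀ y, 0 < A1 y) (pos2 : ∀ y, 0 < A2 y)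
    (wk1 : WeakSol W1 A1) (wk2 : WeakSol W2 A2) (cW1 : Continuous W1) (cW2 : Continuous W2)
    (cα1 : ContDiff ℝ 1 α1) (cα2 : ContDiff ℝ 1 α2) (n1 : ∀ y, 0 ≤ α1 y) (n2 : ∀ y, 0 ≤ α2 y)
    (n12 : ∀ y, α1 y + α2 y ≤ 1) (v1 : ∀ᶠ y in 𝓝 p1, α1 y = 1) (v2 : ∀ᶠ y in 𝓝 p2, α2 y = 1)
    (cB : ∀ y, y ≠ p1 → y ≠ p2 → ContDiffAt ℝ 1 B y) (posB : ∀ y, y ≠ p1 → y ≠ p2 → 0 < B y)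
    (d1 : ∀ y, y ≠ p1 → y ≠ p2 → ∃ c ≤ (0:ℝ), gradient α1 y = c • ((A1 y)⁻¹ • gradient A1 y - (B y)⁻¹ • gradient B y))
    (d2 : ∀ y, y ≠ p1 → y ≠ p2 → ∃ c ≤ (0:ℝ), gradient α2 y = c • ((A2 y)⁻¹ • gradient A2 y - (B y)⁻¹ • gradient B y))
    (wkB : ∀ w, C1c w → VanNear w p1 → VanNear w p2 → Integrable (fun y => inner ℝ (gradient B y) (gradient w y)) ∧
      ∫ y, inner ℝ (gradient B y) (gradient w y) = - ∫ y, k ^ 2 * B y * w y)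
    {u : E3 → ℝ} (hu : C1c u) :
    0 ≤ ∫ y, (‖gradient u y‖ ^ 2 + (W1 y * α1 y + W2 y * α2 y + k ^ 2 * (1 - α1 y - α2 y)) * u y ^ 2) := by
  have hdA : ∀ {A : E3 → ℝ}, ContDiff ℝ 1 A → ∀ y, HasGradientAt A (gradient A y) y := fun h y => C1.hg h y
  have inv1 : ContDiff ℝ 1 (fun y => (A1 y)⁻¹) := cA1.inv fun y => (pos1 y).ne'
  have inv2 : ContDiff ℝ 1 (fun y => (A2 y)⁻¹) := cA2.inv fun y => (pos2 y).ne'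
  have t1 : C1c (fun y => (A1 y)⁻¹ * (α1 y * (u y * u y))) := C1c.mul inv1 (C1c.mul cα1 (C1c.mul hu.1 hu))
  have t2 : C1c (fun y => (A2 y)⁻¹ * (α2 y * (u y * u y))) := C1c.mul inv2 (C1c.mul cα2 (C1c.mul hu.1 hu))
  have cβ : ContDiff ℝ 1 (fun y => 1 - α1 y - α2 y) := (contDiff_const.sub cα1).sub cα2
  have bu : C1c (fun y => (1 - α1 y - α2 y) * (u y * u y)) := C1c.mul cβ (C1c.mul hu.1 hu)
  have bv1 : ∀ᶠ y in 𝓝 p1, 1 - α1 y - α2 y = 0 := by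
    filter_upwards [v1] with y hy
    linarith [n2 y, n12 y]
  have bv2 : ∀ᶠ y in 𝓝 p2, 1 - α1 y - α2 y = 0 := by
    filter_upwards [v2] with y hy
    linarith [n1 y, n12 y]
  have b1 : VanNear (fun y => (1 - α1 y - α2 y) * (u y * u y)) p1 := by
    filter_upwards [bv1] with y hy
    rw [hy, zero_mul]
  have b2 : VanNear (fun y => (1 - α1 y - α2 y) * (u y * u y)) p2 := by
    filter_upwards [bv2] with y hy
    rw [hy, zero_mul]
  have t3 : C1c (fun y => (B y)⁻¹ * ((1 - α1 y - α2 y) * (u y * u y))) := by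
    refine ⟨contDiff_iff_contDiffAt.2 fun y => ?_, bu.2.mul_left⟩
    by_cases h2 : y = p2
    · exact b2.cd bu.1 fun h => absurd h2 h
    · exact b1.cd bu.1 fun h => (cB y h h2).inv (posB y h h2).ne'
  have w1 : VanNear (fun y => (B y)⁻¹ * ((1 - α1 y - α2 y) * (u y * u y))) p1 := by
    filter_upwards [b1] with y hy
    rw [hy, mul_zero]
  have w2 : VanNear (fun y => (B y)⁻¹ * ((1 - α1 y - α2 y) * (u y * u y))) p2 := by
    filter_upwards [b2] with y hy
    rw [hy, mul_zero]
  obtain ⟨i3, e3⟩ := wkB _ t3 w1 w2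
  have e1 := wk1 _ t1
  have e2 := wk2 _ t2
  have i1 := t1.int_grad_inner (C1.cont_grad cA1)
  have i2 := t2.int_grad_inner (C1.cont_grad cA2)
  have hc := hu.1.continuous
  have cc1 := cα1.continuous
  have cc2 := cα2.continuous
  have j1 : Integrable (fun y => ‖gradient u y‖ ^ 2) := hu.int_grad_sq
  have js : ∀ {F : E3 → ℝ}, Continuous F → Integrable (fun y => F y * u y ^ 2) := by
    intro F hF
    exact hu.integrable_of (by fun_prop) (fun x h _ => by simp [h])
  have j2 : Integrable (fun y => (W1 y * α1 y + W2 y * α2 y + k ^ 2 * (1 - α1 y - α2 y)) * u y ^ 2) := js (by fun_prop)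
  have s1 : ∫ y, W1 y * A1 y * ((A1 y)⁻¹ * (α1 y * (u y * u y))) = ∫ y, W1 y * α1 y * u y ^ 2 := by
    refine integral_congr_ae (Eventually.of_forall fun y => ?_)
    have := (pos1 y).ne'
    simp only
    field_simp
  have s2 : ∫ y, W2 y * A2 y * ((A2 y)⁻¹ * (α2 y * (u y * u y))) = ∫ y, W2 y * α2 y * u y ^ 2 := by
    refine integral_congr_ae (Eventually.of_forall fun y => ?_)
    have := (pos2 y).ne'
    simp only
    field_simp
  have s3 : ∫ y, k ^ 2 * B y * ((B y)⁻¹ * ((1 - α1 y - α2 y) * (u y * u y))) = ∫ y, k ^ 2 * (1 - α1 y - α2 y) * u y ^ 2 := by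
    refine integral_congr_ae ?_
    filter_upwards [ae_ne p1, ae_ne p2] with y h1 h2
    have := (posB y h1 h2).ne'
    field_simp
  have s4 : ∫ y, (W1 y * α1 y + W2 y * α2 y + k ^ 2 * (1 - α1 y - α2 y)) * u y ^ 2
      = (∫ y, W1 y * α1 y * u y ^ 2) + (∫ y, W2 y * α2 y * u y ^ 2) + ∫ y, k ^ 2 * (1 - α1 y - α2 y) * u y ^ 2 := by
    have q1 := js (F := fun y => W1 y * α1 y) (by fun_prop)
    have q2 := js (F := fun y => W2 y * α2 y) (by fun_prop)
    have q3 := js (F := fun y => k ^ 2 * (1 - α1 y - α2 y)) (by fun_prop)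
    rw [← integral_add q1 q2, ← integral_add (by exact q1.add q2) q3]
    refine integral_congr_ae (Eventually.of_forall fun y => ?_)
    simp only
    ring
  rw [integral_add j1 j2, s4, ← s1, ← s2, ← s3]
  have key : (∫ y, inner ℝ (gradient A1 y) (gradient (fun y => (A1 y)⁻¹ * (α1 y * (u y * u y))) y))
      + (∫ y, inner ℝ (gradient A2 y) (gradient (fun y => (A2 y)⁻¹ * (α2 y * (u y * u y))) y))
      + (∫ y, inner ℝ (gradient B y) (gradient (fun y => (B y)⁻¹ * ((1 - α1 y - α2 y) * (u y * u y))) y))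
      ≤ ∫ y, ‖gradient u y‖ ^ 2 := by
    rw [← integral_add i1 i2, ← integral_add (by exact i1.add i2) i3]
    refine integral_mono_ae (by exact (i1.add i2).add i3) j1 ?_
    filter_upwards [ae_ne p1, ae_ne p2] with y h1 h2
    obtain ⟨c1, hc1, f1⟩ := d1 y h1 h2
    obtain ⟨c2, hc2, f2⟩ := d2 y h1 h2
    have gB : HasGradientAt B (gradient B y) y := ((cB y h1 h2).differentiableAt (by norm_num)).hasGradientAt
    have hgu := C1.hg hu.1 y
    have x1 := (glue_test (C1.hg cA1 y) (pos1 y) (C1.hg cα1 y) hgu).gradient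
    have x2 := (glue_test (C1.hg cA2 y) (pos2 y) (C1.hg cα2 y) hgu).gradient
    have gβ : HasGradientAt (fun y => 1 - α1 y - α2 y) (- gradient α1 y - gradient α2 y) y := by
      have := hg_sub (hg_sub (hasGradientAt_const y (1:ℝ)) (C1.hg cα1 y)) (C1.hg cα2 y)
      rwa [zero_sub] at this
    have x3 := (glue_test gB (posB y h1 h2) gβ hgu).gradient
    rw [x1, x2, x3]
    have := lower_alg (g := gradient u y) (u := u y) (n1 y) (n2 y) (n12 y) hc1 hc2 f1 f2
    refine le_trans (le_of_eq ?_) this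
    simp only [real_inner_smul_right, real_inner_smul_left]
  linarith

lemma alpha_exists {p : E3} {A B : E3 → ℝ} {η ε q0 q1 : ℝ} (hη : 0 < η) (hηε : 2 * η ≤ ε) (hq : q0 < q1)
    (cA : ContDiff ℝ 1 A) (posA : ∀ y, 0 < A y)
    (cB : ∀ y, y ≠ p → ‖y - p‖ < 2 * ε → ContDiffAt ℝ 1 B y) (posB : ∀ y, y ≠ p → ‖y - p‖ < 2 * ε → 0 < B y)
    (hin : ∀ y, η ≤ ‖y - p‖ → ‖y - p‖ ≤ 2 * η → A y / B y ≤ q0)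
    (hout : ∀ y, ε ≤ ‖y - p‖ → ‖y - p‖ < 2 * ε → q1 ≤ A y / B y) :
    ∃ α : E3 → ℝ, ContDiff ℝ 1 α ∧ (∀ y, 0 ≤ α y) ∧ (∀ y, α y ≤ 1) ∧ (∀ y, ‖y - p‖ < 2 * η → α y = 1) ∧
      (∀ y, 2 * ε ≤ ‖y - p‖ → α y = 0) ∧
      ∀ y, y ≠ p → ∃ c ≤ (0:ℝ), gradient α y = c • ((A y)⁻¹ • gradient A y - (B y)⁻¹ • gradient B y) := by
  let j : ℝ → ℝ := fun q => Real.smoothTransition ((q1 - q) / (q1 - q0))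
  have hd : 0 < q1 - q0 := by linarith
  have hj : ContDiff ℝ 1 j := Real.smoothTransition.contDiff.comp ((contDiff_const.sub contDiff_id).div_const _)
  have hanti : Antitone j := fun a b hab => Real.smoothTransition.monotone (by gcongr)
  have j1 : ∀ q, q ≤ q0 → j q = 1 := fun q h => Real.smoothTransition.one_of_one_le (by
    rw [le_div_iff₀ hd]; linarith)
  have j0 : ∀ q, q1 ≤ q → j q = 0 := fun q h => Real.smoothTransition.zero_of_nonpos
    (div_nonpos_of_nonpos_of_nonneg (by linarith) hd.le)
  let α : E3 → ℝ := fun y => if ‖y - p‖ < 2 * η then 1 else if ‖y - p‖ < 2 * ε then j (A y / B y) else 0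
  have a1 : ∀ y, ‖y - p‖ < 2 * η → α y = 1 := fun y h => if_pos h
  have a2 : ∀ y, η ≤ ‖y - p‖ → ‖y - p‖ < 2 * ε → α y = j (A y / B y) := by
    intro y h1 h2
    by_cases h : ‖y - p‖ < 2 * η
    · rw [a1 y h, j1 _ (hin y h1 h.le)]
    · simp only [α, if_neg h, if_pos h2]
  have a3 : ∀ y, ε ≤ ‖y - p‖ → α y = 0 := by
    intro y h
    by_cases h2 : ‖y - p‖ < 2 * ε
    · rw [a2 y (by linarith) h2, j0 _ (hout y h h2)]
    · simp only [α, if_neg h2, if_neg (show ¬ ‖y - p‖ < 2 * η by linarith)]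
  have cn : Continuous (fun y : E3 => ‖y - p‖) := by fun_prop
  have loc : ∀ y, (α =ᶠ[𝓝 y] fun _ => 1) ∨ (α =ᶠ[𝓝 y] fun _ => 0) ∨
      (η < ‖y - p‖ ∧ ‖y - p‖ < 2 * ε ∧ α =ᶠ[𝓝 y] fun y => j (A y / B y)) := by
    intro y
    by_cases h1 : ‖y - p‖ < 2 * η
    · left
      filter_upwards [(isOpen_Iio.preimage cn).mem_nhds h1] with z hz using a1 z hz
    by_cases h2 : ‖y - p‖ < 2 * ε
    · right; right
      refine ⟨by linarith, h2, ?_⟩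
      have hy : η < ‖y - p‖ := by linarith
      filter_upwards [(isOpen_Iio.preimage cn).mem_nhds h2, (isOpen_Ioi.preimage cn).mem_nhds hy] with z hz hz'
      exact a2 z (le_of_lt hz') hz
    · right; left
      have hy : ε < ‖y - p‖ := by linarith
      filter_upwards [(isOpen_Ioi.preimage cn).mem_nhds hy] with z hz'
      exact a3 z (le_of_lt hz')
  have ne_of : ∀ y, η < ‖y - p‖ → y ≠ p := by
    rintro y h rfl
    simp at h; linarith
  refine ⟨α, ?_, ?_, ?_, a1, fun y h => a3 y (by linarith), ?_⟩
  · refine contDiff_iff_contDiffAt.2 fun y => ?_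
    rcases loc y with h | h | ⟨h1, h2, h⟩
    · exact contDiffAt_const.congr_of_eventuallyEq h
    · exact contDiffAt_const.congr_of_eventuallyEq h
    · refine ContDiffAt.congr_of_eventuallyEq ?_ h
      exact hj.contDiffAt.comp y (cA.contDiffAt.div (cB y (ne_of y h1) h2) (posB y (ne_of y h1) h2).ne')
  · intro y
    simp only [α]
    split_ifs
    · norm_num
    · exact Real.smoothTransition.nonneg _
    · norm_num
  · intro y
    simp only [α]
    split_ifs
    · norm_num
    · exact Real.smoothTransition.le_one _
    · norm_num
  · intro y hy
    rcases loc y with h | h | ⟨h1, h2, h⟩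
    · refine ⟨0, le_rfl, ?_⟩
      rw [zero_smul]
      exact ((hasGradientAt_const y (1:ℝ)).congr_of_eventuallyEq h).gradient
    · refine ⟨0, le_rfl, ?_⟩
      rw [zero_smul]
      exact ((hasGradientAt_const y (0:ℝ)).congr_of_eventuallyEq h).gradient
    · have pB := posB y (ne_of y h1) h2
      have gB : HasGradientAt B (gradient B y) y := ((cB y (ne_of y h1) h2).differentiableAt (by norm_num)).hasGradientAt
      have hB := hg_comp (f := B) (hasDerivAt_inv pB.ne') gB
      have hAB := hg_mul (C1.hg cA y) hB
      have hD : HasDerivAt j (deriv j (A y * (B y)⁻¹)) (A y * (B y)⁻¹) :=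
        (hj.differentiable (by norm_num) _).hasDerivAt
      have hF := hg_comp (f := fun y => A y * (B y)⁻¹) hD hAB
      refine ⟨deriv j (A y * (B y)⁻¹) * (A y * (B y)⁻¹), mul_nonpos_of_nonpos_of_nonneg hanti.deriv_nonpos
        (mul_nonneg (posA y).le (inv_pos.2 pB).le), ?_⟩
      have := (hF.congr_of_eventuallyEq (show α =ᶠ[𝓝 y] _ by simpa only [div_eq_mul_inv] using h)).gradient
      rw [this]
      simp only [smul_add, smul_sub, smul_smul]
      have hA := (posA y).ne'
      rw [sub_eq_add_neg, add_comm, ← neg_smul]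
      congr 2
      · field_simp
      · rw [pow_two, mul_inv]; ring

lemma kappa {s : ℝ} (hs : 0 < s) (hg : Real.exp (-s) < s) :
    ∃ ε, 0 < ε ∧ ε < 1 / 4 ∧ ∀ r, 0 < r → r < 2 * ε →
      Real.exp (-s * r) + r * (Real.exp (-s * (1 - r)) / (1 - r)) ≤ 1 - (s - Real.exp (-s)) / 2 * r := by
  have h1 : HasDerivAt (fun r : ℝ => Real.exp (-s * r) + r * (Real.exp (-s * (1 - r)) / (1 - r))) (- (s - Real.exp (-s))) 0 := by
    have a1 : HasDerivAt (fun r : ℝ => Real.exp (-s * r)) (-s) 0 := by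
      have := ((hasDerivAt_id (0:ℝ)).const_mul (-s)).exp
      simpa using this
    have a2 : DifferentiableAt ℝ (fun r : ℝ => Real.exp (-s * (1 - r)) / (1 - r)) 0 := by
      refine DifferentiableAt.div (by fun_prop) (by fun_prop) (by norm_num)
    have a3 := a1.add ((hasDerivAt_id (0:ℝ)).mul a2.hasDerivAt)
    refine a3.congr_deriv ?_
    simp
    ring
  rw [hasDerivAt_iff_isLittleO] at h1
  have h2 := h1.bound (show 0 < (s - Real.exp (-s)) / 2 by linarith)
  obtain ⟨δ, hδ, h3⟩ := Metric.eventually_nhds_iff.1 h2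
  refine ⟨min (δ / 2) (1 / 5), by positivity, ?_, ?_⟩
  · exact (min_le_right _ _).trans_lt (by norm_num)
  · intro r h0 hr
    have : r < δ := by linarith [min_le_left (δ / 2) (1 / 5)]
    have := h3 (y := r) (by simpa [abs_of_pos h0] using this)
    simp only [Real.norm_eq_abs, sub_zero, abs_of_pos h0, smul_eq_mul, mul_zero, Real.exp_zero, zero_mul, add_zero] at this
    have := (abs_le.1 this).2
    linarith

lemma site_bounds {s τ η ε M : ℝ} (hs : 0 < s) (hg : Real.exp (-s) < s) (hε : 0 < ε) (hε4 : ε < 1 / 4)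
    (hτ : 0 < τ) (hη : 0 < η) (hηε : 2 * η ≤ ε)
    (hk : ∀ r, 0 < r → r < 2 * ε →
      Real.exp (-s * r) + r * (Real.exp (-s * (1 - r)) / (1 - r)) ≤ 1 - (s - Real.exp (-s)) / 2 * r)
    (hq : (1 + τ) * Real.exp (s * (2 * η)) < (1 - τ) / (1 - (s - Real.exp (-s)) / 2 * ε))
    {p q : E3} (hpq : ‖q - p‖ = 1) {W A : E3 → ℝ} (S : Site p W A τ η M) :
    ∃ α : E3 → ℝ, ContDiff ℝ 1 α ∧ (∀ y, 0 ≤ α y) ∧ (∀ y, α y ≤ 1) ∧ (∀ y, ‖y - p‖ < 2 * η → α y = 1) ∧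
      (∀ y, 2 * ε ≤ ‖y - p‖ → α y = 0) ∧
      ∀ y, y ≠ p → ∃ c ≤ (0:ℝ), gradient α y = c • ((A y)⁻¹ • gradient A y -
        (Yk (fun r => Real.exp (-s * r)) p y + Yk (fun r => Real.exp (-s * r)) q y)⁻¹ •
          gradient (fun y => Yk (fun r => Real.exp (-s * r)) p y + Yk (fun r => Real.exp (-s * r)) q y) y) := by
  have hqd : ∀ y : E3, 1 - ‖y - p‖ ≤ ‖y - q‖ := by
    intro y
    have : ‖q - p‖ ≤ ‖y - p‖ + ‖y - q‖ := by
      rw [show q - p = (y - p) - (y - q) by abel]; exact norm_sub_le _ _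
    linarith
  have hYn : ∀ a y : E3, 0 ≤ Yk (fun r => Real.exp (-s * r)) a y := fun a y => div_nonneg (Real.exp_pos _).le (norm_nonneg _)
  have hYp : ∀ a y : E3, y ≠ a → 0 < Yk (fun r => Real.exp (-s * r)) a y := fun a y h =>
    div_pos (Real.exp_pos _) (norm_pos_iff.2 (sub_ne_zero.2 h))
  have hgc : ContDiff ℝ 1 (fun r => Real.exp (-s * r)) := by fun_prop
  have nq : ∀ y : E3, ‖y - p‖ < 2 * ε → y ≠ q := by
    rintro y h rfl
    linarith
  refine alpha_exists hη hηε hq S.cA S.pos ?_ ?_ ?_ ?_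
  · exact fun y h1 h2 => (Yk_cd hgc h1).add (Yk_cd hgc (nq y h2))
  · exact fun y h1 h2 => add_pos (hYp p y h1) (hYp q y (nq y h2))
  · intro y h1 h2
    have hr : 0 < ‖y - p‖ := by linarith
    have hA := (abs_le.1 (S.farA y h1)).2
    have hB : Real.exp (-s * (2 * η)) ≤ ‖y - p‖ * (Yk (fun r => Real.exp (-s * r)) p y + Yk (fun r => Real.exp (-s * r)) q y) := by
      have e1 : ‖y - p‖ * Yk (fun r => Real.exp (-s * r)) p y = Real.exp (-s * ‖y - p‖) := by
        simp only [Yk]; field_simp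
      have e2 : Real.exp (-s * (2 * η)) ≤ Real.exp (-s * ‖y - p‖) := Real.exp_le_exp.2 (by nlinarith)
      have := mul_nonneg hr.le (hYn q y)
      rw [mul_add]; linarith
    set B := Yk (fun r => Real.exp (-s * r)) p y + Yk (fun r => Real.exp (-s * r)) q y
    have hee : Real.exp (s * (2 * η)) * Real.exp (-s * (2 * η)) = 1 := by
      rw [← Real.exp_add]; simp
    have hBp : 0 < ‖y - p‖ * B := (Real.exp_pos _).trans_le hB
    have hB0 : 0 < B := (mul_pos_iff_of_pos_left hr).1 hBp
    rw [← mul_div_mul_left (A y) B hr.ne', div_le_iff₀ hBp]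
    calc ‖y - p‖ * A y ≤ (1 + τ) * 1 := by linarith
      _ = (1 + τ) * Real.exp (s * (2 * η)) * Real.exp (-s * (2 * η)) := by rw [← hee]; ring
      _ ≤ _ := by gcongr
  · intro y h1 h2
    have hr : 0 < ‖y - p‖ := by linarith
    have hA := (abs_le.1 (S.farA y (by linarith))).1
    have hB : ‖y - p‖ * (Yk (fun r => Real.exp (-s * r)) p y + Yk (fun r => Real.exp (-s * r)) q y) ≤ 1 - (s - Real.exp (-s)) / 2 * ε := by
      have e1 : ‖y - p‖ * Yk (fun r => Real.exp (-s * r)) p y = Real.exp (-s * ‖y - p‖) := by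
        simp only [Yk]; field_simp
      have e2 : Yk (fun r => Real.exp (-s * r)) q y ≤ Real.exp (-s * (1 - ‖y - p‖)) / (1 - ‖y - p‖) := by
        have h5 : 0 < 1 - ‖y - p‖ := by linarith
        simp only [Yk]
        exact div_le_div₀ (Real.exp_pos _).le (Real.exp_le_exp.2 (by nlinarith [hqd y])) h5 (hqd y)
      have e3 := mul_le_mul_of_nonneg_left e2 hr.le
      have e4 := hk _ hr h2
      have e5 : (s - Real.exp (-s)) / 2 * ε ≤ (s - Real.exp (-s)) / 2 * ‖y - p‖ := by gcongr
      rw [mul_add]; linarith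
    have hB0 : 0 < Yk (fun r => Real.exp (-s * r)) p y + Yk (fun r => Real.exp (-s * r)) q y :=
      add_pos_of_pos_of_nonneg (hYp p y (by rintro rfl; simp at hr)) (hYn q y)
    set B := Yk (fun r => Real.exp (-s * r)) p y + Yk (fun r => Real.exp (-s * r)) q y
    have hBp : 0 < ‖y - p‖ * B := mul_pos hr hB0
    rw [← mul_div_mul_left (A y) B hr.ne']
    have : 0 ≤ ‖y - p‖ * A y := mul_nonneg hr.le (S.pos y).le
    exact div_le_div₀ this (by linarith) hBp hB

lemma core_lower {s t : ℝ} (hs : 0 < s) (hg : Real.exp (-s) < s) (hst : s < t) :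
    ∃ τ η : ℝ, 0 < τ ∧ 0 < η ∧ ∀ (p q : E3) (W1 W2 A1 A2 : E3 → ℝ) (M1 M2 : ℝ), ‖q - p‖ = 1 →
      Site p W1 A1 τ η M1 → Site q W2 A2 τ η M2 → ∀ u : E3 → ℝ, C1c u →
      0 ≤ ∫ y, (‖gradient u y‖ ^ 2 + (W1 y + W2 y + t ^ 2) * u y ^ 2) := by
  obtain ⟨ε, hε, hε4, hk⟩ := kappa hs hg
  obtain ⟨θ, hθd⟩ : ∃ θ, θ = (s - Real.exp (-s)) / 2 * ε := ⟨_, rfl⟩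
  have hθ : 0 < θ := by rw [hθd]; exact mul_pos (by linarith) hε
  have hθ1 : θ < 1 := by
    have h1 := hk ε hε (by linarith)
    have h2 : 0 < Real.exp (-s * ε) + ε * (Real.exp (-s * (1 - ε)) / (1 - ε)) := by
      have h5 : 0 < 1 - ε := by linarith
      positivity
    linarith
  have hη : ∃ η, 0 < η ∧ 2 * η ≤ ε ∧ Real.exp (s * (2 * η)) < 1 + θ / 2 := by
    have hc : ContinuousAt (fun η : ℝ => Real.exp (s * (2 * η))) 0 := by fun_prop
    have := hc.eventually_lt (f := fun η : ℝ => Real.exp (s * (2 * η))) (g := fun _ => 1 + θ / 2) continuousAt_const (by simp; linarith)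
    obtain ⟨δ, hδ, h3⟩ := Metric.eventually_nhds_iff.1 this
    refine ⟨min (δ / 2) (ε / 2), by positivity, ?_, ?_⟩
    · linarith [min_le_right (δ / 2) (ε / 2)]
    · refine h3 ?_
      rw [Real.dist_eq, sub_zero, abs_of_pos (by positivity)]
      linarith [min_le_left (δ / 2) (ε / 2)]
  obtain ⟨η, hη, hηε, hηe⟩ := hη
  have hd : 0 < t ^ 2 - s ^ 2 := by nlinarith
  obtain ⟨τ, hτ, hτ1, hτ2⟩ : ∃ τ, 0 < τ ∧ τ ≤ θ / 8 ∧ 2 * τ ≤ t ^ 2 - s ^ 2 := by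
    refine ⟨min (θ / 8) ((t ^ 2 - s ^ 2) / 2), by positivity, min_le_left _ _, ?_⟩
    linarith [min_le_right (θ / 8) ((t ^ 2 - s ^ 2) / 2)]
  have hq : (1 + τ) * Real.exp (s * (2 * η)) < (1 - τ) / (1 - (s - Real.exp (-s)) / 2 * ε) := by
    rw [← hθd, lt_div_iff₀ (by linarith)]
    have h1 : (1 + τ) * Real.exp (s * (2 * η)) * (1 - θ) ≤ (1 + τ) * (1 + θ / 2) * (1 - θ) := by
      have : 0 ≤ 1 - θ := by linarith
      gcongr
    have h2 : (1 + τ) * (1 + θ / 2) * (1 - θ) ≤ (1 + τ) * (1 - θ / 2) := by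
      rw [mul_assoc]
      refine mul_le_mul_of_nonneg_left ?_ (by linarith)
      nlinarith
    have h3 : (1 + τ) * (1 - θ / 2) < 1 - τ := by nlinarith
    linarith
  refine ⟨τ, η, hτ, hη, ?_⟩
  intro p q W1 W2 A1 A2 M1 M2 hpq S1 S2 u hu
  have hpq' : ‖p - q‖ = 1 := by rw [norm_sub_rev]; exact hpq
  obtain ⟨α1, c1, n1, l1, o1, z1, d1⟩ := site_bounds hs hg hε hε4 hτ hη hηε hk hq hpq S1
  obtain ⟨α2, c2, n2, l2, o2, z2, d2⟩ := site_bounds hs hg hε hε4 hτ hη hηε hk hq hpq' S2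
  have hgc : ContDiff ℝ 1 (fun r => Real.exp (-s * r)) := by fun_prop
  have hYp : ∀ a y : E3, y ≠ a → 0 < Yk (fun r => Real.exp (-s * r)) a y := fun a y h =>
    div_pos (Real.exp_pos _) (norm_pos_iff.2 (sub_ne_zero.2 h))
  have n12 : ∀ y, α1 y + α2 y ≤ 1 := by
    intro y
    by_cases h : 2 * ε ≤ ‖y - p‖
    · rw [z1 y h]; linarith [l2 y]
    · have : ‖q - p‖ ≤ ‖y - p‖ + ‖y - q‖ := by
        rw [show q - p = (y - p) - (y - q) by abel]; exact norm_sub_le _ _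
      rw [z2 y (by linarith)]; linarith [l1 y]
  have nb : ∀ a : E3, ∀ᶠ y in 𝓝 a, ‖y - a‖ < 2 * η := by
    intro a
    have cn : Continuous (fun y : E3 => ‖y - a‖) := by fun_prop
    exact (isOpen_Iio.preimage cn).mem_nhds (by simp; linarith)
  have g1 : ∀ r, HasDerivAt (fun r => Real.exp (-s * r)) (-s * Real.exp (-s * r)) r := by
    intro r
    have := ((hasDerivAt_id r).const_mul (-s)).exp
    refine this.congr_deriv ?_
    simp; ring
  have g2 : ∀ r, HasDerivAt (fun r => -s * Real.exp (-s * r)) (s ^ 2 * Real.exp (-s * r)) r := by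
    intro r
    refine ((g1 r).const_mul (-s)).congr_deriv ?_
    ring
  have main := lower_glue (B := fun y => Yk (fun r => Real.exp (-s * r)) p y + Yk (fun r => Real.exp (-s * r)) q y) (k := s)
    (p1 := p) (p2 := q) S1.cA S2.cA S1.pos S2.pos S1.weak S2.weak S1.cW S2.cW c1 c2 n1 n2 n12
    ((nb p).mono o1) ((nb q).mono o2) (fun y h1 h2 => (Yk_cd hgc h1).add (Yk_cd hgc h2))
    (fun y h1 h2 => add_pos (hYp p y h1) (hYp q y h2)) (fun y h1 h2 => d1 y h1)
    (fun y h1 h2 => by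
      obtain ⟨c, hc, e⟩ := d2 y h2
      refine ⟨c, hc, ?_⟩
      rw [e]
      simp only [add_comm (Yk (fun r => Real.exp (-s * r)) q _)])
    (fun w hw v1 v2 => by
      obtain ⟨i1, e1⟩ := Yk_weak g1 g2 (by fun_prop) hw v1
      obtain ⟨i2, e2⟩ := Yk_weak g1 g2 (by fun_prop) hw v2
      have hae : (fun y => inner ℝ (gradient (fun y => Yk (fun r => Real.exp (-s * r)) p y + Yk (fun r => Real.exp (-s * r)) q y) y) (gradient w y))
          =ᵐ[volume] fun y => inner ℝ (gradient (Yk (fun r => Real.exp (-s * r)) p) y) (gradient w y) + inner ℝ (gradient (Yk (fun r => Real.exp (-s * r)) q) y) (gradient w y) := by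
        filter_upwards [ae_ne p, ae_ne q] with y h1 h2
        rw [(hg_add (Yk_hg h1 (g1 _)) (Yk_hg h2 (g1 _))).gradient, inner_add_left, (Yk_hg h1 (g1 _)).gradient, (Yk_hg h2 (g1 _)).gradient]
      refine ⟨(i1.add i2).congr hae.symm, ?_⟩
      have j : ∀ a : E3, VanNear w a → Integrable (fun y => s ^ 2 * Real.exp (-s * ‖y - a‖) / ‖y - a‖ * w y) := by
        intro a hv
        refine Continuous.integrable_of_hasCompactSupport (continuous_iff_continuousAt.2 fun y => ?_) hw.2.mul_left
        by_cases hy : y = a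
        · subst hy
          refine continuousAt_const.congr (f := fun _ => (0:ℝ)) ?_
          filter_upwards [hv] with z hz
          rw [hz, mul_zero]
        · have hp : 0 < ‖y - a‖ := norm_pos_iff.2 (sub_ne_zero.2 hy)
          have hwc := hw.1.continuous
          exact ((by fun_prop : ContinuousAt (fun y => s ^ 2 * Real.exp (-s * ‖y - a‖)) y).div (by fun_prop) hp.ne').mul hwc.continuousAt
      rw [integral_congr_ae hae, integral_add i1 i2, e1, e2, ← neg_add, ← integral_add (j p v1) (j q v2)]
      congr 1
      refine integral_congr_ae (Eventually.of_forall fun y => ?_)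
      simp only [Yk]
      ring) hu
  refine main.trans ?_
  have hc := hu.1.continuous
  have cc1 := c1.continuous
  have cc2 := c2.continuous
  have cw1 := S1.cW
  have cw2 := S2.cW
  have j1 : Integrable (fun y => ‖gradient u y‖ ^ 2) := hu.int_grad_sq
  have js : ∀ {F : E3 → ℝ}, Continuous F → Integrable (fun y => F y * u y ^ 2) := by
    intro F hF
    exact hu.integrable_of (by fun_prop) (fun x h _ => by simp [h])
  refine integral_mono (by exact j1.add (js (F := fun y => W1 y * α1 y + W2 y * α2 y + s ^ 2 * (1 - α1 y - α2 y)) (by fun_prop)))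
    (by exact j1.add (js (F := fun y => W1 y + W2 y + t ^ 2) (by fun_prop))) ?_
  intro y
  have far : ∀ (a : E3) (W A α : E3 → ℝ) (M : ℝ), Site a W A τ η M → (∀ y, 0 ≤ α y) → (∀ y, α y ≤ 1) → (∀ y, ‖y - a‖ < 2 * η → α y = 1) →
      -τ ≤ (1 - α y) * W y := by
    intro a W A α M S h0 h1 h2
    by_cases h : ‖y - a‖ < 2 * η
    · rw [h2 y h]; linarith
    · have := (abs_le.1 (S.farW y (by linarith))).1
      nlinarith [h0 y, h1 y]
  have f1 := far p W1 A1 α1 M1 S1 n1 l1 o1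
  have f2 := far q W2 A2 α2 M2 S2 n2 l2 o2
  have f3 : s ^ 2 * (1 - α1 y - α2 y) ≤ s ^ 2 := by nlinarith [n1 y, n2 y, sq_nonneg s]
  have f4 : W1 y * α1 y + W2 y * α2 y + s ^ 2 * (1 - α1 y - α2 y) ≤ W1 y + W2 y + t ^ 2 := by linarith
  have f5 := mul_le_mul_of_nonneg_right f4 (sq_nonneg (u y))
  simp only
  linarith

lemma jsig {q0 q1 : ℝ} (h0 : 0 < q0) (hq : q0 < q1) : ∃ (j j1 σ : ℝ → ℝ) (c : ℝ),
    (∀ q, HasDerivAt j (j1 q) q) ∧ (∀ q, HasDerivAt σ (-(q * j1 q)) q) ∧ Continuous j1 ∧ (∀ q, 0 ≤ j1 q) ∧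
    (∀ q, 0 ≤ j q ∧ j q ≤ 1) ∧ (∀ q, q ≤ q0 → j q = 0 ∧ σ q = c) ∧ (∀ q, q1 ≤ q → j q = 1 ∧ σ q = 0) ∧
    (∀ q, 0 ≤ q → 0 ≤ σ q ∧ σ q ≤ c) ∧ q0 ≤ c ∧ c ≤ q1 := by
  let j : ℝ → ℝ := fun q => Real.smoothTransition ((q - q0) / (q1 - q0))
  have hd : 0 < q1 - q0 := by linarith
  have hj : ContDiff ℝ 1 j := Real.smoothTransition.contDiff.comp ((contDiff_id.sub contDiff_const).div_const _)
  have hmono : Monotone j := fun a b hab => Real.smoothTransition.monotone (by gcongr)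
  have ja : ∀ q, q1 ≤ q → j q = 1 := fun q h => Real.smoothTransition.one_of_one_le (by
    rw [le_div_iff₀ hd]; linarith)
  have jb : ∀ q, q ≤ q0 → j q = 0 := fun q h => Real.smoothTransition.zero_of_nonpos
    (div_nonpos_of_nonpos_of_nonneg (by linarith) hd.le)
  have j01 : ∀ q, 0 ≤ j q ∧ j q ≤ 1 := fun q => ⟨Real.smoothTransition.nonneg _, Real.smoothTransition.le_one _⟩
  have hD : ∀ q, HasDerivAt j (deriv j q) q := fun q => (hj.differentiable (by norm_num) q).hasDerivAt
  have hc : Continuous (deriv j) := hj.continuous_deriv (by norm_num)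
  have hn : ∀ q, 0 ≤ deriv j q := fun q => hmono.deriv_nonneg
  have ka : ∀ q, q1 ≤ q → deriv j q = 0 := fun q h =>
    IsLocalMax.deriv_eq_zero (Eventually.of_forall fun y => by rw [ja q h]; exact (j01 y).2)
  have kb : ∀ q, q ≤ q0 → deriv j q = 0 := fun q h =>
    IsLocalMin.deriv_eq_zero (Eventually.of_forall fun y => by rw [jb q h]; exact (j01 y).1)
  let σ : ℝ → ℝ := fun q => - ∫ t in q1..q, t * deriv j t
  have hcc : Continuous (fun t => t * deriv j t) := by fun_prop
  have hσ : ∀ q, HasDerivAt σ (-(q * deriv j q)) q := by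
    intro q
    exact (intervalIntegral.integral_hasDerivAt_right (hcc.intervalIntegrable _ _)
      (hcc.stronglyMeasurableAtFilter _ _) hcc.continuousAt).neg
  have sa : ∀ q, q1 ≤ q → σ q = 0 := by
    intro q h
    simp only [σ]
    rw [intervalIntegral.integral_congr (g := fun _ => (0:ℝ))]
    · simp
    · intro t ht
      rw [Set.uIcc_of_le h] at ht
      simp [ka t ht.1]
  have sb : ∀ q, q ≤ q0 → σ q = σ q0 := by
    intro q h
    have : σ q - σ q0 = ∫ t in q..q0, t * deriv j t := by
      simp only [σ]
      rw [← intervalIntegral.integral_add_adjacent_intervals (hcc.intervalIntegrable q1 q) (hcc.intervalIntegrable q q0)]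
      ring
    rw [intervalIntegral.integral_congr (g := fun _ => (0:ℝ))] at this
    · simp at this; linarith
    · intro t ht
      rw [Set.uIcc_of_le h] at ht
      simp [kb t ht.2]
  have anti : AntitoneOn σ (Set.Ici 0) := by
    refine antitoneOn_of_deriv_nonpos (convex_Ici 0) (fun q _ => (hσ q).continuousAt.continuousWithinAt)
      (fun q _ => (hσ q).differentiableAt.differentiableWithinAt) ?_
    intro q hq
    rw [interior_Ici] at hq
    rw [(hσ q).deriv]
    have := mul_nonneg (le_of_lt hq) (hn q)
    linarith
  have c1 : q0 ≤ σ q0 := by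
    have : AntitoneOn (fun q => σ q + q0 * j q) (Set.Icc q0 q1) := by
      have hh : ∀ q, HasDerivAt (fun q => σ q + q0 * j q) (-(q * deriv j q) + q0 * deriv j q) q := fun q =>
        (hσ q).add ((hD q).const_mul q0)
      refine antitoneOn_of_deriv_nonpos (convex_Icc _ _) (fun q _ => (hh q).continuousAt.continuousWithinAt)
        (fun q _ => (hh q).differentiableAt.differentiableWithinAt) ?_
      intro q hq
      rw [interior_Icc] at hq
      rw [(hh q).deriv]
      nlinarith [hn q, hq.1]
    have := this (Set.left_mem_Icc.2 hq.le) (Set.right_mem_Icc.2 hq.le) hq.le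
    simp only [ja q1 le_rfl, sa q1 le_rfl, jb q0 le_rfl] at this
    linarith
  have c2 : σ q0 ≤ q1 := by
    have : MonotoneOn (fun q => σ q + q1 * j q) (Set.Icc q0 q1) := by
      have hh : ∀ q, HasDerivAt (fun q => σ q + q1 * j q) (-(q * deriv j q) + q1 * deriv j q) q := fun q =>
        (hσ q).add ((hD q).const_mul q1)
      refine monotoneOn_of_deriv_nonneg (convex_Icc _ _) (fun q _ => (hh q).continuousAt.continuousWithinAt)
        (fun q _ => (hh q).differentiableAt.differentiableWithinAt) ?_
      intro q hq
      rw [interior_Icc] at hq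
      rw [(hh q).deriv]
      nlinarith [hn q, hq.2]
    have := this (Set.left_mem_Icc.2 hq.le) (Set.right_mem_Icc.2 hq.le) hq.le
    simp only [ja q1 le_rfl, sa q1 le_rfl, jb q0 le_rfl] at this
    linarith
  refine ⟨j, deriv j, σ, σ q0, hD, hσ, hc, hn, j01, fun q h => ⟨jb q h, sb q h⟩, fun q h => ⟨ja q h, sa q h⟩, ?_, c1, c2⟩
  intro q h
  constructor
  · have := anti (show (0:ℝ) ≤ q from h) (show (0:ℝ) ≤ max q q1 from h.trans (le_max_left _ _)) (le_max_left q q1)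
    rw [sa _ (le_max_right _ _)] at this
    exact this
  · have := anti (show (0:ℝ) ≤ 0 from le_rfl) (show (0:ℝ) ≤ q from h) h
    rw [sb 0 h0.le] at this
    exact this

lemma piece_cd {p : E3} {η ε a c : ℝ} (hη : 0 < η) (hηε : 2 * η ≤ ε) (f : E3 → ℝ)
    (hin : ∀ y, η ≤ ‖y - p‖ → ‖y - p‖ ≤ 2 * η → f y = a)
    (hout : ∀ y, ε ≤ ‖y - p‖ → ‖y - p‖ < 2 * ε → f y = c) :
    ∃ F : E3 → ℝ, (∀ y, ‖y - p‖ < 2 * η → F y = a) ∧ (∀ y, ε ≤ ‖y - p‖ → F y = c) ∧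
      (∀ y, F y = a ∨ F y = c ∨ (η < ‖y - p‖ ∧ ‖y - p‖ < 2 * ε ∧ F y = f y)) ∧
      (∀ y, (‖y - p‖ < 2 * η ∧ F =ᶠ[𝓝 y] fun _ => a) ∨ (2 * ε ≤ ‖y - p‖ ∧ F =ᶠ[𝓝 y] fun _ => c) ∨
      (2 * η ≤ ‖y - p‖ ∧ ‖y - p‖ < 2 * ε ∧ F =ᶠ[𝓝 y] f)) := by
  let α : E3 → ℝ := fun y => if ‖y - p‖ < 2 * η then a else if ‖y - p‖ < 2 * ε then f y else c
  have a1 : ∀ y, ‖y - p‖ < 2 * η → α y = a := fun y h => if_pos h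
  have a2 : ∀ y, η ≤ ‖y - p‖ → ‖y - p‖ < 2 * ε → α y = f y := by
    intro y h1 h2
    by_cases h : ‖y - p‖ < 2 * η
    · rw [a1 y h, hin y h1 h.le]
    · simp only [α, if_neg h, if_pos h2]
  have a3 : ∀ y, ε ≤ ‖y - p‖ → α y = c := by
    intro y h
    by_cases h2 : ‖y - p‖ < 2 * ε
    · rw [a2 y (by linarith) h2, hout y h h2]
    · simp only [α, if_neg h2, if_neg (show ¬ ‖y - p‖ < 2 * η by linarith)]
  have cn : Continuous (fun y : E3 => ‖y - p‖) := by fun_prop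
  refine ⟨α, a1, a3, ?_, ?_⟩
  · intro y
    by_cases h1 : ‖y - p‖ < 2 * η
    · exact Or.inl (a1 y h1)
    by_cases h2 : ‖y - p‖ < 2 * ε
    · exact Or.inr (Or.inr ⟨by linarith, h2, a2 y (by linarith) h2⟩)
    · exact Or.inr (Or.inl (a3 y (by linarith)))
  · intro y
    by_cases h1 : ‖y - p‖ < 2 * η
    · left
      refine ⟨h1, ?_⟩
      filter_upwards [(isOpen_Iio.preimage cn).mem_nhds h1] with z hz using a1 z hz
    by_cases h2 : ‖y - p‖ < 2 * ε
    · right; right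
      refine ⟨by linarith, h2, ?_⟩
      have hy : η < ‖y - p‖ := by linarith
      filter_upwards [(isOpen_Iio.preimage cn).mem_nhds h2, (isOpen_Ioi.preimage cn).mem_nhds hy] with z hz hz'
      exact a2 z (le_of_lt hz') hz
    · right; left
      refine ⟨by linarith, ?_⟩
      have hy : ε < ‖y - p‖ := by linarith
      filter_upwards [(isOpen_Ioi.preimage cn).mem_nhds hy] with z hz'
      exact a3 z (le_of_lt hz')

lemma alsig {p : E3} {A B : E3 → ℝ} {η ε q0 q1 c : ℝ} {j j1 σ : ℝ → ℝ} (hη : 0 < η) (hηε : 2 * η ≤ ε)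
    (hj : ∀ q, HasDerivAt j (j1 q) q) (hσ : ∀ q, HasDerivAt σ (-(q * j1 q)) q) (hjc : Continuous j1) (hj1 : ∀ q, 0 ≤ j1 q)
    (j01 : ∀ q, 0 ≤ j q ∧ j q ≤ 1) (jb : ∀ q, q ≤ q0 → j q = 0 ∧ σ q = c) (ja : ∀ q, q1 ≤ q → j q = 1 ∧ σ q = 0)
    (σ01 : ∀ q, 0 ≤ q → 0 ≤ σ q ∧ σ q ≤ c) (hc0 : 0 ≤ c)
    (cA : ContDiff ℝ 1 A) (posA : ∀ y, 0 < A y)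
    (cB : ∀ y, y ≠ p → ‖y - p‖ < 2 * ε → ContDiffAt ℝ 1 B y) (posB : ∀ y, y ≠ p → ‖y - p‖ < 2 * ε → 0 < B y)
    (hin : ∀ y, η ≤ ‖y - p‖ → ‖y - p‖ ≤ 2 * η → q1 ≤ A y / B y)
    (hout : ∀ y, ε ≤ ‖y - p‖ → ‖y - p‖ < 2 * ε → A y / B y ≤ q0) :
    ∃ α S : E3 → ℝ, ContDiff ℝ 1 α ∧ ContDiff ℝ 1 S ∧ (∀ y, 0 ≤ α y ∧ α y ≤ 1) ∧ (∀ y, 0 ≤ S y ∧ S y ≤ c) ∧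
      (∀ y, ‖y - p‖ < 2 * η → α y = 1 ∧ S y = 0) ∧ (∀ y, ε ≤ ‖y - p‖ → α y = 0 ∧ S y = c) ∧
      ∀ y, y ≠ p → A y • gradient α y + B y • gradient S y = 0 ∧
        0 ≤ inner ℝ (gradient A y) (gradient α y) + inner ℝ (gradient B y) (gradient S y) := by
  obtain ⟨α, a1, a2, a3, a4⟩ := piece_cd (p := p) (a := 1) (c := 0) hη hηε (fun y => j (A y / B y)) (fun y h1 h2 => (ja _ (hin y h1 h2)).1)
    (fun y h1 h2 => (jb _ (hout y h1 h2)).1)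
  obtain ⟨S, s1, s2, s3, s4⟩ := piece_cd (p := p) (a := 0) (c := c) hη hηε (fun y => σ (A y / B y)) (fun y h1 h2 => (ja _ (hin y h1 h2)).2)
    (fun y h1 h2 => (jb _ (hout y h1 h2)).2)
  have ne_of : ∀ y, η < ‖y - p‖ → y ≠ p := by
    rintro y h rfl
    simp at h; linarith
  have jcd : ContDiff ℝ 1 j := cd1_of hj hjc
  have scd : ContDiff ℝ 1 σ := cd1_of hσ (by fun_prop)
  refine ⟨α, S, ?_, ?_, ?_, ?_, fun y h => ⟨a1 y h, s1 y h⟩, fun y h => ⟨a2 y h, s2 y h⟩, ?_⟩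
  · refine contDiff_iff_contDiffAt.2 fun y => ?_
    rcases a4 y with ⟨-, h⟩ | ⟨-, h⟩ | ⟨h1, h2, h⟩
    · exact contDiffAt_const.congr_of_eventuallyEq h
    · exact contDiffAt_const.congr_of_eventuallyEq h
    · refine ContDiffAt.congr_of_eventuallyEq ?_ h
      have hn := ne_of y (by linarith)
      exact jcd.contDiffAt.comp y (cA.contDiffAt.div (cB y hn h2) (posB y hn h2).ne')
  · refine contDiff_iff_contDiffAt.2 fun y => ?_
    rcases s4 y with ⟨-, h⟩ | ⟨-, h⟩ | ⟨h1, h2, h⟩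
    · exact contDiffAt_const.congr_of_eventuallyEq h
    · exact contDiffAt_const.congr_of_eventuallyEq h
    · refine ContDiffAt.congr_of_eventuallyEq ?_ h
      have hn := ne_of y (by linarith)
      exact scd.contDiffAt.comp y (cA.contDiffAt.div (cB y hn h2) (posB y hn h2).ne')
  · intro y
    rcases a3 y with h | h | ⟨-, -, h⟩
    · rw [h]; norm_num
    · rw [h]; norm_num
    · rw [h]; exact j01 _
  · intro y
    rcases s3 y with h | h | ⟨h1, h2, h⟩
    · rw [h]; exact ⟨le_rfl, hc0⟩
    · rw [h]; exact ⟨hc0, le_rfl⟩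
    · rw [h]
      exact σ01 _ (div_nonneg (posA y).le (posB y (ne_of y h1) h2).le)
  · intro y hy
    have triv : ∀ {a c : ℝ}, (α =ᶠ[𝓝 y] fun _ => a) → (S =ᶠ[𝓝 y] fun _ => c) → A y • gradient α y + B y • gradient S y = 0 ∧
        0 ≤ inner ℝ (gradient A y) (gradient α y) + inner ℝ (gradient B y) (gradient S y) := by
      intro a c h h'
      rw [((hasGradientAt_const y a).congr_of_eventuallyEq h).gradient, ((hasGradientAt_const y c).congr_of_eventuallyEq h').gradient]
      simp
    rcases a4 y with ⟨k1, h⟩ | ⟨k1, h⟩ | ⟨h1, h2, h⟩ <;> rcases s4 y with ⟨k2, h'⟩ | ⟨k2, h'⟩ | ⟨h1', h2', h'⟩ <;> try linarith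
    · exact triv h h'
    · exact triv h h'
    · have hn := ne_of y (by linarith)
      have pB := posB y hn h2
      have gB : HasGradientAt B (gradient B y) y := ((cB y hn h2).differentiableAt (by norm_num)).hasGradientAt
      have hB := hg_comp (f := B) (hasDerivAt_inv pB.ne') gB
      have hAB := hg_mul (C1.hg cA y) hB
      have hF := hg_comp (f := fun y => A y * (B y)⁻¹) (hj _) hAB
      have hG := hg_comp (f := fun y => A y * (B y)⁻¹) (hσ _) hAB
      rw [(hF.congr_of_eventuallyEq (show α =ᶠ[𝓝 y] _ by simpa only [div_eq_mul_inv] using h)).gradient,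
        (hG.congr_of_eventuallyEq (show S =ᶠ[𝓝 y] _ by simpa only [div_eq_mul_inv] using h')).gradient]
      obtain ⟨Z, hZ⟩ : ∃ Z, Z = A y • -(B y ^ 2)⁻¹ • gradient B y + (B y)⁻¹ • gradient A y := ⟨_, rfl⟩
      have hgA : gradient A y = B y • Z + (A y * (B y)⁻¹) • gradient B y := by
        rw [hZ, smul_add, smul_smul, smul_smul, smul_smul, mul_inv_cancel₀ pB.ne', one_smul,
          show B y * A y * -(B y ^ 2)⁻¹ = -(A y * (B y)⁻¹) by field_simp, neg_smul]
        abel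
      rw [← hZ]
      constructor
      · rw [smul_smul, smul_smul, ← add_smul]
        rw [show A y * j1 (A y * (B y)⁻¹) + B y * -(A y * (B y)⁻¹ * j1 (A y * (B y)⁻¹)) = 0 by field_simp; ring, zero_smul]
      · rw [hgA]
        simp only [inner_add_left, real_inner_smul_left, real_inner_smul_right, real_inner_self_eq_norm_sq]
        have := mul_nonneg (mul_nonneg pB.le (hj1 (A y * (B y)⁻¹))) (sq_nonneg ‖Z‖)
        linarith

lemma upper_glue {p1 p2 : E3} {W1 W2 A1 A2 α1 α2 B β u : E3 → ℝ} {k : ℝ}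
    (cA1 : ContDiff ℝ 1 A1) (cA2 : ContDiff ℝ 1 A2)
    (wk1 : WeakSol W1 A1) (wk2 : WeakSol W2 A2)
    (cα1 : ContDiff ℝ 1 α1) (cα2 : ContDiff ℝ 1 α2) (cβ : ContDiff ℝ 1 β)
    (nβ : ∀ y, 0 ≤ β y) (v1 : VanNear β p1) (v2 : VanNear β p2)
    (cB : ∀ y, y ≠ p1 → y ≠ p2 → ContDiffAt ℝ 1 B y)
    (eqn : ∀ y, y ≠ p1 → y ≠ p2 → A1 y • gradient α1 y + A2 y • gradient α2 y + B y • gradient β y = 0)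
    (cvx : ∀ y, y ≠ p1 → y ≠ p2 → 0 ≤ inner ℝ (gradient A1 y) (gradient α1 y) + inner ℝ (gradient A2 y) (gradient α2 y) +
      inner ℝ (gradient B y) (gradient β y))
    (wkB : ∀ w, C1c w → (∀ y, 0 ≤ w y) → VanNear w p1 → VanNear w p2 → Integrable (fun y => inner ℝ (gradient B y) (gradient w y)) ∧
      ∫ y, inner ℝ (gradient B y) (gradient w y) ≤ - ∫ y, k * B y * w y)
    (hu : C1c u) (pu : ∀ y, 0 ≤ u y) (eu : ∀ y, u y = A1 y * α1 y + A2 y * α2 y + B y * β y) :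
    ∫ y, ‖gradient u y‖ ^ 2 ≤ - (∫ y, W1 y * A1 y * (α1 y * u y)) - (∫ y, W2 y * A2 y * (α2 y * u y)) - ∫ y, k * B y * (β y * u y) := by
  have t1 : C1c (fun y => α1 y * u y) := C1c.mul cα1 hu
  have t2 : C1c (fun y => α2 y * u y) := C1c.mul cα2 hu
  have t3 : C1c (fun y => β y * u y) := C1c.mul cβ hu
  have w1 : VanNear (fun y => β y * u y) p1 := by
    filter_upwards [v1] with y hy
    rw [hy, zero_mul]
  have w2 : VanNear (fun y => β y * u y) p2 := by
    filter_upwards [v2] with y hy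
    rw [hy, zero_mul]
  obtain ⟨i3, e3⟩ := wkB _ t3 (fun y => mul_nonneg (nβ y) (pu y)) w1 w2
  have e1 := wk1 _ t1
  have e2 := wk2 _ t2
  have i1 := t1.int_grad_inner (C1.cont_grad cA1)
  have i2 := t2.int_grad_inner (C1.cont_grad cA2)
  have j1 : Integrable (fun y => ‖gradient u y‖ ^ 2) := hu.int_grad_sq
  have key : ∫ y, ‖gradient u y‖ ^ 2 ≤ (∫ y, inner ℝ (gradient A1 y) (gradient (fun y => α1 y * u y) y))
      + (∫ y, inner ℝ (gradient A2 y) (gradient (fun y => α2 y * u y) y))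
      + (∫ y, inner ℝ (gradient B y) (gradient (fun y => β y * u y) y)) := by
    rw [← integral_add i1 i2, ← integral_add (by exact i1.add i2) i3]
    refine integral_mono_ae j1 (by exact (i1.add i2).add i3) ?_
    filter_upwards [ae_ne p1, ae_ne p2] with y h1 h2
    have gB : HasGradientAt B (gradient B y) y := ((cB y h1 h2).differentiableAt (by norm_num)).hasGradientAt
    have hgu := C1.hg hu.1 y
    rw [(hg_mul (C1.hg cα1 y) hgu).gradient, (hg_mul (C1.hg cα2 y) hgu).gradient, (hg_mul (C1.hg cβ y) hgu).gradient]
    have gu : gradient u y = α1 y • gradient A1 y + α2 y • gradient A2 y + β y • gradient B y := by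
      have x1 := hg_add (hg_add (hg_mul (C1.hg cA1 y) (C1.hg cα1 y)) (hg_mul (C1.hg cA2 y) (C1.hg cα2 y))) (hg_mul gB (C1.hg cβ y))
      have x2 := x1.gradient
      rw [← (funext eu : u = fun y => A1 y * α1 y + A2 y * α2 y + B y * β y)] at x2
      rw [x2, ← sub_eq_zero, ← eqn y h1 h2]
      abel
    have c := mul_nonneg (pu y) (cvx y h1 h2)
    have nn : ‖gradient u y‖ ^ 2 = α1 y * inner ℝ (gradient A1 y) (gradient u y) + α2 y * inner ℝ (gradient A2 y) (gradient u y)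
        + β y * inner ℝ (gradient B y) (gradient u y) := by
      have := congrArg (fun z => inner ℝ z (gradient u y)) gu
      simp only [inner_add_left, real_inner_smul_left, real_inner_self_eq_norm_sq] at this
      exact this
    rw [nn]
    simp only [inner_add_right, real_inner_smul_right]
    linarith
  linarith

lemma maxpow (n : ℕ) (x : ℝ) : HasDerivAt (fun x : ℝ => (max x 0) ^ (n + 2)) (((n + 2 : ℕ) : ℝ) * (max x 0) ^ (n + 1)) x := by
  rcases lt_trichotomy x 0 with h | h | h
  · have : (fun x : ℝ => (max x 0) ^ (n + 2)) =ᶠ[𝓝 x] fun _ => 0 := by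
      filter_upwards [Iio_mem_nhds h] with z hz
      rw [max_eq_right (le_of_lt hz)]; simp
    refine ((hasDerivAt_const x (0:ℝ)).congr_of_eventuallyEq this).congr_deriv ?_
    rw [max_eq_right h.le]; simp
  · subst h
    have : HasFDerivAt (fun x : ℝ => (max x 0) ^ (n + 2)) (0 : ℝ →L[ℝ] ℝ) 0 := by
      refine Asymptotics.IsBigO.hasFDerivAt (n := n + 2) ?_ (by omega)
      refine Asymptotics.IsBigO.of_bound 1 (Eventually.of_forall fun x => ?_)
      rw [sub_zero, one_mul, norm_pow, norm_pow, norm_norm]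
      gcongr
      rw [Real.norm_eq_abs, Real.norm_eq_abs, abs_of_nonneg (le_max_right _ _)]
      exact max_le (le_abs_self _) (abs_nonneg _)
    have := this.hasDerivAt
    refine this.congr_deriv ?_
    simp
  · have : (fun x : ℝ => (max x 0) ^ (n + 2)) =ᶠ[𝓝 x] fun x => x ^ (n + 2) := by
      filter_upwards [Ioi_mem_nhds h] with z hz
      rw [max_eq_left (le_of_lt hz)]
    refine ((hasDerivAt_pow (n + 2) x).congr_of_eventuallyEq this).congr_deriv ?_
    rw [max_eq_left h.le]; simp

/-- profile functions -/
structure GF (g g1 g2 : ℝ → ℝ) (k L : ℝ) : Prop where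
  d1 : ∀ r, HasDerivAt g (g1 r) r
  d2 : ∀ r, HasDerivAt g1 (g2 r) r
  c2 : Continuous g2
  sub : ∀ r, 0 ≤ r → k * g r ≤ g2 r
  kpos : 0 < k
  Lpos : 0 < L
  zero : ∀ r, L ≤ r → g r = 0
  nonneg : ∀ r, 0 ≤ g r
  le1 : ∀ r, 0 ≤ r → g r ≤ 1
  anti : Antitone g
  pos : ∀ r, r ≤ 2 → 0 < g r
  g0 : g 0 = 1
  slope : 0 < g1 0 + g 1

lemma gfun {s κ : ℝ} (hs : 0 < s) (hs1 : s < 1) (he : s < Real.exp (-s)) (hκ : κ < s ^ 2) :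
    ∃ g g1 g2 k L, κ < k ∧ GF g g1 g2 k L := by
  have t1 : Tendsto (fun n : ℕ => (1 + (-s) / (n:ℝ)) ^ n) atTop (𝓝 (Real.exp (-s))) := Real.tendsto_one_add_div_pow_exp (-s)
  have t2 : Tendsto (fun n : ℕ => s ^ 2 * (1 - 1 / (n:ℝ))) atTop (𝓝 (s ^ 2 * (1 - 0))) :=
    (tendsto_const_nhds.sub tendsto_one_div_atTop_nhds_zero_nat).const_mul _
  rw [sub_zero, mul_one] at t2
  obtain ⟨m, h1, h2, h3⟩ := ((t1.eventually_const_lt he).and ((t2.eventually_const_lt hκ).and (eventually_ge_atTop 3))).exists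
  obtain ⟨n, rfl⟩ : ∃ n, m = n + 3 := ⟨m - 3, by omega⟩
  obtain ⟨m, hm⟩ : ∃ m : ℝ, m = ((n + 3 : ℕ) : ℝ) := ⟨_, rfl⟩
  have hm3 : 3 ≤ m := by rw [hm]; exact_mod_cast h3
  have hm0 : 0 < m := by linarith
  rw [← hm] at h1 h2
  have hl : ∀ r, HasDerivAt (fun r : ℝ => 1 - s / m * r) (-(s / m)) r := by
    intro r
    have := ((hasDerivAt_id r).const_mul (s / m)).const_sub 1
    simpa using this
  have hsm : 0 < s / m := by positivity
  have hmx : ∀ r : ℝ, 0 ≤ r → max (1 - s / m * r) 0 ≤ 1 := fun r h => max_le (by nlinarith) (by norm_num)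
  have hmn : ∀ r : ℝ, 0 ≤ max (1 - s / m * r) 0 := fun r => le_max_right _ _
  have hm1 : ((n + 1 + 1 : ℕ) : ℝ) = m - 1 := by rw [hm]; push_cast; ring
  have hkk : 0 < s ^ 2 * (1 - 1 / m) := by
    have : 1 / m < 1 := by rw [div_lt_one hm0]; linarith
    have : 0 < 1 - 1 / m := by linarith
    positivity
  refine ⟨fun r => (max (1 - s / m * r) 0) ^ (n + 3), fun r => -s * (max (1 - s / m * r) 0) ^ (n + 2),
    fun r => s ^ 2 * (1 - 1 / m) * (max (1 - s / m * r) 0) ^ (n + 1), s ^ 2 * (1 - 1 / m), m / s, h2, ?_⟩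
  refine ⟨?_, ?_, by fun_prop, ?_, hkk, by positivity, ?_, ?_, ?_, ?_, ?_, by simp, ?_⟩
  · intro r
    have := (maxpow (n + 1) (1 - s / m * r)).comp r (hl r)
    refine this.congr_deriv ?_
    rw [show ((n + 1 + 2 : ℕ) : ℝ) = m by rw [hm]]
    field_simp
  · intro r
    have := ((maxpow n (1 - s / m * r)).comp r (hl r)).const_mul (-s)
    refine this.congr_deriv ?_
    rw [show ((n + 2 : ℕ) : ℝ) = m - 1 by rw [hm]; push_cast; ring]
    field_simp
  · intro r hr
    refine mul_le_mul_of_nonneg_left ?_ hkk.le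
    exact pow_le_pow_of_le_one (hmn r) (hmx r hr) (by omega)
  · intro r hr
    rw [max_eq_right, zero_pow (by omega)]
    have : s / m * (m / s) ≤ s / m * r := by gcongr
    have e : s / m * (m / s) = 1 := by field_simp
    linarith
  · exact fun r => pow_nonneg (hmn r) _
  · exact fun r hr => pow_le_one₀ (hmn r) (hmx r hr)
  · intro a b hab
    simp only
    gcongr
  · intro r hr
    have : 0 < 1 - s / m * r := by
      have h5 : s / m ≤ 1 / 3 := by
        rw [div_le_div_iff₀ hm0 (by norm_num)]; linarith
      nlinarith
    have : 0 < max (1 - s / m * r) 0 := lt_max_of_lt_left this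
    positivity
  · simp only [mul_zero, sub_zero, mul_one]
    rw [max_eq_left (by norm_num : (0:ℝ) ≤ 1), one_pow, max_eq_left]
    · rw [show (1:ℝ) - s / m = 1 + -s / m by ring]; linarith
    · have : s / m ≤ 1 := by rw [div_le_one hm0]; linarith
      linarith

lemma kappa2 {g g1 g2 : ℝ → ℝ} {k L : ℝ} (G : GF g g1 g2 k L) :
    ∃ δ ε : ℝ, 0 < δ ∧ 0 < ε ∧ ε < 1 / 4 ∧ ∀ r, 0 < r → r < 2 * ε → 1 + δ * r ≤ g r + r * (g (1 + r) / (1 + r)) := by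
  have h1 : HasDerivAt (fun r : ℝ => g r + r * (g (1 + r) / (1 + r))) (g1 0 + g 1) 0 := by
    have hd : Differentiable ℝ g := fun r => (G.d1 r).differentiableAt
    have a2 : DifferentiableAt ℝ (fun r : ℝ => g (1 + r) / (1 + r)) 0 := by
      refine DifferentiableAt.div (by fun_prop) (by fun_prop) (by norm_num)
    have a3 := (G.d1 0).add ((hasDerivAt_id (0:ℝ)).mul a2.hasDerivAt)
    refine a3.congr_deriv ?_
    simp
  rw [hasDerivAt_iff_isLittleO] at h1
  have hsl := G.slope
  have h2 := h1.bound (show 0 < (g1 0 + g 1) / 2 by linarith)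
  obtain ⟨δ, hδ, h3⟩ := Metric.eventually_nhds_iff.1 h2
  refine ⟨(g1 0 + g 1) / 2, min (δ / 2) (1 / 5), by linarith, by positivity, ?_, ?_⟩
  · exact (min_le_right _ _).trans_lt (by norm_num)
  · intro r h0 hr
    have : r < δ := by linarith [min_le_left (δ / 2) (1 / 5)]
    have := h3 (y := r) (by simpa [abs_of_pos h0] using this)
    simp only [Real.norm_eq_abs, sub_zero, abs_of_pos h0, smul_eq_mul, G.g0, zero_mul, add_zero] at this
    have := (abs_le.1 this).1
    linarith

lemma yk_int {h : ℝ → ℝ} (hh : Continuous h) {w : E3 → ℝ} (hw : C1c w) {a : E3} (hv : VanNear w a) :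
    Integrable (fun y => h ‖y - a‖ / ‖y - a‖ * w y) := by
  refine Continuous.integrable_of_hasCompactSupport (continuous_iff_continuousAt.2 fun y => ?_) hw.2.mul_left
  by_cases hy : y = a
  · subst hy
    refine continuousAt_const.congr (f := fun _ => (0:ℝ)) ?_
    filter_upwards [hv] with z hz
    rw [hz, mul_zero]
  · have hp : 0 < ‖y - a‖ := norm_pos_iff.2 (sub_ne_zero.2 hy)
    have hwc := hw.1.continuous
    exact ((by fun_prop : ContinuousAt (fun y => h ‖y - a‖) y).div (by fun_prop) hp.ne').mul hwc.continuousAt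

lemma GF.wk {g g1 g2 : ℝ → ℝ} {k L : ℝ} (G : GF g g1 g2 k L) {p q : E3} {w : E3 → ℝ} (hw : C1c w) (hw0 : ∀ y, 0 ≤ w y)
    (v1 : VanNear w p) (v2 : VanNear w q) :
    Integrable (fun y => inner ℝ (gradient (fun y => Yk g p y + Yk g q y) y) (gradient w y)) ∧
      ∫ y, inner ℝ (gradient (fun y => Yk g p y + Yk g q y) y) (gradient w y) ≤ - ∫ y, k * (Yk g p y + Yk g q y) * w y := by
  obtain ⟨i1, e1⟩ := Yk_weak G.d1 G.d2 G.c2 hw v1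
  obtain ⟨i2, e2⟩ := Yk_weak G.d1 G.d2 G.c2 hw v2
  have hae : (fun y => inner ℝ (gradient (fun y => Yk g p y + Yk g q y) y) (gradient w y))
      =ᵐ[volume] fun y => inner ℝ (gradient (Yk g p) y) (gradient w y) + inner ℝ (gradient (Yk g q) y) (gradient w y) := by
    filter_upwards [ae_ne p, ae_ne q] with y h1 h2
    rw [(hg_add (Yk_hg h1 (G.d1 _)) (Yk_hg h2 (G.d1 _))).gradient, inner_add_left, (Yk_hg h1 (G.d1 _)).gradient, (Yk_hg h2 (G.d1 _)).gradient]
  refine ⟨(i1.add i2).congr hae.symm, ?_⟩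
  have cg : Continuous g := continuous_iff_continuousAt.2 fun r => (G.d1 r).continuousAt
  have l1 := yk_int G.c2 hw v1
  have l2 := yk_int G.c2 hw v2
  have m1 := yk_int cg hw v1
  have m2 := yk_int cg hw v2
  rw [integral_congr_ae hae, integral_add i1 i2, e1, e2, ← neg_add, ← integral_add l1 l2]
  refine neg_le_neg (integral_mono (((m1.add m2).const_mul k).congr (Eventually.of_forall fun y => ?_)) (by exact l1.add l2) fun y => ?_)
  · simp only [Pi.add_apply, Yk]; ring
  · simp only [Yk]
    have : ∀ a : E3, k * (g ‖y - a‖ / ‖y - a‖) * w y ≤ g2 ‖y - a‖ / ‖y - a‖ * w y := by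
      intro a
      have := G.sub ‖y - a‖ (norm_nonneg _)
      refine mul_le_mul_of_nonneg_right ?_ (hw0 y)
      rw [← mul_div_assoc]
      gcongr
    have z1 := this p
    have z2 := this q
    linarith

lemma GF.Yn {g g1 g2 : ℝ → ℝ} {k L : ℝ} (G : GF g g1 g2 k L) (a y : E3) : 0 ≤ Yk g a y :=
  div_nonneg (G.nonneg _) (norm_nonneg _)

lemma far_tri {p q : E3} (hpq : ‖q - p‖ = 1) (y : E3) : 1 - ‖y - p‖ ≤ ‖y - q‖ ∧ ‖y - q‖ ≤ 1 + ‖y - p‖ := by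
  have h1 : ‖q - p‖ ≤ ‖y - p‖ + ‖y - q‖ := by
    rw [show q - p = (y - p) - (y - q) by abel]; exact norm_sub_le _ _
  have h2 : ‖y - q‖ ≤ ‖y - p‖ + ‖q - p‖ := by
    rw [show y - q = (y - p) - (q - p) by abel]; exact norm_sub_le _ _
  constructor <;> linarith

lemma GF.Bup {g g1 g2 : ℝ → ℝ} {k L : ℝ} (G : GF g g1 g2 k L) {p q : E3} (hpq : ‖q - p‖ = 1) {y : E3}
    (h0 : 0 < ‖y - p‖) (h : ‖y - p‖ ≤ 1 / 2) : ‖y - p‖ * (Yk g p y + Yk g q y) ≤ 1 + 2 * ‖y - p‖ := by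
  have e1 : ‖y - p‖ * Yk g p y = g ‖y - p‖ := by
    simp only [Yk]; field_simp
  have e2 : Yk g q y ≤ 2 := by
    have := (far_tri hpq y).1
    simp only [Yk]
    rw [div_le_iff₀ (by linarith)]
    linarith [G.le1 ‖y - q‖ (norm_nonneg _)]
  have := mul_le_mul_of_nonneg_left e2 h0.le
  rw [mul_add]
  linarith [G.le1 ‖y - p‖ (norm_nonneg _)]

lemma site_up {g g1 g2 : ℝ → ℝ} {k L : ℝ} (G : GF g g1 g2 k L) {δ τ η ε M q0 q1 c : ℝ} {j j1 σ : ℝ → ℝ}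
    (hε : 0 < ε) (hε4 : ε < 1 / 4) (hδ : 0 < δ) (hτ : 0 < τ) (hτ1 : τ < 1) (hη : 0 < η) (hηε : 2 * η ≤ ε)
    (hk : ∀ r, 0 < r → r < 2 * ε → 1 + δ * r ≤ g r + r * (g (1 + r) / (1 + r)))
    (hq0 : q0 = (1 + τ) / (1 + δ * ε)) (hq1 : q1 = (1 - τ) / (1 + 4 * η))
    (hj : ∀ q, HasDerivAt j (j1 q) q) (hσ : ∀ q, HasDerivAt σ (-(q * j1 q)) q) (hjc : Continuous j1) (hj1 : ∀ q, 0 ≤ j1 q)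
    (j01 : ∀ q, 0 ≤ j q ∧ j q ≤ 1) (jb : ∀ q, q ≤ q0 → j q = 0 ∧ σ q = c) (ja : ∀ q, q1 ≤ q → j q = 1 ∧ σ q = 0)
    (σ01 : ∀ q, 0 ≤ q → 0 ≤ σ q ∧ σ q ≤ c) (hc0 : 0 ≤ c)
    {p q : E3} (hpq : ‖q - p‖ = 1) {W A : E3 → ℝ} (S : Site p W A τ η M) :
    ∃ α S : E3 → ℝ, ContDiff ℝ 1 α ∧ ContDiff ℝ 1 S ∧ (∀ y, 0 ≤ α y ∧ α y ≤ 1) ∧ (∀ y, 0 ≤ S y ∧ S y ≤ c) ∧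
      (∀ y, ‖y - p‖ < 2 * η → α y = 1 ∧ S y = 0) ∧ (∀ y, ε ≤ ‖y - p‖ → α y = 0 ∧ S y = c) ∧
      ∀ y, y ≠ p → A y • gradient α y + (Yk g p y + Yk g q y) • gradient S y = 0 ∧
        0 ≤ inner ℝ (gradient A y) (gradient α y) + inner ℝ (gradient (fun y => Yk g p y + Yk g q y) y) (gradient S y) := by
  have cg1 : Continuous g1 := continuous_iff_continuousAt.2 fun r => (G.d2 r).continuousAt
  have hgc : ContDiff ℝ 1 g := cd1_of G.d1 cg1
  have hYp : ∀ y : E3, y ≠ p → ‖y - p‖ < 2 * ε → 0 < Yk g p y := fun y h h' =>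
    div_pos (G.pos _ (by linarith)) (norm_pos_iff.2 (sub_ne_zero.2 h))
  have nq : ∀ y : E3, ‖y - p‖ < 2 * ε → y ≠ q := by
    rintro y h rfl
    linarith
  refine alsig (q0 := q0) (q1 := q1) hη hηε hj hσ hjc hj1 j01 jb ja σ01 hc0 S.cA S.pos ?_ ?_ ?_ ?_
  · exact fun y h1 h2 => (Yk_cd hgc h1).add (Yk_cd hgc (nq y h2))
  · exact fun y h1 h2 => add_pos_of_pos_of_nonneg (hYp y h1 h2) (G.Yn q y)
  · intro y h1 h2
    have hr : 0 < ‖y - p‖ := by linarith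
    have hA := (abs_le.1 (S.farA y h1)).1
    have hB := G.Bup hpq hr (by linarith)
    have hB0 : 0 < Yk g p y + Yk g q y :=
      add_pos_of_pos_of_nonneg (hYp y (by rintro rfl; simp at hr) (by linarith)) (G.Yn q y)
    set B := Yk g p y + Yk g q y
    have hBp : 0 < ‖y - p‖ * B := mul_pos hr hB0
    rw [← mul_div_mul_left (A y) B hr.ne', hq1]
    have : 0 ≤ ‖y - p‖ * A y := mul_nonneg hr.le (S.pos y).le
    exact div_le_div₀ this (by linarith) hBp (by linarith)
  · intro y h1 h2
    have hr : 0 < ‖y - p‖ := by linarith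
    have hA := (abs_le.1 (S.farA y (by linarith))).2
    have hB : 1 + δ * ε ≤ ‖y - p‖ * (Yk g p y + Yk g q y) := by
      have e1 : ‖y - p‖ * Yk g p y = g ‖y - p‖ := by
        simp only [Yk]; field_simp
      have e2 : g (1 + ‖y - p‖) / (1 + ‖y - p‖) ≤ Yk g q y := by
        obtain ⟨h3, h4⟩ := far_tri hpq y
        simp only [Yk]
        exact div_le_div₀ (G.nonneg _) (G.anti h4) (by linarith) h4
      have e3 := mul_le_mul_of_nonneg_left e2 hr.le
      have e4 := hk _ hr h2
      have e5 : δ * ε ≤ δ * ‖y - p‖ := by gcongr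
      rw [mul_add]; linarith
    set B := Yk g p y + Yk g q y
    rw [← mul_div_mul_left (A y) B hr.ne', hq0]
    exact div_le_div₀ (by linarith) (by linarith) (by positivity) hB

set_option maxHeartbeats 1000000 in
lemma core_upper {s κ M : ℝ} (hs : 0 < s) (hs1 : s < 1) (he : s < Real.exp (-s)) (hκ : κ < s ^ 2) (hM : 0 < M) :
    ∃ τ η : ℝ, 0 < τ ∧ 0 < η ∧ ∀ (p q : E3) (W1 W2 A1 A2 : E3 → ℝ), ‖q - p‖ = 1 →
      Site p W1 A1 τ η M → Site q W2 A2 τ η M → ∃ u : E3 → ℝ, C1c u ∧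
      ∫ y, (‖gradient u y‖ ^ 2 + (W1 y + W2 y + κ) * u y ^ 2) < 0 := by
  obtain ⟨g, g1, g2, k, L, hκk, G⟩ := gfun hs hs1 he hκ
  obtain ⟨δ, ε0, hδ, hε0, hε04, hk0⟩ := kappa2 G
  obtain ⟨c0, hc0d⟩ : ∃ c0 : ℝ, c0 = (g 2 / 4) ^ 2 * volume.real (Metric.ball (0 : E3) (1 / 2)) := ⟨_, rfl⟩
  have hc0 : 0 < c0 := by
    have h1 := G.pos 2 le_rfl
    have h2 : 0 < volume.real (Metric.ball (0 : E3) (1 / 2)) :=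
      ENNReal.toReal_pos (Metric.measure_ball_pos volume _ (by norm_num)).ne' measure_ball_lt_top.ne
    rw [hc0d]; positivity
  have hkpos := G.kpos
  have hom := om_pos
  obtain ⟨X, hXd⟩ : ∃ X : ℝ, X = 2 * k * (M * (M + 2)) * om := ⟨_, rfl⟩
  have hX : 0 < X := by rw [hXd]; positivity
  obtain ⟨ε, hε, hεε0, hεδ, hεX⟩ : ∃ ε : ℝ, 0 < ε ∧ ε ≤ ε0 ∧ δ * ε ≤ 1 ∧ X * ε < (k - κ) / 2 * c0 := by
    have hd : 0 < k - κ := by linarith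
    have hz : 0 < (k - κ) / 4 * c0 / X := by positivity
    refine ⟨min ε0 (min (1 / δ) ((k - κ) / 4 * c0 / X)), by positivity, min_le_left _ _, ?_, ?_⟩
    · calc _ ≤ δ * (1 / δ) := by gcongr; exact (min_le_right _ _).trans (min_le_left _ _)
        _ = 1 := by field_simp
    · calc _ ≤ X * ((k - κ) / 4 * c0 / X) := by gcongr; exact (min_le_right _ _).trans (min_le_right _ _)
        _ = (k - κ) / 4 * c0 := by field_simp
        _ < _ := by have := mul_pos hd hc0; linarith
  have hε4 : ε < 1 / 4 := by linarith
  obtain ⟨θ, hθd⟩ : ∃ θ, θ = δ * ε := ⟨_, rfl⟩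
  have hθ : 0 < θ := by rw [hθd]; positivity
  have hθ1 : θ ≤ 1 := by rw [hθd]; exact hεδ
  obtain ⟨τ, hτ, hτ1, hτ2⟩ : ∃ τ, 0 < τ ∧ τ ≤ θ / 8 ∧ 2 * τ ≤ (k - κ) / 2 := by
    have hd : 0 < k - κ := by linarith
    refine ⟨min (θ / 8) ((k - κ) / 4), by positivity, min_le_left _ _, ?_⟩
    linarith [min_le_right (θ / 8) ((k - κ) / 4)]
  obtain ⟨η, hη, hηε, hηθ⟩ : ∃ η, 0 < η ∧ 2 * η ≤ ε ∧ 4 * η ≤ θ / 4 := by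
    refine ⟨min (ε / 2) (θ / 16), by positivity, ?_, ?_⟩
    · linarith [min_le_left (ε / 2) (θ / 16)]
    · linarith [min_le_right (ε / 2) (θ / 16)]
  obtain ⟨q0, hq0⟩ : ∃ q0, q0 = (1 + τ) / (1 + δ * ε) := ⟨_, rfl⟩
  obtain ⟨q1, hq1⟩ : ∃ q1, q1 = (1 - τ) / (1 + 4 * η) := ⟨_, rfl⟩
  have hq0h : 1 / 2 ≤ q0 := by
    rw [hq0, ← hθd, div_le_div_iff₀ (by norm_num) (by linarith)]; linarith
  have hq1h : q1 ≤ 1 := by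
    rw [hq1, div_le_one (by linarith)]; linarith
  have hq : q0 < q1 := by
    rw [hq0, hq1, ← hθd, div_lt_div_iff₀ (by linarith) (by linarith)]
    have h1 : (1 + τ) * (1 + 4 * η) ≤ (1 + θ / 8) * (1 + θ / 4) := by gcongr <;> linarith
    have h2 : (1 - θ / 8) * (1 + θ) ≤ (1 - τ) * (1 + θ) := by gcongr
    nlinarith
  obtain ⟨j, j1, σ, c, hj, hσ, hjc, hj1, j01, jb, ja, σ01, cq0, cq1⟩ := jsig (by linarith) hq
  have hc0' : 0 ≤ c := by linarith
  refine ⟨τ, η, hτ, hη, ?_⟩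
  intro p q W1 W2 A1 A2 hpq T1 T2
  have hpq' : ‖p - q‖ = 1 := by rw [norm_sub_rev]; exact hpq
  have hk : ∀ r, 0 < r → r < 2 * ε → 1 + δ * r ≤ g r + r * (g (1 + r) / (1 + r)) := fun r h h' => hk0 r h (by linarith)
  obtain ⟨α1, S1, ca1, cs1, n1, m1, o1, z1, d1⟩ := site_up G hε hε4 hδ hτ (by linarith) hη hηε hk hq0 hq1 hj hσ hjc hj1 j01 jb ja σ01 hc0' hpq T1
  obtain ⟨α2, S2, ca2, cs2, n2, m2, o2, z2, d2⟩ := site_up G hε hε4 hδ hτ (by linarith) hη hηε hk hq0 hq1 hj hσ hjc hj1 j01 jb ja σ01 hc0' hpq' T2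
  clear hj hσ hjc hj1 j01 jb ja σ01
  simp only [add_comm (Yk g q _)] at d2
  obtain ⟨B, hBd⟩ : ∃ B : E3 → ℝ, B = fun y => Yk g p y + Yk g q y := ⟨_, rfl⟩
  have hBy : ∀ y, Yk g p y + Yk g q y = B y := fun y => by rw [hBd]
  have wkB : ∀ w, C1c w → (∀ y, 0 ≤ w y) → VanNear w p → VanNear w q → Integrable (fun y => inner ℝ (gradient B y) (gradient w y)) ∧
      ∫ y, inner ℝ (gradient B y) (gradient w y) ≤ - ∫ y, k * B y * w y := by
    intro w hw h0 h1 h2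
    have := G.wk hw h0 h1 h2
    rw [hBd]; exact this
  have hgc : ContDiff ℝ 1 g := cd1_of G.d1 (continuous_iff_continuousAt.2 fun r => (G.d2 r).continuousAt)
  have cB : ∀ y, y ≠ p → y ≠ q → ContDiffAt ℝ 1 B y := by
    intro y h1 h2
    rw [hBd]; exact (Yk_cd hgc h1).add (Yk_cd hgc h2)
  have B0 : ∀ y, 0 ≤ B y := fun y => by rw [hBd]; exact add_nonneg (G.Yn p y) (G.Yn q y)
  simp only [hBy] at d1 d2
  have tri := far_tri hpq
  have alt : ∀ y, ε ≤ ‖y - p‖ ∨ ε ≤ ‖y - q‖ := by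
    intro y
    by_cases h : ε ≤ ‖y - p‖
    · exact Or.inl h
    · right; linarith [(tri y).1]
  obtain ⟨β, hβd⟩ : ∃ β : E3 → ℝ, β = fun y => S1 y + S2 y - c := ⟨_, rfl⟩
  have hβy : ∀ y, β y = S1 y + S2 y - c := fun y => by rw [hβd]
  have cβ : ContDiff ℝ 1 β := by rw [hβd]; exact (cs1.add cs2).sub contDiff_const
  have β0 : ∀ y, 0 ≤ β y := by
    intro y
    rcases alt y with h | h
    · rw [hβy, (z1 y h).2]; linarith [(m2 y).1]
    · rw [hβy, (z2 y h).2]; linarith [(m1 y).1]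
  have β1 : ∀ y, β y ≤ 1 := by
    intro y
    rw [hβy]; linarith [(m1 y).2, (m2 y).2]
  have nb : ∀ a : E3, ∀ᶠ y in 𝓝 a, ‖y - a‖ < 2 * η := by
    intro a
    have cn : Continuous (fun y : E3 => ‖y - a‖) := by fun_prop
    exact (isOpen_Iio.preimage cn).mem_nhds (by simp; linarith)
  have near1 : ∀ y, ‖y - p‖ < 2 * η → α1 y = 1 ∧ α2 y = 0 ∧ β y = 0 := by
    intro y h
    have h2 := z2 y (by linarith [(tri y).1])
    refine ⟨(o1 y h).1, h2.1, ?_⟩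
    rw [hβy, (o1 y h).2, h2.2]; ring
  have near2 : ∀ y, ‖y - q‖ < 2 * η → α2 y = 1 ∧ α1 y = 0 ∧ β y = 0 := by
    intro y h
    have h2 := z1 y (by linarith [(tri y).1])
    refine ⟨(o2 y h).1, h2.1, ?_⟩
    rw [hβy, (o2 y h).2, h2.2]; ring
  have v1 : VanNear β p := (nb p).mono fun y h => (near1 y h).2.2
  have v2 : VanNear β q := (nb q).mono fun y h => (near2 y h).2.2
  have gβ : ∀ y, gradient β y = gradient S1 y + gradient S2 y := by
    intro y
    have := (hg_sub (hg_add (C1.hg cs1 y) (C1.hg cs2 y)) (hasGradientAt_const y c)).gradient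
    rw [sub_zero] at this
    rw [hβd]; exact this
  have eqn : ∀ y, y ≠ p → y ≠ q → A1 y • gradient α1 y + A2 y • gradient α2 y + B y • gradient β y = 0 := by
    intro y h1 h2
    have e1 := (d1 y h1).1
    have e2 := (d2 y h2).1
    rw [gβ, smul_add, ← add_zero (0 : E3)]
    nth_rewrite 1 [← e1]
    rw [← e2]
    abel
  have cvx : ∀ y, y ≠ p → y ≠ q → 0 ≤ inner ℝ (gradient A1 y) (gradient α1 y) + inner ℝ (gradient A2 y) (gradient α2 y) +
      inner ℝ (gradient B y) (gradient β y) := by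
    intro y h1 h2
    have e1 := (d1 y h1).2
    have e2 := (d2 y h2).2
    rw [gβ, inner_add_right]
    rw [show (fun y => B y) = B from rfl] at e1 e2
    linarith
  have cBβ : ContDiff ℝ 1 (fun y => B y * β y) := by
    refine contDiff_iff_contDiffAt.2 fun y => ?_
    by_cases h2 : y = q
    · exact v2.cd cβ fun h => absurd h2 h
    · exact v1.cd cβ fun h => cB y h h2
  obtain ⟨u, hud⟩ : ∃ u : E3 → ℝ, u = fun y => A1 y * α1 y + A2 y * α2 y + B y * β y := ⟨_, rfl⟩
  have eu : ∀ y, u y = A1 y * α1 y + A2 y * α2 y + B y * β y := fun y => by rw [hud]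
  have x1 : ∀ y, 0 ≤ A1 y * α1 y := fun y => mul_nonneg (T1.pos y).le (n1 y).1
  have x2 : ∀ y, 0 ≤ A2 y * α2 y := fun y => mul_nonneg (T2.pos y).le (n2 y).1
  have x3 : ∀ y, 0 ≤ B y * β y := fun y => mul_nonneg (B0 y) (β0 y)
  have pu : ∀ y, 0 ≤ u y := fun y => by rw [eu]; linarith [x1 y, x2 y, x3 y]
  have hu : C1c u := by
    refine ⟨?_, ?_⟩
    · rw [hud]; exact ((T1.cA.mul ca1).add (T2.cA.mul ca2)).add cBβ
    · refine cs_ball (p := p) (S := (L + 2) ^ 2) fun y h => ?_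
      have hL := G.Lpos
      have h1 : L + 2 ≤ ‖y - p‖ := (pow_le_pow_iff_left₀ (by linarith) (norm_nonneg _) (by norm_num)).1 h
      have h2 : L + 1 ≤ ‖y - q‖ := by
        have := (far_tri hpq' y).2
        linarith
      rw [eu, (z1 y (by linarith)).1, (z2 y (by linarith)).1, ← hBy]
      simp only [Yk]
      rw [G.zero _ (by linarith), G.zero _ (by linarith)]
      simp
  refine ⟨u, hu, ?_⟩
  have glue := upper_glue T1.cA T2.cA T1.weak T2.weak ca1 ca2 cβ β0 v1 v2 cB eqn cvx wkB hu pu eu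
  have uc := hu.1.continuous
  have c1 := T1.cA.continuous
  have c2 := T2.cA.continuous
  have c3 := ca1.continuous
  have c4 := ca2.continuous
  have c5 := cBβ.continuous
  have c6 := T1.cW
  have c7 := T2.cW
  have js : ∀ {F : E3 → ℝ}, Continuous F → Integrable (fun y => F y * u y) := by
    intro F hF
    exact hu.integrable_of (by fun_prop) (fun x h _ => by simp [h])
  have I1 : Integrable (fun y => W1 y * A1 y * (α1 y * u y)) := (js (F := fun y => W1 y * A1 y * α1 y) (by fun_prop)).congr
    (Eventually.of_forall fun y => by simp only; ring)
  have I2 : Integrable (fun y => W2 y * A2 y * (α2 y * u y)) := (js (F := fun y => W2 y * A2 y * α2 y) (by fun_prop)).congr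
    (Eventually.of_forall fun y => by simp only; ring)
  have I3 : Integrable (fun y => k * B y * (β y * u y)) := (js (F := fun y => k * (B y * β y)) (by fun_prop)).congr
    (Eventually.of_forall fun y => by simp only; ring)
  have I4 : Integrable (fun y => (W1 y + W2 y + κ) * u y ^ 2) := (js (F := fun y => (W1 y + W2 y + κ) * u y) (by fun_prop)).congr
    (Eventually.of_forall fun y => by simp only; ring)
  have I5 : Integrable (fun y => u y ^ 2) := (js uc).congr (Eventually.of_forall fun y => by simp only; ring)
  have I6 : Integrable (fun y => A1 y * α1 y * u y) := js (F := fun y => A1 y * α1 y) (by fun_prop)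
  have I7 : Integrable (fun y => A2 y * α2 y * u y) := js (F := fun y => A2 y * α2 y) (by fun_prop)
  have hdk : 0 < k - κ := by linarith
  have pw : ∫ y, ((W1 y + W2 y + κ) * u y ^ 2 - W1 y * A1 y * (α1 y * u y) - W2 y * A2 y * (α2 y * u y) - k * B y * (β y * u y))
      ≤ ∫ y, (k * (A1 y * α1 y * u y) + k * (A2 y * α2 y * u y) - (k - κ) / 2 * u y ^ 2) := by
    refine integral_mono (((I4.sub I1).sub I2).sub I3) (((I6.const_mul k).add (I7.const_mul k)).sub (I5.const_mul _)) fun y => ?_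
    simp only
    have w1 : W1 y * (u y - A1 y * α1 y) ≤ τ * u y := by
      by_cases h : ‖y - p‖ < 2 * η
      · obtain ⟨e1, e2, e3⟩ := near1 y h
        rw [show u y - A1 y * α1 y = 0 by rw [eu, e2, e3]; ring]
        rw [mul_zero]; exact mul_nonneg hτ.le (pu y)
      · have h1 := (abs_le.1 (T1.farW y (by linarith))).2
        have h2 : 0 ≤ u y - A1 y * α1 y := by rw [eu]; linarith [x2 y, x3 y]
        calc _ ≤ τ * (u y - A1 y * α1 y) := by gcongr
          _ ≤ _ := by gcongr; linarith [x1 y]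
    have w2 : W2 y * (u y - A2 y * α2 y) ≤ τ * u y := by
      by_cases h : ‖y - q‖ < 2 * η
      · obtain ⟨e1, e2, e3⟩ := near2 y h
        rw [show u y - A2 y * α2 y = 0 by rw [eu, e2, e3]; ring]
        rw [mul_zero]; exact mul_nonneg hτ.le (pu y)
      · have h1 := (abs_le.1 (T2.farW y (by linarith))).2
        have h2 : 0 ≤ u y - A2 y * α2 y := by rw [eu]; linarith [x1 y, x3 y]
        calc _ ≤ τ * (u y - A2 y * α2 y) := by gcongr
          _ ≤ _ := by gcongr; linarith [x2 y]
    have w3 : B y * β y = u y - A1 y * α1 y - A2 y * α2 y := by rw [eu]; ring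
    have y1 := mul_le_mul_of_nonneg_right w1 (pu y)
    have y2 := mul_le_mul_of_nonneg_right w2 (pu y)
    have y3 := mul_le_mul_of_nonneg_right hτ2 (sq_nonneg (u y))
    rw [show k * B y * (β y * u y) = k * (B y * β y) * u y by ring, w3]
    linarith
  have nearI : ∀ (a b : E3) (W A α : E3 → ℝ), ‖b - a‖ = 1 → Site a W A τ η M → Continuous α → (∀ y, 0 ≤ α y ∧ α y ≤ 1) →
      (∀ y, ε ≤ ‖y - a‖ → α y = 0) → (∀ y, B y = Yk g a y + Yk g b y) →
      (∀ y, ‖y - a‖ < ε → u y ≤ A y + B y) → ∫ y, A y * α y * u y ≤ M * (M + 2) * (om * ε) := by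
    intro a b W A α hab T cα n z hB hub
    have cA := T.cA.continuous
    have := near_int (p := a) (g := fun y => A y * α y * u y) (C := M * (M + 2)) (R := ε)
      (by fun_prop) hε.le ?_ ?_
    · exact (le_abs_self _).trans this.2.1
    · intro y h1 h2
      have hr : 0 < ‖y - a‖ := norm_pos_iff.2 (sub_ne_zero.2 h2)
      rcases h1.lt_or_eq with h3 | h3
      · have b1 := T.bd y
        have b2 := G.Bup hab hr (by linarith)
        rw [← hB] at b2
        have b3 : ‖y - a‖ * u y ≤ M + 2 := by
          have := mul_le_mul_of_nonneg_left (hub y h3) hr.le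
          linarith
        have b4 : ‖y - a‖ * (A y * α y) ≤ M := by
          have := mul_le_mul_of_nonneg_left (n y).2 (mul_nonneg hr.le (T.pos y).le)
          linarith
        have p4 : 0 ≤ A y * α y := mul_nonneg (T.pos y).le (n y).1
        rw [abs_of_nonneg (mul_nonneg p4 (pu y)), ← div_eq_mul_inv, le_div_iff₀ (by positivity)]
        calc A y * α y * u y * ‖y - a‖ ^ 2 = (‖y - a‖ * (A y * α y)) * (‖y - a‖ * u y) := by ring
          _ ≤ M * (M + 2) := mul_le_mul b4 b3 (mul_nonneg hr.le (pu y)) hM.le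
      · rw [z y h3.ge]; simp; positivity
    · intro y h
      simp only [z y h.le]; simp
  have J1 : ∫ y, A1 y * α1 y * u y ≤ M * (M + 2) * (om * ε) := by
    refine nearI p q W1 A1 α1 hpq T1 c3 n1 (fun y h => (z1 y h).1) (fun y => (hBy y).symm) fun y h => ?_
    have h2 := z2 y (by linarith [(tri y).1])
    rw [eu, h2.1]
    have := mul_le_mul_of_nonneg_left (n1 y).2 (T1.pos y).le
    have := mul_le_mul_of_nonneg_left (β1 y) (B0 y)
    linarith
  have J2 : ∫ y, A2 y * α2 y * u y ≤ M * (M + 2) * (om * ε) := by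
    refine nearI q p W2 A2 α2 hpq' T2 c4 n2 (fun y h => (z2 y h).1) (fun y => by rw [← hBy, add_comm]) fun y h => ?_
    have h2 := z1 y (by linarith [(tri y).1])
    rw [eu, h2.1]
    have := mul_le_mul_of_nonneg_left (n2 y).2 (T2.pos y).le
    have := mul_le_mul_of_nonneg_left (β1 y) (B0 y)
    linarith
  have J3 : c0 ≤ ∫ y, u y ^ 2 := by
    have hvol : volume.real (Metric.ball (p - (q - p)) (1 / 2)) = volume.real (Metric.ball (0 : E3) (1 / 2)) := by
      simp only [Measure.real]
      rw [Measure.addHaar_ball_center]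
    calc c0 = ∫ y in Metric.ball (p - (q - p)) (1 / 2), (g 2 / 4) ^ 2 := by
          rw [setIntegral_const, hvol, hc0d, smul_eq_mul]; ring
      _ ≤ ∫ y in Metric.ball (p - (q - p)) (1 / 2), u y ^ 2 := by
          refine setIntegral_mono_on (integrableOn_const measure_ball_lt_top.ne) I5.integrableOn measurableSet_ball fun y hy => ?_
          rw [Metric.mem_ball, dist_eq_norm] at hy
          have k1 : 1 / 2 ≤ ‖y - p‖ := by
            have : ‖q - p‖ ≤ ‖y - (p - (q - p))‖ + ‖y - p‖ := by
              have e := norm_sub_le (y - (p - (q - p))) (y - p)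
              rwa [show (y - (p - (q - p))) - (y - p) = q - p by abel] at e
            linarith
          have k2 : ‖y - p‖ ≤ 2 := by
            have : ‖y - p‖ ≤ ‖y - (p - (q - p))‖ + ‖q - p‖ := by
              have e := norm_sub_le (y - (p - (q - p))) (q - p)
              rwa [show (y - (p - (q - p))) - (q - p) = y - p by abel] at e
            linarith
          have k3 : 1 / 2 ≤ ‖y - q‖ := by
            have : ‖(q - p) + (q - p)‖ ≤ ‖y - (p - (q - p))‖ + ‖y - q‖ := by
              have e := norm_sub_le (y - (p - (q - p))) (y - q)
              rwa [show (y - (p - (q - p))) - (y - q) = (q - p) + (q - p) by abel] at e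
            have h2 : ‖(q - p) + (q - p)‖ = 2 := by
              rw [← two_smul ℝ, norm_smul, hpq]; norm_num
            linarith
          have f1 := z1 y (by linarith)
          have f2 := z2 y (by linarith)
          have f3 : u y = B y * c := by rw [eu, hβy, f1.1, f1.2, f2.1, f2.2]; ring
          have f4 : g 2 / 2 ≤ B y := by
            rw [← hBy]
            have : g 2 / 2 ≤ Yk g p y := div_le_div₀ (G.nonneg _) (G.anti k2) (by linarith) k2
            linarith [G.Yn q y]
          have gp := G.nonneg 2
          have f5 : g 2 / 4 ≤ u y := by
            rw [f3]
            calc g 2 / 4 = g 2 / 2 * (1 / 2) := by ring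
              _ ≤ _ := mul_le_mul f4 (by linarith) (by norm_num) (B0 y)
          gcongr
      _ ≤ _ := setIntegral_le_integral I5 (Eventually.of_forall fun y => sq_nonneg _)
  rw [integral_sub (by exact (I4.sub I1).sub I2) I3, integral_sub (by exact I4.sub I1) I2, integral_sub I4 I1,
    integral_sub (by exact (I6.const_mul k).add (I7.const_mul k)) (I5.const_mul _), integral_add (I6.const_mul k) (I7.const_mul k),
    integral_const_mul, integral_const_mul, integral_const_mul] at pw
  rw [integral_add hu.int_grad_sq I4]
  have K1 := mul_le_mul_of_nonneg_left J1 hkpos.le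
  have K2 := mul_le_mul_of_nonneg_left J2 hkpos.le
  have K3 := mul_le_mul_of_nonneg_left J3 (show 0 ≤ (k - κ) / 2 by linarith)
  have K4 : k * (M * (M + 2) * (om * ε)) + k * (M * (M + 2) * (om * ε)) = X * ε := by rw [hXd]; ring
  linarith

lemma Site.mono {p : E3} {W A : E3 → ℝ} {τ η M M' : ℝ} (h : Site p W A τ η M) (hM : M ≤ M') :
    Site p W A τ η M' :=
  ⟨h.cW, h.cA, h.pos, h.weak, h.farW, h.farA, fun y => (h.bd y).trans hM⟩

lemma Qf_add_const {V u : E3 → ℝ} (hV : Continuous V) (hu : C1c u) (c : ℝ) :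
    Qf (fun x => V x + c) u = Qf V u + c * ∫ x, u x ^ 2 := by
  have i1 : Integrable (fun x => ‖gradient u x‖ ^ 2 + V x * u x ^ 2) :=
    hu.int_grad_sq.add (hu.int_sq hV)
  unfold Qf
  rw [← integral_const_mul, ← integral_add i1 (hu.int_sq (continuous_const (y := c)))]
  congr 1; ext x; ring

lemma scaled_pot {V₁ V₂ : E3 → ℝ} {R : E3} (hR : 0 < ‖R‖) (c : ℝ) (w : E3 → ℝ) :
    Qf (fun y => ‖R‖ ^ 2 * ((fun x => V₁ x + V₂ (x - R) + c / ‖R‖ ^ 2) (‖R‖ • y))) w =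
    ∫ y, (‖gradient w y‖ ^ 2 + ((fun y => ‖R‖ ^ 2 * V₁ (‖R‖ • (y - 0))) y +
      (fun y => ‖R‖ ^ 2 * V₂ (‖R‖ • (y - ‖R‖⁻¹ • R))) y + c) * w y ^ 2) := by
  unfold Qf
  congr 1; ext y
  simp only [sub_zero]
  rw [smul_sub, smul_inv_smul₀ hR.ne']
  field_simp

lemma fin_upper {V₁ V₂ : E3 → ℝ} (h1c : Continuous V₁) (h2c : Continuous V₂)
    {β C₀ : ℝ} (hβ : 2 < β) (hC₀ : 0 < C₀)
    (h1b : ∀ x : E3, |V₁ x| ≤ C₀ * (1 + ‖x‖ ^ 2) ^ (-β / 2))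
    (h2b : ∀ x : E3, |V₂ x| ≤ C₀ * (1 + ‖x‖ ^ 2) ^ (-β / 2))
    (h1cr : Crit V₁) (h2cr : Crit V₂) {s κ : ℝ} (hs : 0 < s) (hs1 : s < 1)
    (he : s < Real.exp (-s)) (hκ : κ < s ^ 2) :
    ∃ L : ℝ, 0 < L ∧ ∀ R : E3, L ≤ ‖R‖ → ∃ u, IsTest u ∧
      Qf (fun x => V₁ x + V₂ (x - R) + κ / ‖R‖ ^ 2) u < 0 := by
  obtain ⟨M1, hM1, H1⟩ := site_exists h1c hC₀ hβ h1b h1cr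
  obtain ⟨M2, hM2, H2⟩ := site_exists h2c hC₀ hβ h2b h2cr
  obtain ⟨τ, η, hτ, hη, K⟩ := core_upper (M := max M1 M2) hs hs1 he hκ (lt_max_of_lt_left hM1)
  obtain ⟨L1, hL1, K1⟩ := H1 τ η hτ hη
  obtain ⟨L2, hL2, K2⟩ := H2 τ η hτ hη
  refine ⟨max L1 L2, lt_max_of_lt_left hL1, fun R hR => ?_⟩
  have hR1 := (le_max_left _ _).trans hR
  have hR2 := (le_max_right _ _).trans hR
  have hR0 : 0 < ‖R‖ := hL1.trans_le hR1
  obtain ⟨A1, S1⟩ := K1 ‖R‖ hR1 0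
  obtain ⟨A2, S2⟩ := K2 ‖R‖ hR2 (‖R‖⁻¹ • R)
  obtain ⟨w, hw, hneg⟩ := K 0 (‖R‖⁻¹ • R) _ _ A1 A2
    (by rw [sub_zero, norm_smul, norm_inv, norm_norm, inv_mul_cancel₀ hR0.ne'])
    (S1.mono (le_max_left _ _)) (S2.mono (le_max_right _ _))
  rw [← scaled_pot hR0 κ w] at hneg
  have hv : C1c (fun x => w (‖R‖⁻¹ • x)) := by
    have := hw.aff (inv_ne_zero hR0.ne') 0
    simpa using this
  have hs := (Q_scale (V := fun x => V₁ x + V₂ (x - R) + κ / ‖R‖ ^ 2) hv hR0).1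
  have hww : (fun y => w (‖R‖⁻¹ • (‖R‖ • y))) = w := by
    ext y; rw [inv_smul_smul₀ hR0.ne']
  rw [hww] at hs
  rw [hs] at hneg
  refine moll_Q hv (by fun_prop) ?_
  by_contra hh
  exact absurd hneg (not_lt.2 (mul_nonneg (inv_nonneg.2 hR0.le) (not_lt.1 hh)))

lemma fin_lower {V₁ V₂ : E3 → ℝ} (h1c : Continuous V₁) (h2c : Continuous V₂)
    {β C₀ : ℝ} (hβ : 2 < β) (hC₀ : 0 < C₀)
    (h1b : ∀ x : E3, |V₁ x| ≤ C₀ * (1 + ‖x‖ ^ 2) ^ (-β / 2))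
    (h2b : ∀ x : E3, |V₂ x| ≤ C₀ * (1 + ‖x‖ ^ 2) ^ (-β / 2))
    (h1cr : Crit V₁) (h2cr : Crit V₂) {s t : ℝ} (hs : 0 < s)
    (he : Real.exp (-s) < s) (hst : s < t) :
    ∃ L : ℝ, 0 < L ∧ ∀ R : E3, L ≤ ‖R‖ → ∀ u, IsTest u →
      0 ≤ Qf (fun x => V₁ x + V₂ (x - R) + t ^ 2 / ‖R‖ ^ 2) u := by
  obtain ⟨M1, hM1, H1⟩ := site_exists h1c hC₀ hβ h1b h1cr
  obtain ⟨M2, hM2, H2⟩ := site_exists h2c hC₀ hβ h2b h2cr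
  obtain ⟨τ, η, hτ, hη, K⟩ := core_lower hs he hst
  obtain ⟨L1, hL1, K1⟩ := H1 τ η hτ hη
  obtain ⟨L2, hL2, K2⟩ := H2 τ η hτ hη
  refine ⟨max L1 L2, lt_max_of_lt_left hL1, fun R hR u hu => ?_⟩
  have hR1 := (le_max_left _ _).trans hR
  have hR2 := (le_max_right _ _).trans hR
  have hR0 : 0 < ‖R‖ := hL1.trans_le hR1
  obtain ⟨A1, S1⟩ := K1 ‖R‖ hR1 0
  obtain ⟨A2, S2⟩ := K2 ‖R‖ hR2 (‖R‖⁻¹ • R)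
  have hv : C1c (fun x => u (‖R‖ • x)) := by
    have := hu.c1c.aff hR0.ne' 0
    simpa using this
  have hpos := K 0 (‖R‖⁻¹ • R) _ _ A1 A2 M1 M2
    (by rw [sub_zero, norm_smul, norm_inv, norm_norm, inv_mul_cancel₀ hR0.ne'])
    S1 S2 _ hv
  rw [← scaled_pot hR0 (t ^ 2) _, (Q_scale (V := fun x => V₁ x + V₂ (x - R) + t ^ 2 / ‖R‖ ^ 2) hu.c1c hR0).1] at hpos
  exact nonneg_of_mul_nonneg_right hpos (inv_pos.2 hR0)

lemma root_facts : ∃ b : ℝ, 1 / 2 < b ∧ b < 1 ∧ b = Real.exp (-b) ∧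
    (∀ s, s < b → s < Real.exp (-s)) ∧ (∀ s, b < s → Real.exp (-s) < s) := by
  have h1 : (1 / 2 : ℝ) < Real.exp (-(1 / 2)) := by
    have := Real.add_one_lt_exp (x := -(1 / 2 : ℝ)) (by norm_num)
    linarith
  have h2 : Real.exp (-1) < (1 : ℝ) := by
    rw [Real.exp_lt_one_iff]; norm_num
  have hc : ContinuousOn (fun s : ℝ => s - Real.exp (-s)) (Set.Icc (1 / 2) 1) := by fun_prop
  obtain ⟨b, hb, hb0⟩ := intermediate_value_Ioo (by norm_num) hc
    (show (0 : ℝ) ∈ Set.Ioo _ _ from ⟨by linarith, by linarith⟩)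
  have hb1 : b = Real.exp (-b) := by simp only at hb0; linarith
  refine ⟨b, hb.1, hb.2, hb1, fun s hs => ?_, fun s hs => ?_⟩
  · have : Real.exp (-b) < Real.exp (-s) := Real.exp_lt_exp.2 (by linarith)
    linarith
  · have : Real.exp (-s) < Real.exp (-b) := Real.exp_lt_exp.2 (by linarith)
    linarith

theorem stmt5 (V₁ V₂ : Ed 3 → ℝ) (h1c : Continuous V₁) (h2c : Continuous V₂)
    (β C₀ : ℝ) (hβ : 2 < β) (hC₀ : 0 < C₀)
    (h1b : ∀ x : Ed 3, |V₁ x| ≤ C₀ * (1 + ‖x‖ ^ 2) ^ (-β / 2))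
    (h2b : ∀ x : Ed 3, |V₂ x| ≤ C₀ * (1 + ‖x‖ ^ 2) ^ (-β / 2))
    (h1cr : Crit V₁) (h2cr : Crit V₂) :
    (∃ r₀ : ℝ, 0 < r₀ ∧ ∀ R : Ed 3, r₀ ≤ ‖R‖ → Supercrit (fun x => V₁ x + V₂ (x - R))) ∧
    ∃ b : ℝ, 0 < b ∧ b = Real.exp (-b) ∧
      (∀ b' : ℝ, 0 < b' → b' = Real.exp (-b') → b' = b) ∧
      -(b ^ 2) < -(1 / 4 : ℝ) ∧
      Tendsto (fun R : Ed 3 => ‖R‖ ^ 2 * Energy (fun x => V₁ x + V₂ (x - R)))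
        (comap (fun R : Ed 3 => ‖R‖) atTop) (𝓝 (-(b ^ 2))) := by
  obtain ⟨b, hb0, hb1, hbe, hlt, hgt⟩ := root_facts
  have up := @fin_upper V₁ V₂ h1c h2c β C₀ hβ hC₀ h1b h2b h1cr h2cr
  have low := @fin_lower V₁ V₂ h1c h2c β C₀ hβ hC₀ h1b h2b h1cr h2cr
  refine ⟨?_, b, by linarith, hbe, ?_, by nlinarith, ?_⟩
  · obtain ⟨L, hL, H⟩ := up (s := 1 / 2) (κ := 0) (by norm_num) (by norm_num)
      (hlt _ hb0) (by norm_num)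
    refine ⟨L, hL, fun R hR => ?_⟩
    obtain ⟨u, hu, hn⟩ := H R hR
    simp only [zero_div, add_zero] at hn
    exact ⟨u, hu, hn⟩
  · intro b' _ hb'
    rcases lt_trichotomy b' b with h | h | h
    · have := hlt _ h
      linarith
    · exact h
    · have := hgt _ h
      linarith
  have mem : ∀ {R : Ed 3} {t : ℝ}, 0 < ‖R‖ → (∀ u, IsTest u →
      0 ≤ Qf (fun x => V₁ x + V₂ (x - R) + t ^ 2 / ‖R‖ ^ 2) u) →
      -(t ^ 2 / ‖R‖ ^ 2) ∈ {l : ℝ | ∀ u, IsTest u → l * ∫ x, u x ^ 2 ≤ Qf (fun x => V₁ x + V₂ (x - R)) u} := by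
    intro R t hR H u hu
    have h := H u hu
    rw [Qf_add_const (V := fun x => V₁ x + V₂ (x - R)) (by fun_prop) hu.c1c] at h
    linarith
  have ub : ∀ {R : Ed 3} {κ : ℝ}, (∃ u, IsTest u ∧
      Qf (fun x => V₁ x + V₂ (x - R) + κ / ‖R‖ ^ 2) u < 0) →
      -(κ / ‖R‖ ^ 2) ∈ upperBounds {l : ℝ | ∀ u, IsTest u → l * ∫ x, u x ^ 2 ≤ Qf (fun x => V₁ x + V₂ (x - R)) u} := by
    rintro R κ ⟨u, hu, hn⟩ l hl
    rw [Qf_add_const (V := fun x => V₁ x + V₂ (x - R)) (by fun_prop) hu.c1c] at hn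
    have h1 := hl u hu
    have h2 : 0 ≤ ∫ x, u x ^ 2 := integral_nonneg fun x => sq_nonneg _
    by_contra hh
    have h3 := mul_nonneg (show 0 ≤ l + κ / ‖R‖ ^ 2 by linarith [not_le.1 hh]) h2
    linarith
  have ev : ∀ L : ℝ, ∀ᶠ R : Ed 3 in comap (fun R : Ed 3 => ‖R‖) atTop, L ≤ ‖R‖ := fun L =>
    tendsto_comap.eventually (eventually_ge_atTop L)
  -- arbitrary comparison rates
  obtain ⟨t0, hbt0⟩ := exists_gt b
  obtain ⟨s0, hbs0, hst0⟩ := exists_between hbt0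
  obtain ⟨La, hLa, Ha⟩ := low (by linarith) (hgt _ hbs0) hst0
  obtain ⟨Lb, hLb, Hb⟩ := up (s := 1 / 2) (κ := 0) (by norm_num) (by norm_num)
      (hlt _ hb0) (by norm_num)
  refine tendsto_order.2 ⟨fun a ha => ?_, fun a ha => ?_⟩
  · have hc : Tendsto (fun t : ℝ => -(t ^ 2)) (𝓝[>] b) (𝓝 (-(b ^ 2))) :=
      (Continuous.tendsto (by fun_prop) b).mono_left nhdsWithin_le_nhds
    obtain ⟨t, hta, htb⟩ := ((hc.eventually (lt_mem_nhds ha)).and self_mem_nhdsWithin).exists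
    have htb : b < t := htb
    obtain ⟨s, hbs, hst⟩ := exists_between htb
    obtain ⟨L, hL, H⟩ := low (by linarith) (hgt _ hbs) hst
    filter_upwards [ev L, ev Lb] with R h1 h2
    have hR : 0 < ‖R‖ := hL.trans_le h1
    have h3 := le_csSup ⟨_, ub (Hb R h2)⟩ (mem hR (H R h1))
    change _ ≤ Energy (fun x => V₁ x + V₂ (x - R)) at h3
    have h4 := mul_le_mul_of_nonneg_left h3 (sq_nonneg ‖R‖)
    have h5 : ‖R‖ ^ 2 * -(t ^ 2 / ‖R‖ ^ 2) = -(t ^ 2) := by field_simp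
    linarith
  · have hc : Tendsto (fun t : ℝ => -(t ^ 2)) (𝓝[<] b) (𝓝 (-(b ^ 2))) :=
      (Continuous.tendsto (by fun_prop) b).mono_left nhdsWithin_le_nhds
    have h12 : ∀ᶠ t in 𝓝[<] b, 1 / 2 < t := (lt_mem_nhds hb0).filter_mono nhdsWithin_le_nhds
    obtain ⟨k, ⟨hka, hk2⟩, hkb⟩ := (((hc.eventually (gt_mem_nhds ha)).and h12).and self_mem_nhdsWithin).exists
    have hkb : k < b := hkb
    obtain ⟨s, hks, hsb⟩ := exists_between hkb
    obtain ⟨L, hL, H⟩ := up (s := s) (κ := k ^ 2) (by linarith) (by linarith) (hlt _ hsb) (by nlinarith)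
    filter_upwards [ev L, ev La] with R h1 h2
    have hR : 0 < ‖R‖ := hL.trans_le h1
    have h3 := csSup_le ⟨_, mem hR (Ha R h2)⟩ (ub (H R h1))
    change Energy (fun x => V₁ x + V₂ (x - R)) ≤ _ at h3
    have h4 := mul_le_mul_of_nonneg_left h3 (sq_nonneg ‖R‖)
    have h5 : ‖R‖ ^ 2 * -(k ^ 2 / ‖R‖ ^ 2) = -(k ^ 2) := by field_simp
    linarith
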